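/- There is a constant C such that for every n ≥ 2, every finite field F with |F| = q, and every subgroup Z of the center of SL(n, F), the quotient group SL(n, F)/Z has a presentation with at most C generators and at most C relators whose length is at most C·(1 + log₂ n + log₂ q). -/

import Mathlib

/-- A subgroup contained in the center is normal. -/
theorem normal_of_le_center {G : Type} [Group G] {Z : Subgroup G}
    (hZ : Z ≤ Subgroup.center G) : Z.Normal := by
  constructor
  intro n hn g
  rw [Subgroup.mem_center_iff.mp (hZ hn) g, mul_inv_cancel_right]
  exact hn

/-- `G` has a presentation with at most `g` generators, at most `r` relators, and
length (number of generators plus the total length of the reduced relator words) at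
most `L`. -/
def HasBoundedPresentation (G : Type) [Group G] (g r : ℕ) (L : ℝ) : Prop :=
  ∃ (m : ℕ) (π : FreeGroup (Fin m) →* G) (R : Finset (FreeGroup (Fin m))),
    m ≤ g ∧ Function.Surjective π ∧ R.card ≤ r ∧
    π.ker = Subgroup.normalClosure (R : Set (FreeGroup (Fin m))) ∧
    ((m + ∑ w ∈ R, FreeGroup.norm w : ℕ) : ℝ) ≤ L

namespace SLP

/-! ### Framework: words, enforceable conditions, presentations -/

/-- `w` is represented by a word of length at most `k`. -/
def Len {ι : Type} (w : FreeGroup ι) (k : ℕ) : Prop :=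
  ∃ L : List (ι × Bool), L.length ≤ k ∧ FreeGroup.mk L = w

namespace Len
variable {ι κ : Type} {w v : FreeGroup ι} {k l : ℕ}

theorem mono (h : Len w k) (hkl : k ≤ l) : Len w l :=
  let ⟨L, h1, h2⟩ := h; ⟨L, h1.trans hkl, h2⟩

theorem one : Len (1 : FreeGroup ι) k := ⟨[], by simp, rfl⟩

theorem of (i : ι) : Len (FreeGroup.of i) 1 := ⟨[(i, true)], by simp, rfl⟩

theorem mul (h : Len w k) (h' : Len v l) : Len (w * v) (k + l) := by
  obtain ⟨L, h1, rfl⟩ := h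
  obtain ⟨M, h3, rfl⟩ := h'
  exact ⟨L ++ M, by simp; omega, by simp⟩

theorem inv (h : Len w k) : Len w⁻¹ k := by
  obtain ⟨L, h1, rfl⟩ := h
  exact ⟨FreeGroup.invRev L, by simpa using h1, by simp⟩

theorem map (f : ι → κ) (h : Len w k) : Len (FreeGroup.map f w) k := by
  obtain ⟨L, h1, rfl⟩ := h
  exact ⟨L.map fun x => (f x.1, x.2), by simpa using h1, by simp [FreeGroup.map.mk]⟩

theorem pow (h : Len w k) (n : ℕ) : Len (w ^ n) (n * k) := by
  induction n with
  | zero => simpa using one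
  | succ n ih => rw [pow_succ]; exact (ih.mul h).mono (by ring_nf; rfl)

theorem norm_le [DecidableEq ι] (h : Len w k) : FreeGroup.norm w ≤ k := by
  obtain ⟨L, h1, rfl⟩ := h
  exact FreeGroup.norm_mk_le.trans h1

end Len

/-- List of all words of length at most `k`. -/
noncomputable def ball (ι : Type) [Fintype ι] : ℕ → List (FreeGroup ι)
  | 0 => [1]
  | k + 1 => (((Finset.univ : Finset (Option (ι × Bool))).toList.map
      fun x => x.elim 1 fun y => FreeGroup.mk [y]) ×ˢ ball ι k).map fun p => p.1 * p.2

theorem length_ball (ι : Type) [Fintype ι] (k : ℕ) :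
    (ball ι k).length = (2 * Fintype.card ι + 1) ^ k := by
  induction k with
  | zero => simp [ball]
  | succ k ih =>
    simp [ball, ih, List.length_product, Finset.length_toList, pow_succ]
    ring

theorem mem_ball {ι : Type} [Fintype ι] {k : ℕ} {w : FreeGroup ι} (h : Len w k) :
    w ∈ ball ι k := by
  induction k generalizing w with
  | zero =>
    obtain ⟨L, h1, rfl⟩ := h
    have : L = [] := by simpa using h1
    subst this
    simp [ball, FreeGroup.one_eq_mk]
  | succ k ih =>
    obtain ⟨L, h1, rfl⟩ := h
    simp only [ball, List.mem_map, List.mem_product, Finset.mem_toList, Finset.mem_univ, true_and,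
      Prod.exists]
    cases L with
    | nil => exact ⟨1, 1, ⟨⟨none, rfl⟩, ih Len.one⟩, by simp [FreeGroup.one_eq_mk]⟩
    | cons x L =>
      exact ⟨FreeGroup.mk [x], FreeGroup.mk L, ⟨⟨some x, rfl⟩,
        ih ⟨L, by simpa using h1, rfl⟩⟩, by simp⟩

theorem ball_len {ι : Type} [Fintype ι] {k : ℕ} {w : FreeGroup ι} (h : w ∈ ball ι k) :
    Len w k := by
  induction k generalizing w with
  | zero => simp [ball] at h; subst h; exact Len.one
  | succ k ih =>
    simp only [ball, List.mem_map, List.mem_product, Finset.mem_toList, Finset.mem_univ, true_and,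
      Prod.exists] at h
    obtain ⟨a, b, ⟨⟨x, rfl⟩, hb⟩, rfl⟩ := h
    rw [add_comm]
    refine Len.mul ?_ (ih hb)
    cases x with
    | none => exact Len.one
    | some y => exact ⟨[y], by simp, rfl⟩

/-- The condition `P` on a family `γ' : ι → Γ` is enforced by at most `C` relators of length
at most `L` that hold for `γ`. -/
def Enf {G : Type} [Group G] {ι : Type} (γ : ι → G) (C L : ℕ)
    (P : ∀ (Γ : Type) [Group Γ], (ι → Γ) → Prop) : Prop :=
  ∃ R : List (FreeGroup ι), R.length ≤ C ∧ (∀ w ∈ R, Len w L ∧ FreeGroup.lift γ w = 1) ∧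
    ∀ (Γ : Type) [Group Γ] (γ' : ι → Γ), (∀ w ∈ R, FreeGroup.lift γ' w = 1) → P Γ γ'

def Short {G : Type} [Group G] {ι : Type} (γ : ι → G) (K : ℕ) {Γ : Type} [Group Γ] (γ' : ι → Γ) :
    Prop :=
  ∀ w, Len w K → FreeGroup.lift γ w = 1 → FreeGroup.lift γ' w = 1

def Pres {G : Type} [Group G] {ι : Type} (γ : ι → G) (C L : ℕ) : Prop :=
  Enf γ C L fun Γ _ γ' => ∃ ψ : G →* Γ, ∀ i, ψ (γ i) = γ' i

namespace Enf
variable {G : Type} [Group G] {ι : Type} {γ : ι → G} {C C' L L' : ℕ}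
  {P Q : ∀ (Γ : Type) [Group Γ], (ι → Γ) → Prop}

theorem mono (h : Enf γ C L P) (hC : C ≤ C') (hL : L ≤ L')
    (hPQ : ∀ (Γ : Type) [Group Γ] (γ' : ι → Γ), P Γ γ' → Q Γ γ') : Enf γ C' L' Q := by
  obtain ⟨R, h1, h2, h3⟩ := h
  exact ⟨R, h1.trans hC, fun w hw => ⟨(h2 w hw).1.mono hL, (h2 w hw).2⟩,
    fun Γ _ γ' h => hPQ Γ γ' (h3 Γ γ' h)⟩

theorem and (h : Enf γ C L P) (h' : Enf γ C' L Q) :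
    Enf γ (C + C') L fun Γ _ γ' => P Γ γ' ∧ Q Γ γ' := by
  obtain ⟨R, h1, h2, h3⟩ := h
  obtain ⟨R', h1', h2', h3'⟩ := h'
  refine ⟨R ++ R', by simp; omega, ?_, ?_⟩
  · intro w hw
    rcases List.mem_append.1 hw with hw | hw
    · exact h2 w hw
    · exact h2' w hw
  · intro Γ _ γ' h
    exact ⟨h3 Γ γ' fun w hw => h w (List.mem_append.2 (Or.inl hw)),
      h3' Γ γ' fun w hw => h w (List.mem_append.2 (Or.inr hw))⟩

theorem trivial : Enf γ 0 L fun _ _ _ => True := ⟨[], by simp, by simp, by simp⟩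

theorem word {w : FreeGroup ι} (hw : Len w L) (h1 : FreeGroup.lift γ w = 1) :
    Enf γ 1 L fun _ _ γ' => FreeGroup.lift γ' w = 1 :=
  ⟨[w], by simp, by simp [hw, h1], by simp⟩

theorem word_eq {w v : FreeGroup ι} {l : ℕ} (hw : Len w L) (hv : Len v l)
    (h1 : FreeGroup.lift γ w = FreeGroup.lift γ v) :
    Enf γ 1 (L + l) fun _ _ γ' => FreeGroup.lift γ' w = FreeGroup.lift γ' v :=
  (word (hw.mul hv.inv) (by simp [h1])).mono le_rfl le_rfl fun Γ _ γ' h => by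
    simpa [mul_inv_eq_one] using h

theorem forall_fintype {κ : Type} [Fintype κ] {P : κ → ∀ (Γ : Type) [Group Γ], (ι → Γ) → Prop}
    (h : ∀ k, Enf γ C L (P k)) :
    Enf γ (Fintype.card κ * C) L fun Γ _ γ' => ∀ k, P k Γ γ' := by
  choose R h1 h2 h3 using h
  refine ⟨(Finset.univ : Finset κ).toList.flatMap R, ?_, ?_, ?_⟩
  · rw [List.length_flatMap]
    have : ∀ l : List κ, (l.map fun a => (R a).length).sum ≤ l.length * C := by
      intro l
      induction l with
      | nil => simp
      | cons a l ih => simp [add_mul]; linarith [h1 a]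
    simpa using this Finset.univ.toList
  · intro w hw
    simp only [List.mem_flatMap] at hw
    obtain ⟨k, -, hk⟩ := hw
    exact h2 k w hk
  · intro Γ _ γ' h k
    exact h3 k Γ γ' fun w hw => h w (by simp only [List.mem_flatMap]; exact ⟨k, by simp, hw⟩)

theorem short [Fintype ι] (K : ℕ) :
    Enf γ ((2 * Fintype.card ι + 1) ^ K) K fun _ _ γ' => Short γ K γ' := by
  classical
  refine ⟨(ball ι K).filter fun w => FreeGroup.lift γ w = 1, ?_, ?_, ?_⟩
  · exact (List.length_filter_le _ _).trans (length_ball ι K).le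
  · intro w hw
    simp only [List.mem_filter, decide_eq_true_eq] at hw
    exact ⟨ball_len hw.1, hw.2⟩
  · intro Γ _ γ' h w hw h1
    exact h w (by simp [mem_ball hw, h1])

theorem map {G' : Type} [Group G'] {ι' : Type} {γ2 : ι' → G'} (f : ι → ι') (φ : G →* G')
    (hf : ∀ i, γ2 (f i) = φ (γ i)) (h : Enf γ C L P) :
    Enf γ2 C L fun Γ _ γ' => P Γ (γ' ∘ f) := by
  obtain ⟨R, h1, h2, h3⟩ := h
  have key : ∀ (Γ : Type) [Group Γ] (γ' : ι' → Γ) (w : FreeGroup ι),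
      FreeGroup.lift γ' (FreeGroup.map f w) = FreeGroup.lift (γ' ∘ f) w := by
    intro Γ _ γ' w
    rw [FreeGroup.map_eq_lift]
    have : (FreeGroup.lift γ').comp (FreeGroup.lift (FreeGroup.of ∘ f)) =
        FreeGroup.lift (γ' ∘ f) := by ext i; simp
    exact DFunLike.congr_fun this w
  refine ⟨R.map (FreeGroup.map f), by simpa using h1, ?_, ?_⟩
  · intro w hw
    obtain ⟨v, hv, rfl⟩ := List.mem_map.1 hw
    refine ⟨(h2 v hv).1.map f, ?_⟩
    have : FreeGroup.lift (γ2 ∘ f) = φ.comp (FreeGroup.lift γ) := by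
      ext i; simp [hf]
    rw [key, this]
    simp [(h2 v hv).2]
  · intro Γ _ γ' h
    exact h3 Γ _ fun w hw => by rw [← key]; exact h _ (List.mem_map_of_mem hw)

end Enf

/-- From `Pres` to a bounded presentation. -/
theorem Pres.bounded {G : Type} [Group G] {ι : Type} [Fintype ι] {γ : ι → G} {C L : ℕ}
    (h : Pres γ C L) (hgen : Subgroup.closure (Set.range γ) = ⊤) :
    HasBoundedPresentation G (Fintype.card ι) C ((Fintype.card ι + C * L : ℕ) : ℝ) := by
  classical
  let e := Fintype.equivFin ι
  obtain ⟨R, h1, h2, h3⟩ := Enf.map (γ2 := γ ∘ e.symm) e (MonoidHom.id G) (by simp) h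
  refine ⟨Fintype.card ι, FreeGroup.lift (γ ∘ e.symm), R.toFinset, le_rfl, ?_,
    (List.toFinset_card_le R).trans h1, ?_, ?_⟩
  · rw [← MonoidHom.range_eq_top, FreeGroup.range_lift_eq_closure, ← hgen]
    congr 1
    exact e.symm.surjective.range_comp γ
  · apply le_antisymm
    · set N := Subgroup.normalClosure ((R.toFinset : Finset _) : Set (FreeGroup (Fin (Fintype.card ι))))
      obtain ⟨ψ, hψ⟩ := h3 (FreeGroup (Fin (Fintype.card ι)) ⧸ N)
        (fun i => QuotientGroup.mk' N (FreeGroup.of i)) (by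
          intro w hw
          have : FreeGroup.lift (fun i => QuotientGroup.mk' N (FreeGroup.of i)) =
            QuotientGroup.mk' N := by ext i; simp
          rw [this]
          simp only [QuotientGroup.mk'_apply, QuotientGroup.eq_one_iff]
          exact Subgroup.subset_normalClosure (by simpa using hw))
      have hc : ψ.comp (FreeGroup.lift (γ ∘ e.symm)) = QuotientGroup.mk' N := by
        ext i
        have := hψ (e.symm i)
        simpa using this
      intro w hw
      have hw' : (FreeGroup.lift (γ ∘ e.symm)) w = 1 := hw
      have := DFunLike.congr_fun hc w
      simp only [MonoidHom.comp_apply, hw', map_one, QuotientGroup.mk'_apply] at this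
      exact (QuotientGroup.eq_one_iff w).1 this.symm
    · apply Subgroup.normalClosure_le_normal
      intro w hw
      exact (h2 w (by simpa using hw)).2
  · have : ∑ w ∈ R.toFinset, FreeGroup.norm w ≤ C * L := by
      calc ∑ w ∈ R.toFinset, FreeGroup.norm w ≤ ∑ w ∈ R.toFinset, L :=
            Finset.sum_le_sum fun w hw => (h2 w (by simpa using hw)).1.norm_le
        _ = R.toFinset.card * L := by simp
        _ ≤ C * L := Nat.mul_le_mul_right _ ((List.toFinset_card_le R).trans h1)
    exact_mod_cast Nat.add_le_add_left this _

/-- Quotient by a cyclic central subgroup generated by one of the names. -/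
theorem Pres.quotient {G : Type} [Group G] {ι : Type} {γ : ι → G} {C L : ℕ}
    (h : Pres γ C (L + 1)) (Z : Subgroup G) [Z.Normal] (i0 : ι) (hi : Z = Subgroup.zpowers (γ i0)) :
    Pres (fun i => QuotientGroup.mk' Z (γ i)) (C + 1) (L + 1) := by
  have h1 := Enf.map (γ2 := fun i => QuotientGroup.mk' Z (γ i)) id (QuotientGroup.mk' Z)
    (fun _ => rfl) h
  have hz : QuotientGroup.mk' Z (γ i0) = 1 := by
    simp [QuotientGroup.eq_one_iff, hi]
  have h2 := Enf.word (γ := fun i => QuotientGroup.mk' Z (γ i)) (L := L + 1) (w := FreeGroup.of i0)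
    ((Len.of i0).mono (by omega)) (by simpa using hz)
  refine (h1.and h2).mono le_rfl le_rfl ?_
  rintro Γ _ γ' ⟨⟨ψ, hψ⟩, hw⟩
  have hk : Z ≤ ψ.ker := by
    rw [hi, Subgroup.zpowers_le]
    have := hψ i0
    simp at this hw
    simp [MonoidHom.mem_ker, this, hw]
  exact ⟨QuotientGroup.lift Z ψ hk, fun i => by simpa using hψ i⟩

/-- `x` and `y` are values of the same short word. -/
def Near {G : Type} [Group G] {ι : Type} (γ : ι → G) {Γ : Type} [Group Γ] (γ' : ι → Γ) (k : ℕ)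
    (x : G) (y : Γ) : Prop :=
  ∃ w, Len w k ∧ FreeGroup.lift γ w = x ∧ FreeGroup.lift γ' w = y

namespace Near
variable {G : Type} [Group G] {ι : Type} {γ : ι → G} {Γ : Type} [Group Γ] {γ' : ι → Γ}
  {k l K : ℕ} {x x' : G} {y y' : Γ}

theorem of (i : ι) : Near γ γ' 1 (γ i) (γ' i) := ⟨_, Len.of i, by simp, by simp⟩

theorem one : Near γ γ' k 1 1 := ⟨1, Len.one, by simp, by simp⟩

theorem mono (h : Near γ γ' k x y) (hk : k ≤ l) : Near γ γ' l x y :=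
  let ⟨w, h1, h2⟩ := h; ⟨w, h1.mono hk, h2⟩

theorem mul (h : Near γ γ' k x y) (h' : Near γ γ' l x' y') :
    Near γ γ' (k + l) (x * x') (y * y') := by
  obtain ⟨w, h1, rfl, rfl⟩ := h
  obtain ⟨v, h2, rfl, rfl⟩ := h'
  exact ⟨w * v, h1.mul h2, by simp, by simp⟩

theorem inv (h : Near γ γ' k x y) : Near γ γ' k x⁻¹ y⁻¹ := by
  obtain ⟨w, h1, rfl, rfl⟩ := h
  exact ⟨w⁻¹, h1.inv, by simp, by simp⟩

theorem comm (h : Near γ γ' k x y) (h' : Near γ γ' l x' y') :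
    Near γ γ' (k + l + k + l) (x * x' * x⁻¹ * x'⁻¹) (y * y' * y⁻¹ * y'⁻¹) :=
  ((h.mul h').mul h.inv).mul h'.inv

theorem conj (h : Near γ γ' k x y) (h' : Near γ γ' l x' y') :
    Near γ γ' (k + l + k) (x * x' * x⁻¹) (y * y' * y⁻¹) :=
  (h.mul h').mul h.inv

theorem unique (hs : Short γ K γ') (h : Near γ γ' k x y) (h' : Near γ γ' l x' y')
    (hx : x = x') (hK : k + l ≤ K) : y = y' := by
  obtain ⟨w, h1, rfl, rfl⟩ := h
  obtain ⟨v, h2, rfl, rfl⟩ := h'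
  have := hs (w * v⁻¹) ((h1.mul h2.inv).mono hK) (by simp [hx])
  simpa [mul_inv_eq_one] using this

end Near

end SLP


set_option linter.unusedSectionVars false
set_option linter.unusedSimpArgs false
set_option linter.unusedVariables false

namespace SLP
open scoped commutatorElement

/-! ### Steinberg families, transvections, embeddings -/

/-- Steinberg relations for a family `x i j r`, `i ≠ j`. -/
structure Stein {I R Γ : Type} [Ring R] [Group Γ] (x : I → I → R → Γ) : Prop where
  add : ∀ {i j}, i ≠ j → ∀ r s, x i j (r + s) = x i j r * x i j s
  comm : ∀ {i j k l}, i ≠ j → k ≠ l → j ≠ k → i ≠ l → ∀ r s, Commute (x i j r) (x k l s)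
  mul : ∀ {i j k}, i ≠ j → j ≠ k → i ≠ k → ∀ r s, ⁅x i j r, x j k s⁆ = x i k (r * s)

namespace Stein
variable {I R Γ : Type} [Ring R] [Group Γ] {x : I → I → R → Γ}

theorem zero (h : Stein x) {i j} (hij : i ≠ j) : x i j 0 = 1 := by
  have := h.add hij 0 0
  simpa using this

theorem neg (h : Stein x) {i j} (hij : i ≠ j) (r : R) : x i j (-r) = (x i j r)⁻¹ := by
  have := h.add hij (-r) r
  rw [neg_add_cancel, h.zero hij] at this
  exact eq_inv_of_mul_eq_one_left this.symm

theorem comp (h : Stein x) {J : Type} (f : J → I) (hf : Function.Injective f) :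
    Stein fun i j => x (f i) (f j) :=
  ⟨fun hij => h.add (hf.ne hij), fun h1 h2 h3 h4 => h.comm (hf.ne h1) (hf.ne h2) (hf.ne h3)
    (hf.ne h4), fun h1 h2 h3 => h.mul (hf.ne h1) (hf.ne h2) (hf.ne h3)⟩

theorem prod (h : Stein x) {Γ' : Type} [Group Γ'] {y : I → I → R → Γ'} (h' : Stein y) :
    Stein fun i j r => (x i j r, y i j r) where
  add hij r s := by simp [h.add hij, h'.add hij]
  comm h1 h2 h3 h4 r s := Prod.ext (h.comm h1 h2 h3 h4 r s) (h'.comm h1 h2 h3 h4 r s)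
  mul h1 h2 h3 r s := Prod.ext (h.mul h1 h2 h3 r s) (h'.mul h1 h2 h3 r s)

/-- Conjugation form of the commutator relation. -/
theorem conj (h : Stein x) {i j k} (h1 : i ≠ j) (h2 : j ≠ k) (h3 : i ≠ k) (r s : R) :
    x i j r * x j k s = x j k s * x i k (r * s) * x i j r := by
  have := h.mul h1 h2 h3 r s
  have hc := h.comm h3 h2 h2.symm h3 (r * s) s
  have hc2 := h.comm h3 h1 h3.symm h1 (r * s) r
  rw [commutatorElement_def, mul_inv_eq_iff_eq_mul, mul_inv_eq_iff_eq_mul] at this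
  rw [this, hc.eq]

theorem conj' (h : Stein x) {i j k} (h1 : i ≠ j) (h2 : j ≠ k) (h3 : i ≠ k) (r s : R) :
    x j k s * x i j r = x i j r * x i k (-(r * s)) * x j k s := by
  have := h.conj h1 h2 h3 r s
  have hc := h.comm h3 h1 h3.symm h1 (r * s) r
  have hc' := h.comm h3 h2 h2.symm h3 (r * s) s
  rw [h.neg h3, mul_assoc, ← (h.comm h3 h2 h2.symm h3 (r*s) s).inv_left.symm.eq, ← mul_assoc, this,
    mul_assoc (x j k s), hc.eq]
  group

end Stein

/-- Special linear groups. -/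
abbrev SL (I F : Type) [Fintype I] [DecidableEq I] [CommRing F] : Type :=
  Matrix.SpecialLinearGroup I F

section sl
variable {I J F : Type} [Fintype I] [DecidableEq I] [Fintype J] [DecidableEq J] [CommRing F]

theorem commute_of {a b : SL I F} {A B : Matrix I I F} (ha : a.1 = 1 + A) (hb : b.1 = 1 + B)
    (h1 : A * B = 0) (h2 : B * A = 0) : Commute a b := by
  apply Subtype.ext
  simp only [Matrix.SpecialLinearGroup.coe_mul, ha, hb]
  simp only [mul_add, add_mul, h1, h2, mul_one, one_mul]
  abel

theorem commutator_of {a b c : SL I F} {A B : Matrix I I F} (ha : a.1 = 1 + A) (hb : b.1 = 1 + B)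
    (hc : c.1 = 1 + A * B) (h1 : B * A = 0) (h2 : A * B * B = 0) : ⁅a, b⁆ = c := by
  rw [commutatorElement_def, mul_inv_eq_iff_eq_mul, mul_inv_eq_iff_eq_mul]
  apply Subtype.ext
  simp only [Matrix.SpecialLinearGroup.coe_mul, ha, hb, hc]
  have h3 : A * B * A = 0 := by rw [mul_assoc, h1, mul_zero]
  simp only [mul_add, add_mul, h1, h2, h3, mul_one, one_mul, zero_mul]
  abel

/-- Total version of transvections. -/
def tv (i j : I) (r : F) : SL I F :=
  if h : i ≠ j then Matrix.SpecialLinearGroup.transvection h r else 1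

theorem tv_coe {i j : I} (h : i ≠ j) (r : F) : (tv i j r).1 = 1 + Matrix.single i j r := by
  simp [tv, h, Matrix.SpecialLinearGroup.transvection_coe]

theorem tv_stein : Stein (tv (I := I) (F := F)) where
  add h r s := by simp [tv, h, Matrix.SpecialLinearGroup.transvection_add]
  comm h1 h2 h3 h4 r s := by
    refine commute_of (tv_coe h1 r) (tv_coe h2 s) ?_ ?_
    · rw [Matrix.single_mul_single_of_ne]; exact h3
    · rw [Matrix.single_mul_single_of_ne]; exact h4.symm
  mul {i j k} h1 h2 h3 r s := by
    refine commutator_of (tv_coe h1 r) (tv_coe h2 s) ?_ ?_ ?_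
    · rw [tv_coe h3, Matrix.single_mul_single_same]
    · rw [Matrix.single_mul_single_of_ne]; exact h3.symm
    · rw [Matrix.single_mul_single_same, Matrix.single_mul_single_of_ne]; exact h2.symm

/-- The incidence matrix of a map. -/
def inc (F : Type) [CommRing F] (f : J → I) : Matrix I J F := fun a j => if a = f j then 1 else 0

theorem inc_mul {f : J → I} (hf : Function.Injective f) : (inc F f).transpose * inc F f = 1 := by
  ext i j
  simp [inc, Matrix.mul_apply, Matrix.one_apply, hf.eq_iff, eq_comm]

/-- Embedding of special linear groups along an injection of index sets. -/
def emb (f : J → I) (hf : Function.Injective f) : SL J F →* SL I F where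
  toFun A := ⟨1 + inc F f * (A.1 - 1) * (inc F f).transpose, by
    rw [Matrix.mul_assoc, Matrix.det_one_add_mul_comm, Matrix.mul_assoc, inc_mul hf, mul_one,
      add_sub_cancel, A.2]⟩
  map_one' := by ext; simp
  map_mul' A B := by
    apply Subtype.ext
    simp only [Matrix.SpecialLinearGroup.coe_mul]
    have : ∀ X Y : Matrix J J F, inc F f * X * (inc F f).transpose * (inc F f * Y * (inc F f).transpose)
        = inc F f * (X * Y) * (inc F f).transpose := by
      intro X Y
      calc _ = inc F f * X * ((inc F f).transpose * inc F f) * Y * (inc F f).transpose := by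
            simp only [Matrix.mul_assoc]
        _ = _ := by rw [inc_mul hf]; simp [Matrix.mul_assoc]
    change _ = (1 + inc F f * (A.1 - 1) * (inc F f).transpose) *
      (1 + inc F f * (B.1 - 1) * (inc F f).transpose)
    rw [add_mul, mul_add, mul_add, this, mul_one, one_mul, mul_one]
    simp only [Matrix.mul_sub, Matrix.sub_mul, mul_sub, sub_mul, mul_one, one_mul]
    abel

theorem emb_coe (f : J → I) (hf : Function.Injective f) (A : SL J F) :
    (emb f hf A).1 = 1 + inc F f * (A.1 - 1) * (inc F f).transpose := rfl

theorem inc_mul_mul (f : J → I) (X : Matrix J J F) :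
    inc F f * X * (inc F f).transpose = ∑ i, ∑ j, Matrix.single (f i) (f j) (X i j) := by
  ext a b
  simp only [Matrix.mul_apply, inc, Matrix.transpose_apply, Matrix.sum_apply, Matrix.single_apply]
  rw [Finset.sum_comm]
  refine Finset.sum_congr rfl fun j _ => ?_
  rw [Finset.sum_mul]
  refine Finset.sum_congr rfl fun i _ => ?_
  by_cases h1 : a = f i <;> by_cases h2 : b = f j <;> grind

theorem emb_tv (f : J → I) (hf : Function.Injective f) (i j : J) (r : F) :
    emb f hf (tv i j r) = tv (f i) (f j) r := by
  by_cases h : i = j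
  · subst h; simp [tv]
  · apply Subtype.ext
    rw [emb_coe, tv_coe h, tv_coe (hf.ne h), add_sub_cancel_left]
    congr 1
    rw [inc_mul_mul, Finset.sum_eq_single i, Finset.sum_eq_single j]
    · simp
    · intro b _ hb; simp [hb.symm]
    · simp
    · intro a _ ha
      exact Finset.sum_eq_zero fun b _ => by simp [ha.symm]
    · simp

theorem emb_apply (f : J → I) (hf : Function.Injective f) (A : SL J F) (i j : J) :
    (emb f hf A).1 (f i) (f j) = A.1 i j := by
  rw [emb_coe, inc_mul_mul, Matrix.add_apply]
  simp only [Matrix.sum_apply, Matrix.single_apply, hf.eq_iff]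
  rw [Finset.sum_eq_single i, Finset.sum_eq_single j]
  · simp [Matrix.one_apply, hf.eq_iff]
  · intro b _ hb; simp [hb]
  · simp
  · intro a _ ha
    exact Finset.sum_eq_zero fun b _ => by simp [ha]
  · simp

theorem emb_apply_left (f : J → I) (hf : Function.Injective f) (A : SL J F) {a : I}
    (ha : ∀ i, f i ≠ a) (b : I) : (emb f hf A).1 a b = (1 : Matrix I I F) a b := by
  rw [emb_coe, inc_mul_mul, Matrix.add_apply]
  simp only [Matrix.sum_apply, Matrix.single_apply, ha, false_and, if_false]
  simp

theorem emb_apply_right (f : J → I) (hf : Function.Injective f) (A : SL J F) {b : I}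
    (hb : ∀ i, f i ≠ b) (a : I) : (emb f hf A).1 a b = (1 : Matrix I I F) a b := by
  rw [emb_coe, inc_mul_mul, Matrix.add_apply]
  simp only [Matrix.sum_apply, Matrix.single_apply, hb, and_false, if_false]
  simp

end sl

section gen
variable {I F : Type} [Fintype I] [DecidableEq I] [Field F]

theorem tv_gen2 (H : Subgroup (SL (Fin 2) F)) (h01 : ∀ r, tv 0 1 r ∈ H) (h10 : ∀ r, tv 1 0 r ∈ H) :
    H = ⊤ := by
  rw [eq_top_iff]
  intro A _
  refine Matrix.SL2.transvection_induction (fun A => A ∈ H) ?_ (fun A B => H.mul_mem) A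
  intro i j hij c
  have : ∀ i j : Fin 2, i ≠ j → tv i j c ∈ H := by
    intro i j h
    fin_cases i <;> fin_cases j <;> simp_all
  simpa [tv, hij] using this i j hij

theorem tv_gen [Nontrivial I] (H : Subgroup (SL I F)) (h : ∀ i j, i ≠ j → ∀ r, tv i j r ∈ H) :
    H = ⊤ := by
  rw [eq_top_iff]
  intro A _
  refine Matrix.SpecialLinearGroup.diagonal_transvection_induction' (fun A => A ∈ H) A ?_ ?_
    (fun A B => H.mul_mem)
  · intro i j hij c hc
    have hf : Function.Injective ![i, j] := by
      intro a b
      fin_cases a <;> fin_cases b <;> simp [hij, hij.symm]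
    have : Matrix.SpecialLinearGroup.diag2n hij c hc =
        emb ![i, j] hf (Matrix.SpecialLinearGroup.diag2n zero_ne_one c hc) := by
      apply Subtype.ext
      ext a b
      rw [emb_coe, inc_mul_mul, Matrix.SpecialLinearGroup.diag2n_coe,
        Matrix.SpecialLinearGroup.diag2n_coe]
      simp only [Fin.sum_univ_two, Matrix.add_apply, Matrix.single_apply, Matrix.diagonal_apply,
        Matrix.one_apply, Matrix.sub_apply]
      simp
      by_cases hab : a = b
      · subst hab
        by_cases h1 : a = i
        · subst h1; simp [hij.symm]
        · by_cases h2 : a = j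
          · subst h2; simp [h1, hij]
          · simp [h1, h2, Ne.symm h1, Ne.symm h2, eq_comm]
      · grind
    rw [this]
    have h2 := tv_gen2 (H.comap (emb ![i, j] hf))
      (fun r => by rw [Subgroup.mem_comap, emb_tv]; exact h _ _ hij r)
      (fun r => by rw [Subgroup.mem_comap, emb_tv]; exact h _ _ hij.symm r)
    have : (Matrix.SpecialLinearGroup.diag2n zero_ne_one c hc) ∈ H.comap (emb ![i, j] hf) := by
      rw [h2]; trivial
    exact this
  · intro i j hij r
    have := h i j hij r
    simpa [tv, hij] using this

end gen

/-- Commuting additive families assemble to a homomorphism from vectors. -/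
theorem exists_vec_hom {J F Γ : Type} [Fintype J] [DecidableEq J] [AddCommGroup F] [Group Γ]
    (x : J → F → Γ) (hadd : ∀ j r s, x j (r + s) = x j r * x j s)
    (hcomm : ∀ i j, i ≠ j → ∀ r s, Commute (x i r) (x j s)) :
    ∃ X : (J → F) → Γ, (∀ b c, X (b + c) = X b * X c) ∧ (∀ j r, X (Pi.single j r) = x j r) := by
  let φ : ∀ j : J, Multiplicative F →* Γ := fun j => MonoidHom.mk' (fun r => x j r.toAdd)
    (fun a b => hadd j _ _)
  have hc : Pairwise fun i j => ∀ (a b : Multiplicative F), Commute (φ i a) (φ j b) :=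
    fun i j hij a b => hcomm i j hij _ _
  let Φ := MonoidHom.noncommPiCoprod φ hc
  refine ⟨fun b => Φ fun j => Multiplicative.ofAdd (b j), fun b c => ?_, fun j r => ?_⟩
  · rw [← map_mul]; rfl
  · have := MonoidHom.noncommPiCoprod_mulSingle (hcomm := hc) φ j (Multiplicative.ofAdd r)
    exact Eq.trans rfl (this.trans rfl)

/-- Induction principle for vectors. -/
theorem vec_induction {J F : Type} [Fintype J] [DecidableEq J] [AddCommMonoid F]
    {p : (J → F) → Prop} (h0 : p 0) (h1 : ∀ j r, p (Pi.single j r))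
    (h2 : ∀ b c, p b → p c → p (b + c)) (b : J → F) : p b := by
  rw [← Finset.univ_sum_single b]
  refine Finset.sum_induction _ p h2 h0 fun j _ => h1 j _

end SLP


set_option linter.unusedSectionVars false
set_option linter.unusedSimpArgs false
set_option linter.unusedVariables false

namespace SLP
open scoped commutatorElement
open Matrix

/-! ### Steinberg families give homomorphisms from special linear groups -/

theorem graph_hom {G Γ : Type} [Group G] [Group Γ] (K : Subgroup (G × Γ))
    (h1 : ∀ g, ((1 : G), g) ∈ K → g = 1) (h2 : ∀ a, ∃ g, (a, g) ∈ K) :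
    ∃ ψ : G →* Γ, ∀ a g, (a, g) ∈ K → ψ a = g := by
  choose f hf using h2
  have huniq : ∀ a g g', (a, g) ∈ K → (a, g') ∈ K → g = g' := by
    intro a g g' hg hg'
    have := K.mul_mem hg (K.inv_mem hg')
    simp only [Prod.inv_mk, Prod.mk_mul_mk, mul_inv_cancel] at this
    exact mul_inv_eq_one.1 (h1 _ this)
  refine ⟨MonoidHom.mk' f fun a b => ?_, fun a g h => huniq a _ _ (hf a) h⟩
  exact huniq (a * b) _ _ (hf _) (K.mul_mem (hf a) (hf b))

section RLD
variable {J F Γ : Type} [Fintype J] [DecidableEq J] [Field F] [Group Γ]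

/-- The abstract structure used in the inductive step. -/
structure RLD (R L : (J → F) → Γ) (D : SL J F →* Γ) : Prop where
  addR : ∀ b c, R (b + c) = R b * R c
  addL : ∀ b c, L (b + c) = L b * L c
  DR : ∀ A b, D A * R b = R (b ᵥ* (A⁻¹).1) * D A
  DL : ∀ (A : SL J F) b, D A * L b = L (A.1 *ᵥ b) * D A
  RL : ∀ b w, b ⬝ᵥ w = 0 → ∀ T : SL J F, T.1 = 1 - vecMulVec w b → R b * L w = L w * R b * D T

/-- Equality of left cosets of the parabolic. -/
def PE (R : (J → F) → Γ) (D : SL J F →* Γ) (g h : Γ) : Prop := ∃ b A, h = g * (R b * D A)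

theorem exists_T {b w : J → F} (h : b ⬝ᵥ w = 0) : ∃ T : SL J F, T.1 = 1 - vecMulVec w b := by
  refine ⟨⟨1 - vecMulVec w b, ?_⟩, rfl⟩
  rw [sub_eq_add_neg, ← Matrix.neg_vecMulVec, Matrix.vecMulVec_eq Unit,
    Matrix.det_one_add_replicateCol_mul_replicateRow]
  simp [h]

namespace RLD
variable {R L : (J → F) → Γ} {D : SL J F →* Γ}

theorem R0 (h : RLD R L D) : R 0 = 1 := by simpa using h.addR 0 0
theorem L0 (h : RLD R L D) : L 0 = 1 := by simpa using h.addL 0 0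

theorem refl (h : RLD R L D) (g : Γ) : PE R D g g := ⟨0, 1, by simp [h.R0]⟩

theorem trans (h : RLD R L D) {f g k : Γ} (h1 : PE R D f g) (h2 : PE R D g k) : PE R D f k := by
  obtain ⟨b, A, rfl⟩ := h1
  obtain ⟨c, B, rfl⟩ := h2
  refine ⟨b + c ᵥ* (A⁻¹).1, A * B, ?_⟩
  rw [h.addR, map_mul]
  simp only [mul_assoc]
  congr 2
  rw [← mul_assoc, h.DR]; simp only [mul_assoc]

theorem symm (h : RLD R L D) {f g : Γ} (h1 : PE R D f g) : PE R D g f := by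
  obtain ⟨b, A, rfl⟩ := h1
  refine ⟨(-b) ᵥ* ((A⁻¹)⁻¹).1, A⁻¹, ?_⟩
  rw [← h.DR]
  have : R b * R (-b) = 1 := by rw [← h.addR, add_neg_cancel, h.R0]
  rw [map_inv]
  simp [mul_assoc, this]

theorem left {f g : Γ} (k : Γ) (h1 : PE R D f g) : PE R D (k * f) (k * g) := by
  obtain ⟨b, A, rfl⟩ := h1
  exact ⟨b, A, by simp only [mul_assoc]⟩

theorem rightD (h : RLD R L D) (g : Γ) (A : SL J F) : PE R D (g * D A) g :=
  h.symm ⟨0, A, by simp [h.R0]⟩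

theorem W (h : RLD R L D) {b c v : J → F} (hbc : b ⬝ᵥ v = c ⬝ᵥ v) :
    PE R D (R b * L v) (R c * L v) := by
  have h0 : (c - b) ⬝ᵥ v = 0 := by simp [sub_dotProduct, hbc]
  obtain ⟨T, hT⟩ := exists_T h0
  refine ⟨c - b, T, ?_⟩
  have := h.RL _ _ h0 T hT
  calc R c * L v = R b * (R (c - b) * L v) := by rw [← mul_assoc, ← h.addR]; simp
    _ = _ := by rw [this]; simp only [mul_assoc]

theorem indep (h : RLD R L D) {b v w : J → F} (hbw : b ⬝ᵥ w = 0) :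
    PE R D (L w * (R b * L v)) (R b * L (v + (1 + b ⬝ᵥ v) • w)) := by
  obtain ⟨T, hT⟩ := exists_T (b := -b) (w := w) (by simp [hbw])
  obtain ⟨T', hT'⟩ := exists_T hbw
  have hTT : T' * T = 1 := by
    apply Subtype.ext
    simp only [Matrix.SpecialLinearGroup.coe_mul, hT, hT', sub_mul, mul_sub, one_mul, mul_one,
      vecMulVec_mul_vecMulVec, vecMulVec_neg, Matrix.SpecialLinearGroup.coe_one]
    have : vecMulVec w b * vecMulVec w b = 0 := by
      rw [Matrix.vecMulVec_mul_vecMulVec, hbw]; simp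
    simp [this]
  have h1 : L w * R b = R b * L w * D T := by
    rw [h.RL b w hbw T' hT', mul_assoc, ← map_mul, hTT]; simp
  have h2 : T.1 *ᵥ v = v + (b ⬝ᵥ v) • w := by
    rw [hT, sub_mulVec, vecMulVec_neg, neg_mulVec, vecMulVec_mulVec]
    simp
  have h3 : L w * (R b * L v) = R b * L (v + (1 + b ⬝ᵥ v) • w) * D T := by
    rw [← mul_assoc, h1, mul_assoc, h.DL, h2, ← mul_assoc, mul_assoc (R b), ← h.addL]
    congr 3
    module
  rw [h3]
  exact h.rightD _ _

theorem exists_dot {v : J → F} (hv : v ≠ 0) (s : F) : ∃ b : J → F, b ⬝ᵥ v = s := by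
  obtain ⟨j, hj⟩ := Function.ne_iff.1 hv
  exact ⟨Pi.single j (s / v j), by simp at hj; simp [hj]⟩

theorem exists_dot2 {v w : J → F} (hv : v ∉ Submodule.span F {w}) (s : F) :
    ∃ b : J → F, b ⬝ᵥ w = 0 ∧ b ⬝ᵥ v = s := by
  obtain ⟨f, hf, hw⟩ := Submodule.exists_le_ker_of_notMem hv
  have key : ∀ u : J → F, (fun j => f (Pi.single j 1)) ⬝ᵥ u = f u := by
    intro u
    conv_rhs => rw [← Finset.univ_sum_single u, map_sum]
    refine Finset.sum_congr rfl fun j _ => ?_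
    have : (Pi.single j (u j) : J → F) = u j • Pi.single j 1 := by
      ext k; by_cases h : k = j
      · subst h; simp
      · simp [h]
    rw [this, map_smul, smul_eq_mul, mul_comm]
  have hw0 : f w = 0 := hw (Submodule.mem_span_singleton_self w)
  refine ⟨(s / f v) • fun j => f (Pi.single j 1), ?_, ?_⟩
  · rw [smul_dotProduct, key, hw0]; simp
  · rw [smul_dotProduct, key, smul_eq_mul, div_mul_cancel₀ _ hf]

theorem exists_not_span [Nontrivial J] (v : J → F) : ∃ w : J → F, w ∉ Submodule.span F {v} := by
  by_contra! h
  obtain ⟨i, j, hij⟩ := exists_pair_ne J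
  obtain ⟨a, ha⟩ := Submodule.mem_span_singleton.1 (h (Pi.single i 1))
  obtain ⟨b, hb⟩ := Submodule.mem_span_singleton.1 (h (Pi.single j 1))
  have h1 := congrFun ha i
  have h2 := congrFun ha j
  have h3 := congrFun hb i
  have h4 := congrFun hb j
  simp [hij, hij.symm] at h1 h2 h3 h4
  rcases h2 with h2 | h2 <;> simp_all

theorem main1 (h : RLD R L D) {s : F} {v w b b' : J → F} (hvw : v ∉ Submodule.span F {w} ∨ s = 1)
    (hb : 1 + b ⬝ᵥ v = s) (hb' : 1 + b' ⬝ᵥ (v + s • w) = s) :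
    PE R D (L w * (R b * L v)) (R b' * L (v + s • w)) := by
  have : ∃ c : J → F, c ⬝ᵥ w = 0 ∧ 1 + c ⬝ᵥ v = s := by
    rcases hvw with hvw | rfl
    · obtain ⟨c, h1, h2⟩ := exists_dot2 hvw (s - 1)
      exact ⟨c, h1, by rw [h2]; ring⟩
    · exact ⟨0, by simp, by simp⟩
  obtain ⟨c, hc, hcv⟩ := this
  have h1 := left (L w) (h.W (b := b) (c := c) (v := v) (by linear_combination hb - hcv))
  have h2 := h.indep (v := v) hc
  rw [hcv] at h2
  refine h.trans h1 (h.trans h2 (h.W ?_))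
  rw [dotProduct_add c, dotProduct_smul, hc]
  rw [smul_zero, add_zero]
  linear_combination hcv - hb'

theorem main2 [Nontrivial J] (h : RLD R L D) {s : F} {v w b b' : J → F} (hv : v ≠ 0)
    (hv2 : v + s • w ≠ 0)
    (hb : 1 + b ⬝ᵥ v = s) (hb' : 1 + b' ⬝ᵥ (v + s • w) = s) :
    PE R D (L w * (R b * L v)) (R b' * L (v + s • w)) := by
  by_cases hvw : v ∉ Submodule.span F {w} ∨ s = 1
  · exact h.main1 hvw hb hb'
  push Not at hvw
  obtain ⟨hvw, hs⟩ := hvw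
  obtain ⟨μ, rfl⟩ := Submodule.mem_span_singleton.1 hvw
  have hμ : μ ≠ 0 := fun h => hv (by simp [h])
  have hw : w ≠ 0 := fun h => hv (by simp [h])
  obtain ⟨w1, hw1⟩ := exists_not_span w
  have hli : ∀ a c : F, a • w + c • w1 = 0 → c = 0 ∧ a = 0 := by
    intro a c hac
    have hc : c = 0 := by
      by_contra hc
      apply hw1
      rw [Submodule.mem_span_singleton]
      refine ⟨-(c⁻¹ * a), ?_⟩
      have : w1 = c⁻¹ • (c • w1) := by rw [smul_smul, inv_mul_cancel₀ hc, one_smul]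
      rw [this, eq_neg_of_add_eq_zero_right hac, smul_neg, smul_smul, neg_smul]
    refine ⟨hc, ?_⟩
    subst hc
    simpa [hw] using hac
  have hv1 : μ • w + s • w1 ≠ 0 := fun h0 => hμ (hli _ _ h0).2
  obtain ⟨b1, hb1⟩ := exists_dot hv1 (s - 1)
  have h1 := h.main1 (s := s) (v := μ • w) (w := w1) (b := b) (b' := b1) (Or.inl (by
    intro hm
    obtain ⟨a, ha⟩ := Submodule.mem_span_singleton.1 hm
    exact hμ (hli μ (-a) (by rw [← ha]; module)).2)) hb (by rw [hb1]; ring)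
  have e : μ • w + s • w1 + s • (w - w1) = μ • w + s • w := by module
  have h2 := h.main1 (s := s) (v := μ • w + s • w1) (w := w - w1) (b := b1) (b' := b') (Or.inl (by
    intro hm
    obtain ⟨a, ha⟩ := Submodule.mem_span_singleton.1 hm
    obtain ⟨h3, h4⟩ := hli (μ - a) (s + a) (by
      have : (μ - a) • w + (s + a) • w1 = (μ • w + s • w1) - a • (w - w1) := by module
      rw [this, ha, sub_self])
    apply hv2
    rw [← add_smul]
    rw [show μ + s = 0 by linear_combination h3 + h4, zero_smul])) (by rw [hb1]; ring)
    (by rw [e]; exact hb')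
  rw [e] at h2
  have h3 := left (L (w - w1)) h1
  rw [← mul_assoc, ← h.addL, sub_add_cancel] at h3
  exact h.trans h3 h2

/-- The big set. -/
def SS (R L : (J → F) → Γ) (D : SL J F →* Γ) (g : Γ) : Prop :=
  ∃ w b v, PE R D (L w * (R b * L v)) g

theorem SS_L (h : RLD R L D) (u : J → F) {g : Γ} (hg : SS R L D g) : SS R L D (L u * g) := by
  obtain ⟨w, b, v, hg⟩ := hg
  refine ⟨u + w, b, v, ?_⟩
  have := left (L u) hg
  rwa [← mul_assoc, ← h.addL] at this

theorem SS_D (h : RLD R L D) (A : SL J F) {g : Γ} (hg : SS R L D g) : SS R L D (D A * g) := by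
  obtain ⟨w, b, v, hg⟩ := hg
  refine ⟨A.1 *ᵥ w, b ᵥ* (A⁻¹).1, A.1 *ᵥ v, h.trans (h.symm ?_) (left (D A) hg)⟩
  have : D A * (L w * (R b * L v)) = L (A.1 *ᵥ w) * (R (b ᵥ* (A⁻¹).1) * L (A.1 *ᵥ v)) * D A := by
    rw [← mul_assoc, h.DL, mul_assoc, ← mul_assoc (D A), h.DR, mul_assoc (R _), h.DL]
    simp only [mul_assoc]
  rw [this]
  exact h.rightD _ _

theorem SS_R [Nontrivial J] (h : RLD R L D) (c : J → F) {g : Γ} (hg : SS R L D g) :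
    SS R L D (R c * g) := by
  obtain ⟨w, b, v, hg⟩ := hg
  by_cases hv : v = 0
  · subst hv
    refine ⟨0, c, w, h.trans ?_ (left (R c) hg)⟩
    rw [h.L0, one_mul, mul_one]
    refine left _ ⟨b, 1, by simp⟩
  · set s := 1 + b ⬝ᵥ v with hs
    by_cases hv2 : v + s • w = 0
    · have hs0 : s ≠ 0 := by rintro h0; simp [h0, hv] at hv2
      obtain ⟨w', hw'0, hcw'⟩ : ∃ w' : J → F, w' ≠ 0 ∧ c ⬝ᵥ w' = 0 := by
        obtain ⟨i, j, hij⟩ := exists_pair_ne J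
        by_cases hc : c i = 0
        · exact ⟨Pi.single i 1, by simp, by simp [hc]⟩
        · refine ⟨Pi.single j (c i) - Pi.single i (c j), ?_, ?_⟩
          · intro h0
            have := congrFun h0 j
            simp [hij.symm] at this
            exact hc this
          · rw [dotProduct_sub]; simp; ring
      have hvw : v + s • (w - w') = -s • w' := by
        rw [smul_sub, ← add_sub_assoc, hv2]; simp
      have hne : -s • w' ≠ 0 := by simp [hs0, hw'0]
      obtain ⟨b', hb'⟩ := exists_dot hne (s - 1)
      have h1 := h.main2 (w := w - w') (b := b) (b' := b') (s := s) hv (by rw [hvw]; exact hne)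
        hs.symm (by rw [hvw, hb']; ring)
      rw [hvw] at h1
      have h2 := left (L w') h1
      rw [← mul_assoc, ← h.addL, add_sub_cancel] at h2
      obtain ⟨T, hT⟩ := exists_T hcw'
      have h3 : R c * (L w' * (R b' * L (-s • w'))) =
          L w' * (R (c + b' ᵥ* (T⁻¹).1) * L (-s • w')) * D T := by
        have e : T.1 *ᵥ (-s • w') = -s • w' := by
          rw [hT, sub_mulVec, vecMulVec_mulVec]
          simp [hcw']
        calc _ = L w' * R c * (D T * R b') * L (-s • w') := by
              rw [← mul_assoc, h.RL c w' hcw' T hT]; simp only [mul_assoc]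
          _ = L w' * R c * R (b' ᵥ* (T⁻¹).1) * (D T * L (-s • w')) := by
              rw [h.DR]; simp only [mul_assoc]
          _ = _ := by rw [h.DL, e, h.addR]; simp only [mul_assoc]
      refine ⟨w', c + b' ᵥ* (T⁻¹).1, -s • w', ?_⟩
      have h4 := h.trans (left (R c) (h.symm h2)) (left (R c) hg)
      rw [h3] at h4
      exact h.trans (h.symm (h.rightD _ T)) h4
    · obtain ⟨b', hb'⟩ := exists_dot hv2 (s - 1)
      have h1 := h.main2 (w := w) (b := b) (b' := b') hv hv2 hs.symm (by rw [hb']; ring)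
      refine ⟨0, c + b', v + s • w, ?_⟩
      rw [h.L0, one_mul, h.addR, mul_assoc]
      exact h.trans (left (R c) (h.symm h1)) (left (R c) hg)

theorem SS_final (h : RLD R L D) {w b v : J → F} {g : Γ} (hg : PE R D (L w * (R b * L v)) g)
    (hbv : b ⬝ᵥ v = 0) (hw : w = -v) : ∃ c A, g = R c * D A := by
  obtain ⟨T, hT⟩ := exists_T hbv
  have : PE R D 1 (L w * (R b * L v)) := by
    refine ⟨b, T, ?_⟩
    rw [h.RL b v hbv T hT, hw, ← mul_assoc, ← mul_assoc, ← h.addL]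
    simp [h.L0]
  obtain ⟨c, A, hc⟩ := h.trans this hg
  exact ⟨c, A, by simpa using hc⟩

end RLD
end RLD

end SLP


set_option linter.unusedSectionVars false
set_option linter.unusedSimpArgs false
set_option linter.unusedVariables false

namespace SLP
open scoped commutatorElement
open Matrix

theorem mulVec_single_add {J F : Type} [Fintype J] [DecidableEq J] [Field F] (i j : J) (r : F)
    (u : J → F) : (1 + Matrix.single i j r) *ᵥ u = u + Pi.single i (r * u j) := by
  rw [add_mulVec, one_mulVec, Matrix.single_mulVec]
  congr 1

theorem vecMul_single_add {J F : Type} [Fintype J] [DecidableEq J] [Field F] (i j : J) (r : F)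
    (u : J → F) : u ᵥ* (1 + Matrix.single i j r) = u + Pi.single j (u i * r) := by
  rw [vecMul_add, vecMul_one]
  congr 1
  ext k
  simp [vecMul, dotProduct, Matrix.single_apply, Pi.single_apply]
  by_cases h : k = j
  · simp [h, eq_comm]
  · simp [h, Ne.symm h]

section step
variable {J F Γ : Type} [Fintype J] [DecidableEq J] [Field F] [Group Γ] [Nontrivial J]

theorem exists_RLD {x : Option J → Option J → F → Γ} (hx : Stein x) (D : SL J F →* Γ)
    (hD : ∀ i j, i ≠ j → ∀ r, D (tv i j r) = x (some i) (some j) r) :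
    ∃ R L : (J → F) → Γ, RLD R L D ∧ (∀ j r, R (Pi.single j r) = x none (some j) r) ∧
      (∀ j r, L (Pi.single j r) = x (some j) none r) := by
  have hs : ∀ {i j : J}, i ≠ j → some i ≠ some j := fun h => by simpa using h
  obtain ⟨R, hR, hR1⟩ := exists_vec_hom (fun j r => x none (some j) r)
    (fun j r s => hx.add (by simp) r s)
    (fun i j hij r s => hx.comm (by simp) (by simp) (by simp) (by simp) r s)
  obtain ⟨L, hL, hL1⟩ := exists_vec_hom (fun j r => x (some j) none r)
    (fun j r s => hx.add (by simp) r s)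
    (fun i j hij r s => hx.comm (by simp) (by simp) (by simp) (by simp) r s)
  have R0 : R 0 = 1 := by simpa using hR 0 0
  have L0 : L 0 = 1 := by simpa using hL 0 0
  have hinv : ∀ {i j : J}, i ≠ j → ∀ r : F, (tv i j r)⁻¹ = tv i j (-r) := fun h r =>
    (tv_stein.neg h r).symm
  have DR : ∀ (A : SL J F) b, D A * R b = R (b ᵥ* (A⁻¹).1) * D A := by
    intro A
    let H : Subgroup (SL J F) :=
      { carrier := {A | ∀ b, D A * R b = R (b ᵥ* (A⁻¹).1) * D A}
        one_mem' := by intro b; simp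
        mul_mem' := by
          intro A B hA hB b
          have e : b ᵥ* ((A * B)⁻¹).1 = (b ᵥ* (B⁻¹).1) ᵥ* (A⁻¹).1 := by
            rw [_root_.mul_inv_rev, Matrix.SpecialLinearGroup.coe_mul, vecMul_vecMul]
          rw [e, map_mul, mul_assoc, hB b, ← mul_assoc, hA, mul_assoc]
        inv_mem' := by
          intro A hA b
          have := hA (b ᵥ* A.1)
          have e : b ᵥ* A.1 ᵥ* (A⁻¹).1 = b := by
            rw [vecMul_vecMul, ← Matrix.SpecialLinearGroup.coe_mul, mul_inv_cancel]; simp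
          rw [e] at this
          change D A⁻¹ * R b = R (b ᵥ* ((A⁻¹)⁻¹).1) * D A⁻¹
          rw [inv_inv, map_inv, inv_mul_eq_iff_eq_mul, ← mul_assoc, this]; simp }
    have : H = ⊤ := by
      apply tv_gen
      intro i j hij r b
      rw [hD i j hij, hinv hij, tv_coe hij, vecMul_single_add, hR, hR1]
      refine vec_induction (p := fun b => x (some i) (some j) r * R b = R b *
        x none (some j) (b i * -r) * x (some i) (some j) r) ?_ ?_ ?_ b
      · simp [R0, hx.zero]
      · intro k s
        rw [hR1]
        by_cases hk : k = i
        · subst hk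
          rw [Pi.single_eq_same, hx.conj' (by simp) (hs hij) (by simp)]
          simp
        · rw [Pi.single_eq_of_ne (Ne.symm hk), zero_mul, hx.zero (by simp), mul_one]
          exact hx.comm (hs hij) (by simp) (by simp) (by simpa using Ne.symm hk) _ _
      · intro b c hb hc
        have h1 : Commute (x none (some j) (b i * -r)) (R c) := by
          have : x none (some j) (b i * -r) = R (Pi.single j (b i * -r)) := (hR1 _ _).symm
          rw [this]
          change _ * _ = _ * _
          rw [← hR, ← hR, add_comm]
        rw [hR, ← mul_assoc, hb, Pi.add_apply, add_mul, hx.add (by simp), mul_assoc _ _ (R c), hc]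
        have := h1.eq
        simp only [← mul_assoc]
        rw [mul_assoc (R b) _ (R c), this]
        simp only [mul_assoc]
    have hA : A ∈ H := by rw [this]; trivial
    exact hA
  have DL : ∀ (A : SL J F) b, D A * L b = L (A.1 *ᵥ b) * D A := by
    intro A
    let H : Subgroup (SL J F) :=
      { carrier := {A | ∀ b, D A * L b = L (A.1 *ᵥ b) * D A}
        one_mem' := by intro b; simp
        mul_mem' := by
          intro A B hA hB b
          have e : (A * B).1 *ᵥ b = A.1 *ᵥ (B.1 *ᵥ b) := by
            rw [Matrix.SpecialLinearGroup.coe_mul, mulVec_mulVec]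
          rw [e, map_mul, mul_assoc, hB b, ← mul_assoc, hA, mul_assoc]
        inv_mem' := by
          intro A hA b
          have := hA ((A⁻¹).1 *ᵥ b)
          have e : A.1 *ᵥ (A⁻¹).1 *ᵥ b = b := by
            rw [mulVec_mulVec, ← Matrix.SpecialLinearGroup.coe_mul, mul_inv_cancel]; simp
          rw [e] at this
          change D A⁻¹ * L b = L ((A⁻¹).1 *ᵥ b) * D A⁻¹
          rw [map_inv, inv_mul_eq_iff_eq_mul, ← mul_assoc, this]; simp }
    have : H = ⊤ := by
      apply tv_gen
      intro i j hij r b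
      rw [hD i j hij, tv_coe hij, mulVec_single_add, hL, hL1]
      refine vec_induction (p := fun b => x (some i) (some j) r * L b = L b *
        x (some i) none (r * b j) * x (some i) (some j) r) ?_ ?_ ?_ b
      · simp [L0, hx.zero]
      · intro k s
        rw [hL1]
        by_cases hk : k = j
        · subst hk
          rw [Pi.single_eq_same, hx.conj (hs hij) (by simp) (by simp)]
        · rw [Pi.single_eq_of_ne (Ne.symm hk), mul_zero, hx.zero (by simp), mul_one]
          exact hx.comm (hs hij) (by simp) (by simpa using Ne.symm hk) (by simp) _ _
      · intro b c hb hc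
        have h1 : Commute (x (some i) none (r * b j)) (L c) := by
          have : x (some i) none (r * b j) = L (Pi.single i (r * b j)) := (hL1 _ _).symm
          rw [this]
          change _ * _ = _ * _
          rw [← hL, ← hL, add_comm]
        rw [hL, ← mul_assoc, hb, Pi.add_apply, mul_add, hx.add (by simp), mul_assoc _ _ (L c), hc]
        have := h1.eq
        simp only [← mul_assoc]
        rw [mul_assoc (L b) _ (L c), this]
        simp only [mul_assoc]
    have hA : A ∈ H := by rw [this]; trivial
    exact hA
  refine ⟨R, L, ⟨hR, hL, DR, DL, ?_⟩, hR1, hL1⟩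
  -- the commutation of `R b` and `L w` for `b ⬝ᵥ w = 0`
  have base : ∀ (j : J) (l : F) (b : J → F), b j = 0 → ∀ T : SL J F,
      T.1 = 1 - vecMulVec (Pi.single j l) b → R b * L (Pi.single j l) = L (Pi.single j l) * R b * D T := by
    intro j l b hb
    have hb' : ∃ c : J → F, b = Function.update c j 0 := ⟨b, by rw [← hb]; simp⟩
    obtain ⟨c, rfl⟩ := hb'
    clear hb
    refine vec_induction (p := fun c => ∀ T : SL J F,
      T.1 = 1 - vecMulVec (Pi.single j l) (Function.update c j 0) →
      R (Function.update c j 0) * L (Pi.single j l) =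
        L (Pi.single j l) * R (Function.update c j 0) * D T) ?_ ?_ ?_ c
    · intro T hT
      have h0 : Function.update (0 : J → F) j 0 = 0 := by simp
      have : T = 1 := Subtype.ext (by rw [hT, h0]; simp)
      rw [this, h0]; simp [R0]
    · intro k s T hT
      by_cases hk : k = j
      · subst hk
        have h0 : Function.update (Pi.single k s : J → F) k 0 = 0 := by
          ext m; by_cases hm : m = k
          · subst hm; simp
          · simp [hm]
        have : T = 1 := Subtype.ext (by rw [hT, h0]; simp)
        rw [this, h0]; simp [R0]
      · have h0 : Function.update (Pi.single k s : J → F) j 0 = Pi.single k s := by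
          ext m; by_cases hm : m = j
          · subst hm; simp [Ne.symm hk]
          · simp [hm]
        rw [h0] at hT ⊢
        have hT' : T = tv j k (-(l * s)) := by
          apply Subtype.ext
          rw [hT, tv_coe (Ne.symm hk)]
          ext a b
          simp [vecMulVec_apply, Matrix.single_apply, Pi.single_apply]
          grind
        rw [hT', hR1, hL1, hD j k (Ne.symm hk)]
        rw [hx.conj' (by simp) (by simp) (hs (Ne.symm hk)), mul_assoc, mul_assoc]
        congr 1
        exact hx.comm (hs (Ne.symm hk)) (by simp) (by simp) (hs (Ne.symm hk)) _ _
    · intro b c hb hc T hT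
      have h0 : Function.update (b + c) j 0 = Function.update b j 0 + Function.update c j 0 := by
        ext m; by_cases hm : m = j
        · subst hm; simp
        · simp [hm]
      rw [h0] at hT ⊢
      set b' := Function.update b j 0 with hb'
      set c' := Function.update c j 0 with hc'
      have hbj : b' ⬝ᵥ Pi.single j l = 0 := by simp [hb']
      have hcj : c' ⬝ᵥ Pi.single j l = 0 := by simp [hc']
      obtain ⟨T1, hT1⟩ := exists_T hbj
      obtain ⟨T2, hT2⟩ := exists_T hcj
      have hTT : T = T1 * T2 := by
        apply Subtype.ext
        rw [Matrix.SpecialLinearGroup.coe_mul, hT, hT1, hT2]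
        have e : vecMulVec (Pi.single j l) b' * vecMulVec (Pi.single j l) c' = 0 := by
          rw [Matrix.vecMulVec_mul_vecMulVec, hbj]; simp
        rw [sub_mul, mul_sub, mul_sub, e, vecMulVec_add]
        simp
        abel
      have e : c' ᵥ* (T1⁻¹).1 = c' := by
        have : c' ᵥ* T1.1 = c' := by
          rw [hT1, vecMul_sub, vecMul_vecMulVec, hcj]; simp
        conv_lhs => rw [← this]
        rw [vecMul_vecMul, ← Matrix.SpecialLinearGroup.coe_mul, mul_inv_cancel]; simp
      have h1 := DR T1 c'
      rw [e] at h1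
      calc R (b' + c') * L (Pi.single j l) = R b' * (R c' * L (Pi.single j l)) := by
            rw [hR, mul_assoc]
        _ = (R b' * L (Pi.single j l)) * R c' * D T2 := by rw [hc T2 hT2]; simp only [mul_assoc]
        _ = L (Pi.single j l) * R b' * (D T1 * R c') * D T2 := by
            rw [hb T1 hT1]; simp only [mul_assoc]
        _ = _ := by rw [h1, hTT, map_mul, hR]; simp only [mul_assoc]
  intro b w hbw T hT
  by_cases hw : w = 0
  · subst hw
    have : T = 1 := Subtype.ext (by rw [hT]; simp)
    simp [this, L0]
  · obtain ⟨j⟩ : Nonempty J := inferInstance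
    have hj : (Pi.single j 1 : J → F) ≠ 0 := by simp
    obtain ⟨B, hB⟩ := MulAction.exists_smul_eq (SL J F) (Projectivization.mk F w hw)
      (Projectivization.mk F (Pi.single j 1 : J → F) hj)
    have hB' : ∃ l : F, B.1 *ᵥ w = Pi.single j l := by
      rw [Projectivization.smul_mk, Projectivization.mk_eq_mk_iff'] at hB
      obtain ⟨a, ha⟩ := hB
      refine ⟨a, ?_⟩
      change a • _ = B.1 *ᵥ w at ha
      rw [← ha]
      ext k; simp [Pi.single_apply]
    obtain ⟨l, hl⟩ := hB'
    set T' := B * T * B⁻¹ with hT'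
    have hB1 : (B⁻¹).1 * B.1 = 1 := by
      rw [← Matrix.SpecialLinearGroup.coe_mul, inv_mul_cancel]; simp
    have hB2 : B.1 * (B⁻¹).1 = 1 := by
      rw [← Matrix.SpecialLinearGroup.coe_mul, mul_inv_cancel]; simp
    have h1 := base j l (b ᵥ* (B⁻¹).1) (by
      have e : (b ᵥ* (B⁻¹).1) ⬝ᵥ (B.1 *ᵥ w) = 0 := by
        rw [dotProduct_mulVec, vecMul_vecMul, hB1, vecMul_one, hbw]
      rw [hl] at e
      simp at e
      refine e.resolve_right ?_
      rintro rfl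
      apply hw
      have : (B⁻¹).1 *ᵥ (B.1 *ᵥ w) = 0 := by rw [hl]; simp
      rwa [mulVec_mulVec, hB1, one_mulVec] at this) T' (by
      rw [hT', Matrix.SpecialLinearGroup.coe_mul, Matrix.SpecialLinearGroup.coe_mul, hT, mul_sub,
        sub_mul, mul_one, hB2, mul_vecMulVec, vecMulVec_mul, hl])
    rw [← hl] at h1
    have h2 : D B * (R b * L w) * (D B)⁻¹ = R (b ᵥ* (B⁻¹).1) * L (B.1 *ᵥ w) := by
      rw [← mul_assoc, DR, mul_assoc _ (D B), DL]; simp [mul_assoc]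
    have h3 : D B * (L w * R b * D T) * (D B)⁻¹ = L (B.1 *ᵥ w) * R (b ᵥ* (B⁻¹).1) * D T' := by
      rw [← mul_assoc, ← mul_assoc, DL, mul_assoc _ (D B), DR, hT']; simp [mul_assoc]
    rw [← h2, ← h3] at h1
    simpa using h1

end step
end SLP


set_option linter.unusedSectionVars false
set_option linter.unusedSimpArgs false
set_option linter.unusedVariables false

namespace SLP
open scoped commutatorElement
open Matrix

section step
variable {J F Γ : Type} [Fintype J] [DecidableEq J] [Field F] [Group Γ] [Nontrivial J]

theorem emb_mulVec_some (A : SL J F) (u : Option J → F) :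
    (emb some (Option.some_injective J) A).1 *ᵥ u =
      fun o => o.elim (u none) (A.1 *ᵥ fun j => u (some j)) := by
  ext o
  cases o with
  | none =>
    simp only [mulVec, dotProduct, Option.elim_none]
    rw [Finset.sum_eq_single none]
    · rw [emb_apply_left _ _ _ (by simp)]; simp
    · intro b _ hb; rw [emb_apply_left _ _ _ (by simp), one_apply_ne (Ne.symm hb), zero_mul]
    · simp
  | some i =>
    simp only [mulVec, dotProduct, Option.elim_some]
    rw [Fintype.sum_option, emb_apply_right _ _ _ (by simp), one_apply_ne (by simp), zero_mul, zero_add]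
    simp only [emb_apply]

theorem steinberg_step {x : Option J → Option J → F → Γ} (hx : Stein x) (D : SL J F →* Γ)
    (hD : ∀ i j, i ≠ j → ∀ r, D (tv i j r) = x (some i) (some j) r) :
    ∃ ψ : SL (Option J) F →* Γ, ∀ i j, i ≠ j → ∀ r, ψ (tv i j r) = x i j r := by
  have hX := Stein.prod (tv_stein (I := Option J) (F := F)) hx
  set X : Option J → Option J → F → SL (Option J) F × Γ := fun i j r => (tv i j r, x i j r) with hXd
  let DD : SL J F →* SL (Option J) F × Γ := (emb some (Option.some_injective J)).prod D
  have hDD : ∀ i j, i ≠ j → ∀ r, DD (tv i j r) = X (some i) (some j) r := by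
    intro i j hij r
    exact Prod.ext (emb_tv _ _ _ _ _) (hD i j hij r)
  obtain ⟨R, L, h, hR1, hL1⟩ := exists_RLD hX DD hDD
  have aR : ∀ b u, (R b).1.1 *ᵥ u = u + Pi.single none (b ⬝ᵥ fun j => u (some j)) := by
    intro b
    refine vec_induction (p := fun b => ∀ u, (R b).1.1 *ᵥ u =
      u + Pi.single none (b ⬝ᵥ fun j => u (some j))) ?_ ?_ ?_ b
    · intro u; rw [h.R0]; simp
    · intro j r u; rw [hR1]; simp only [hXd]; rw [tv_coe (by simp), mulVec_single_add]; simp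
    · intro b c hb hc u
      rw [h.addR, Prod.fst_mul, Matrix.SpecialLinearGroup.coe_mul, ← mulVec_mulVec, hc, hb]
      rw [add_dotProduct, Pi.single_add]
      simp
      abel
  have aL : ∀ w u, (L w).1.1 *ᵥ u = u + fun o => o.elim 0 (u none • w) := by
    intro w
    refine vec_induction (p := fun w => ∀ u, (L w).1.1 *ᵥ u = u + fun o => o.elim 0 (u none • w)) ?_ ?_ ?_ w
    · intro u; rw [h.L0]; ext o; cases o <;> simp
    · intro j r u; rw [hL1]; simp only [hXd]; rw [tv_coe (by simp), mulVec_single_add]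
      ext o; cases o <;> simp [Pi.single_apply, mul_comm]
    · intro b c hb hc u
      rw [h.addL, Prod.fst_mul, Matrix.SpecialLinearGroup.coe_mul, ← mulVec_mulVec, hc, hb]
      ext o; cases o <;> simp [mul_add]; ring
  have aD : ∀ A u, (DD A).1.1 *ᵥ u = fun o => o.elim (u none) (A.1 *ᵥ fun j => u (some j)) :=
    fun A u => emb_mulVec_some A u
  let K : Subgroup (SL (Option J) F × Γ) := Subgroup.closure {g | ∃ i j r, i ≠ j ∧ g = X i j r}
  have hK : ∀ g ∈ K, RLD.SS R L DD g := by
    have key : ∀ i j r g, i ≠ j → RLD.SS R L DD g → RLD.SS R L DD (X i j r * g) := by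
      intro i j r g hij hg
      cases i with
      | none =>
        cases j with
        | none => exact absurd rfl hij
        | some j => rw [← hR1]; exact h.SS_R _ hg
      | some i =>
        cases j with
        | none => rw [← hL1]; exact h.SS_L _ hg
        | some j => rw [← hDD i j (by simpa using hij)]; exact h.SS_D _ hg
    intro g hg
    induction hg using Subgroup.closure_induction_left with
    | one => exact ⟨0, 0, 0, by simpa [h.L0, h.R0] using h.refl 1⟩
    | mul_left a ha y hy ih =>
      obtain ⟨i, j, r, hij, rfl⟩ := ha
      exact key i j r _ hij ih
    | inv_mul_cancel a ha y hy ih =>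
      obtain ⟨i, j, r, hij, rfl⟩ := ha
      rw [← hX.neg hij]
      exact key i j _ _ hij ih
  suffices hh : (∀ g, ((1 : SL (Option J) F), g) ∈ K → g = 1) ∧ ∀ a, ∃ g, (a, g) ∈ K by
    obtain ⟨ψ, hψ⟩ := graph_hom K hh.1 hh.2
    refine ⟨ψ, fun i j hij r => hψ _ _ ?_⟩
    exact Subgroup.subset_closure ⟨i, j, r, hij, rfl⟩
  refine ⟨?_, ?_⟩
  · intro g hg
    obtain ⟨w, b, v, hP⟩ := hK _ hg
    have hP' := hP
    obtain ⟨c, A, hA⟩ := hP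
    have e := congrArg (fun y : SL (Option J) F × Γ => y.1.1 *ᵥ (Pi.single none 1)) hA
    simp only [Prod.fst_mul, Matrix.SpecialLinearGroup.coe_mul, ← mulVec_mulVec, aR, aL, aD] at e
    have hz : A.1 *ᵥ (fun _ => (0 : F)) = 0 := mulVec_zero _
    have e0 := congrFun e none
    have e1 : w = -v := by
      ext j
      have := congrFun e (some j)
      simp [dotProduct, hz] at e0
      simp [dotProduct, hz] at this
      rw [e0] at this
      simp only [add_zero, one_mul] at this
      rw [Pi.neg_apply, eq_neg_iff_add_eq_zero, add_comm]
      simpa using this.symm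
    obtain ⟨c, A, hA⟩ := h.SS_final hP' (by simpa [dotProduct, hz] using e0) e1
    have e2 := fun j => congrArg (fun y : SL (Option J) F × Γ => y.1.1 *ᵥ (Pi.single (some j) 1)) hA
    have hp : ∀ j : J, (fun k => (Pi.single (some j) 1 : Option J → F) (some k)) = Pi.single j 1 := by
      intro j; ext k; simp [Pi.single_apply]
    simp only [Prod.fst_mul, Matrix.SpecialLinearGroup.coe_mul, ← mulVec_mulVec, aR, aL, aD] at e2
    have hA1 : A = 1 := by
      apply Subtype.ext
      ext i j
      have := congrFun (e2 j) (some i)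
      simp only [Option.elim_some, hp] at this
      simp [Pi.single_apply] at this
      rw [← this]; simp [one_apply]
    subst hA1
    have hc0 : c = 0 := by
      ext j
      have := congrFun (e2 j) none
      simp only [Option.elim_some, Option.elim_none, hp, SpecialLinearGroup.coe_one, one_mulVec,
        Pi.add_apply, Pi.single_eq_same, dotProduct_single, mul_one] at this
      have h2 : (c ⬝ᵥ fun i => (1 : Matrix J J F) i j) = c j := by
        simp [dotProduct, one_apply]
      rw [Pi.zero_apply, ← h2]
      simpa using this.symm
    subst hc0
    rw [h.R0] at hA
    simp at hA
    exact hA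
  · have : K.map (MonoidHom.fst _ _) = ⊤ := by
      apply tv_gen
      intro i j hij r
      exact ⟨X i j r, Subgroup.subset_closure ⟨i, j, r, hij, rfl⟩, rfl⟩
    intro a
    have ha : a ∈ K.map (MonoidHom.fst _ _) := by rw [this]; trivial
    obtain ⟨⟨a', g⟩, hg, rfl⟩ := ha
    exact ⟨g, hg⟩

end step

/-- A Steinberg family whose first `SL_2` is genuine comes from `SL_n`. -/
theorem steinberg_hom {F Γ : Type} [Field F] [Group Γ] (n : ℕ) :
    ∀ (x : Fin (n + 2) → Fin (n + 2) → F → Γ), Stein x → ∀ (ψ2 : SL (Fin 2) F →* Γ),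
    (∀ r, ψ2 (tv 0 1 r) = x 0 1 r) → (∀ r, ψ2 (tv 1 0 r) = x 1 0 r) →
    ∃ ψ : SL (Fin (n + 2)) F →* Γ, ∀ i j, i ≠ j → ∀ r, ψ (tv i j r) = x i j r := by
  induction n with
  | zero =>
    intro x hx ψ2 h01 h10
    refine ⟨ψ2, ?_⟩
    intro i j
    fin_cases i <;> fin_cases j <;> simp
    · exact h01
    · exact h10
  | succ n ih =>
    intro x hx ψ2 h01 h10
    obtain ⟨D, hD⟩ := ih (fun i j => x i.castSucc j.castSucc)
      (hx.comp _ (Fin.castSucc_injective _)) ψ2 h01 h10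
    let e : Fin (n + 2 + 1) ≃ Option (Fin (n + 2)) := finSuccEquivLast
    have he : ∀ i, e.symm (some i) = Fin.castSucc i := fun i => by simp [e]
    obtain ⟨ψ, hψ⟩ := steinberg_step (hx.comp e.symm e.symm.injective) D (by
      intro i j hij r; rw [hD i j hij]; simp only [he])
    refine ⟨ψ.comp (emb e e.injective), fun i j hij r => ?_⟩
    rw [MonoidHom.comp_apply, emb_tv, hψ _ _ (e.injective.ne hij)]
    simp

/-- General index set version. -/
theorem steinberg_hom' {I F Γ : Type} [Fintype I] [DecidableEq I] [Field F] [Group Γ]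
    {x : I → I → F → Γ} (hx : Stein x) (i0 i1 : I) (h01 : i0 ≠ i1) (ψ2 : SL (Fin 2) F →* Γ)
    (h0 : ∀ r, ψ2 (tv 0 1 r) = x i0 i1 r) (h1 : ∀ r, ψ2 (tv 1 0 r) = x i1 i0 r) :
    ∃ ψ : SL I F →* Γ, ∀ i j, i ≠ j → ∀ r, ψ (tv i j r) = x i j r := by
  obtain ⟨n, hn⟩ : ∃ n, Fintype.card I = n + 2 := by
    have : 1 < Fintype.card I := Fintype.one_lt_card_iff.2 ⟨i0, i1, h01⟩
    exact ⟨Fintype.card I - 2, by omega⟩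
  let e0 : I ≃ Fin (n + 2) := (Fintype.equivFin I).trans (finCongr hn)
  let e1 : I ≃ Fin (n + 2) := e0.trans (Equiv.swap (e0 i0) 0)
  let e : I ≃ Fin (n + 2) := e1.trans (Equiv.swap (e1 i1) 1)
  have he1 : e1 i0 = 0 := by simp [e1]
  have he0 : e i0 = 0 := by
    have : e1 i1 ≠ 0 := by rw [← he1]; exact e1.injective.ne h01.symm
    simp [e, he1]
    exact Equiv.swap_apply_of_ne_of_ne this.symm (by simp)
  have hee : e i1 = 1 := by simp [e]
  have s0 : e.symm 0 = i0 := by rw [← he0]; simp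
  have s1 : e.symm 1 = i1 := by rw [← hee]; simp
  obtain ⟨ψ, hψ⟩ := steinberg_hom n _ (hx.comp e.symm e.symm.injective) ψ2
    (by intro r; rw [s0, s1, h0]) (by intro r; rw [s0, s1, h1])
  refine ⟨ψ.comp (emb e e.injective), fun i j hij r => ?_⟩
  rw [MonoidHom.comp_apply, emb_tv, hψ _ _ (e.injective.ne hij)]
  simp

end SLP


set_option linter.unusedSectionVars false
set_option linter.unusedSimpArgs false
set_option linter.unusedVariables false

namespace SLP
open scoped commutatorElement
open Matrix

/-- Straight-line programs. -/
inductive Ex : Type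
  | zero : Ex
  | one : Ex
  | add : Ex → Ex → Ex
  | mulX : Ex → Ex
  | mulT : Ex → Ex

namespace Ex

def size : Ex → ℕ
  | zero => 1
  | one => 1
  | add a b => a.size + b.size + 1
  | mulX a => a.size + 1
  | mulT a => a.size + 1

def eval {R : Type} [Ring R] (τ : ℕ) (θ : R) : Ex → R
  | zero => 0
  | one => 1
  | add a b => a.eval τ θ + b.eval τ θ
  | mulX a => θ * a.eval τ θ
  | mulT a => (τ : R) * a.eval τ θ

def val {Γ : Type} [Group Γ] (u A H : Γ) : Ex → Γ
  | zero => 1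
  | one => u
  | add a b => a.val u A H * b.val u A H
  | mulX a => A * a.val u A H * A⁻¹
  | mulT a => H * a.val u A H * H⁻¹

theorem eval_map {R R' : Type} [Ring R] [Ring R'] (τ : ℕ) (θ : R) (f : R →+* R') (e : Ex) :
    f (e.eval τ θ) = e.eval τ (f θ) := by
  induction e <;> simp_all [eval]

theorem val_map {Γ Γ' : Type} [Group Γ] [Group Γ'] (u A H : Γ) (f : Γ →* Γ') (e : Ex) :
    f (e.val u A H) = e.val (f u) (f A) (f H) := by
  induction e <;> simp_all [val]

theorem val_len {ι : Type} {u A H : FreeGroup ι} {k : ℕ} (hu : Len u k) (hA : Len A k)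
    (hH : Len H k) (e : Ex) : Len (e.val u A H) (2 * k * e.size) := by
  induction e with
  | zero => exact Len.one
  | one => exact hu.mono (by simp [size]; omega)
  | add a b ha hb => exact (ha.mul hb).mono (by simp only [size]; nlinarith)
  | mulX a ha => exact ((hA.mul ha).mul hA.inv).mono (by simp only [size]; nlinarith)
  | mulT a ha => exact ((hH.mul ha).mul hH.inv).mono (by simp only [size]; nlinarith)

theorem val_eq {R Γ : Type} [Ring R] [Group Γ] {X : R → Γ} {u A H : Γ} {τ : ℕ} {θ : R}
    (hadd : ∀ r s, X (r + s) = X r * X s) (h1 : X 1 = u) (hA : ∀ r, A * X r * A⁻¹ = X (θ * r))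
    (hH : ∀ r, H * X r * H⁻¹ = X ((τ : R) * r)) (e : Ex) : e.val u A H = X (e.eval τ θ) := by
  induction e with
  | zero => have := hadd 0 0; simp at this; simp [val, eval, this]
  | one => simp [val, eval, h1]
  | add a b ha hb => simp [val, eval, ha, hb, hadd]
  | mulX a ha => simp [val, eval, ha, hA]
  | mulT a ha => simp [val, eval, ha, hH]

theorem digit (k : ℕ) : ∃ e : Ex, e.size ≤ 2 * k + 1 ∧
    ∀ (R : Type) [Ring R] (τ : ℕ) (θ : R), e.eval τ θ = k := by
  induction k with
  | zero => exact ⟨zero, by simp [size], fun R _ τ θ => by simp [eval]⟩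
  | succ k ih =>
    obtain ⟨e, h1, h2⟩ := ih
    exact ⟨add e one, by simp only [size]; omega, fun R _ τ θ => by simp [eval, h2]⟩

theorem int4 (k : ℕ) : ∃ e : Ex, e.size ≤ 20 * (Nat.log 2 k + 1) ∧
    ∀ (R : Type) [Ring R] (θ : R), e.eval 4 θ = k := by
  induction k using Nat.strong_induction_on with
  | _ k ih =>
    by_cases hk : k < 4
    · obtain ⟨e, h1, h2⟩ := digit k
      exact ⟨e, by omega, fun R _ θ => h2 R 4 θ⟩
    · obtain ⟨e, h1, h2⟩ := ih (k / 4) (by omega)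
      obtain ⟨d, h3, h4⟩ := digit (k % 4)
      have : Nat.log 2 (k / 4) + 2 ≤ Nat.log 2 k := by
        have : k / 4 = k / 2 / 2 := by omega
        rw [this, Nat.log_div_base, Nat.log_div_base]
        have := Nat.log_mono_right (b := 2) (show 4 ≤ k by omega)
        have h4 : Nat.log 2 4 = 2 := by
          rw [show 4 = 2 ^ 2 by norm_num, Nat.log_pow (by norm_num)]
        omega
      have : k % 4 < 4 := Nat.mod_lt _ (by norm_num)
      refine ⟨add (mulT e) d, by simp only [size]; omega, fun R _ θ => ?_⟩
      simp only [eval, h2, h4]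
      conv_rhs => rw [← Nat.div_add_mod k 4]
      push_cast; rfl

end Ex

/-- The multiplier used for digits. -/
def tau (c : ℕ) : ℕ := if c = 2 then 1 else 4

theorem Ex.intc {c : ℕ} (hc : c.Prime) {k : ℕ} (hk : k < c ∨ k = c) :
    ∃ e : Ex, e.size ≤ 20 * (Nat.log 2 c + 1) ∧
    ∀ (R : Type) [Ring R] (θ : R), e.eval (tau c) θ = k := by
  have hk' : k ≤ c := by omega
  by_cases h : c = 2
  · subst h
    obtain ⟨e, h1, h2⟩ := digit k
    exact ⟨e, by omega, fun R _ θ => h2 R _ θ⟩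
  · obtain ⟨e, h1, h2⟩ := int4 k
    have := Nat.log_mono_right (b := 2) hk'
    refine ⟨e, by omega, fun R _ θ => ?_⟩
    rw [tau, if_neg h]; exact h2 R θ

open Polynomial in
theorem Ex.poly {c : ℕ} [Fact c.Prime] (d : ℕ) : ∀ (f : (ZMod c)[X]), f.natDegree ≤ d →
    ∃ e : Ex, e.size ≤ (d + 1) * (20 * (Nat.log 2 c + 1) + 2) ∧
    ∀ (R : Type) [Ring R] [Algebra (ZMod c) R] (θ : R), e.eval (tau c) θ = aeval θ f := by
  have hcast : ∀ (a : ZMod c) (R : Type) [Ring R] [Algebra (ZMod c) R],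
      ((a.val : ℕ) : R) = algebraMap (ZMod c) R a := by
    intro a R _ _
    rw [← map_natCast (algebraMap (ZMod c) R), ZMod.natCast_zmod_val]
  induction d with
  | zero =>
    intro f hf
    obtain ⟨a, rfl⟩ : ∃ a, f = C a := ⟨_, eq_C_of_natDegree_le_zero hf⟩
    obtain ⟨e, h1, h2⟩ := intc (Fact.out : c.Prime) (Or.inl (ZMod.val_lt a))
    refine ⟨e, by omega, fun R _ _ θ => ?_⟩
    rw [h2, aeval_C, hcast]
  | succ d ih =>
    intro f hf
    obtain ⟨e, h1, h2⟩ := intc (Fact.out : c.Prime) (Or.inl (ZMod.val_lt (f.coeff 0)))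
    obtain ⟨e', h3, h4⟩ := ih f.divX (by rw [natDegree_divX_eq_natDegree_tsub_one]; omega)
    refine ⟨add (mulX e') e, ?_, fun R _ _ θ => ?_⟩
    · simp only [size]; rw [add_mul (d + 1) 1]; omega
    · have := congrArg (aeval θ) (X_mul_divX_add f)
      rw [← this]
      simp only [eval, h2, h4, hcast, map_add, map_mul, aeval_X, aeval_C]

/-- Programs for a finite field generated by `θ`. -/
theorem field_prog {F : Type} [Field F] [Fintype F] (θ : F) (hθ : Subring.closure {θ} = ⊤)
    (c : ℕ) [Fact c.Prime] [CharP F c] :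
    (∀ r : F, ∃ e : Ex, e.size ≤ 100 * Nat.log 2 (Fintype.card F) ∧ e.eval (tau c) θ = r) ∧
    ∃ e1 e2 : Ex, e1.size ≤ 200 * Nat.log 2 (Fintype.card F) ∧
      e2.size ≤ 200 * Nat.log 2 (Fintype.card F) ∧
      e1.eval (tau c) θ = 0 ∧ e2.eval (tau c) θ = 0 ∧
      ∀ (R : Type) [Ring R] (θ' : R), e1.eval (tau c) θ' = 0 → e2.eval (tau c) θ' = 0 →
        ∃ f : F →+* R, f θ = θ' := by
  let _ : Algebra (ZMod c) F := ZMod.algebra F c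
  have hc : c.Prime := Fact.out
  have hlc : 1 ≤ Nat.log 2 c := Nat.log_pos (by norm_num) hc.two_le
  have _ : Module.Finite (ZMod c) F := Module.Finite.of_finite
  have hi : IsIntegral (ZMod c) θ := Algebra.IsIntegral.isIntegral θ
  have htop : Algebra.adjoin (ZMod c) {θ} = ⊤ := by
    rw [eq_top_iff]
    intro x _
    have : Subring.closure {θ} ≤ (Algebra.adjoin (ZMod c) {θ}).toSubring := by
      rw [Subring.closure_le]; exact Algebra.subset_adjoin
    exact this (by rw [hθ]; trivial)
  let pb := PowerBasis.ofAdjoinEqTop hi htop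
  have hgen : pb.gen = θ := PowerBasis.ofAdjoinEqTop_gen hi htop
  have hcard : Fintype.card F = c ^ pb.dim := by
    rw [← pb.finrank, Module.card_eq_pow_finrank (K := ZMod c), ZMod.card]
  have hd : 1 ≤ pb.dim := Nat.one_le_iff_ne_zero.2 pb.dim_ne_zero
  have hlog : pb.dim * Nat.log 2 c ≤ Nat.log 2 (Fintype.card F) := by
    rw [hcard]
    apply Nat.le_log_of_pow_le (by norm_num)
    rw [mul_comm, pow_mul]
    exact Nat.pow_le_pow_left (Nat.pow_log_le_self 2 hc.ne_zero) _
  have hb : pb.dim * (20 * (Nat.log 2 c + 1) + 2) ≤ 100 * Nat.log 2 (Fintype.card F) := by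
    calc _ ≤ pb.dim * (100 * Nat.log 2 c) := Nat.mul_le_mul_left _ (by omega)
      _ ≤ _ := by nlinarith
  refine ⟨?_, ?_⟩
  · intro r
    obtain ⟨f, hf, rfl⟩ := pb.exists_eq_aeval r
    obtain ⟨e, h1, h2⟩ := Ex.poly (pb.dim - 1) f (by omega)
    refine ⟨e, h1.trans (le_trans ?_ hb), ?_⟩
    · rw [Nat.sub_add_cancel hd]
    · rw [h2, hgen]
  · obtain ⟨e1, h1, h1'⟩ := Ex.intc hc (Or.inr rfl)
    obtain ⟨e2, h2, h2'⟩ := Ex.poly pb.dim (minpoly (ZMod c) pb.gen) (by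
      rw [pb.natDegree_minpoly])
    refine ⟨e1, e2, ?_, ?_, ?_, ?_, ?_⟩
    · have : Nat.log 2 c ≤ pb.dim * Nat.log 2 c := by nlinarith
      omega
    · refine h2.trans ?_
      have : pb.dim + 1 ≤ 2 * pb.dim := by omega
      calc _ ≤ 2 * pb.dim * (20 * (Nat.log 2 c + 1) + 2) := Nat.mul_le_mul_right _ this
        _ ≤ _ := by rw [mul_assoc]; omega
    · rw [h1']; simp
    · rw [h2', hgen, minpoly.aeval]
    · intro R _ θ' he1 he2
      rw [h1'] at he1
      obtain ⟨m, hm⟩ := CharP.exists R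
      let _ : Algebra (ZMod c) R := ZMod.algebra' R m ((CharP.cast_eq_zero_iff R m c).1 he1)
      rw [h2'] at he2
      exact ⟨(pb.lift θ' he2).toRingHom, by
        have := pb.lift_gen θ' he2
        rw [hgen] at this
        exact this⟩

end SLP


set_option linter.unusedSectionVars false
set_option linter.unusedSimpArgs false
set_option linter.unusedVariables false

namespace SLP
open scoped commutatorElement
open Matrix

section baum
variable {Γ : Type} [Group Γ]

theorem baum_comm {u A B : Γ} (hAB : Commute A B) (h2 : Commute u (A * u * A⁻¹))
    (h3 : B * u * B⁻¹ = A * u * A⁻¹ * u) (i j : ℕ) :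
    Commute (A ^ i * u * (A ^ i)⁻¹) (A ^ j * u * (A ^ j)⁻¹) := by
  set v : ℕ → Γ := fun i => A ^ i * u * (A ^ i)⁻¹ with hv
  have shift : ∀ i j k, Commute (v i) (v j) → Commute (v (k + i)) (v (k + j)) := by
    intro i j k h
    have := (Commute.conj_iff (A ^ k)).2 h
    simp only [hv, pow_add] at this ⊢
    simpa only [_root_.mul_inv_rev, mul_assoc] using this
  have hB : ∀ i, B * v i * B⁻¹ = v (i + 1) * v i := by
    intro i
    have hc : Commute B (A ^ i) := (hAB.symm).pow_right i
    have hc' : Commute (A ^ i)⁻¹ B⁻¹ := hc.symm.inv_inv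
    calc B * v i * B⁻¹ = (B * A ^ i) * u * ((A ^ i)⁻¹ * B⁻¹) := by simp only [hv, mul_assoc]
      _ = A ^ i * (B * u * B⁻¹) * (A ^ i)⁻¹ := by rw [hc.eq, hc'.eq]; simp only [mul_assoc]
      _ = v (i + 1) * v i := by rw [h3]; simp only [hv, pow_succ]; group
  have key : ∀ k, ∀ j ≤ k, Commute (v 0) (v j) := by
    intro k
    induction k with
    | zero => intro j hj; obtain rfl : j = 0 := by omega
              exact Commute.refl _
    | succ k ih =>
      intro j hj
      rcases Nat.lt_or_ge j (k + 1) with h | h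
      · exact ih j (by omega)
      obtain rfl : j = k + 1 := by omega
      rcases Nat.eq_zero_or_pos k with rfl | hk
      · simpa [hv] using h2
      have h0 : Commute (v 1 * v 0) (v (k + 1) * v k) := by
        have := (Commute.conj_iff B).2 (ih k le_rfl)
        rwa [hB, hB] at this
      have a1 : Commute (v 1) (v (k + 1)) := by
        have := shift 0 k 1 (ih k le_rfl); rwa [add_comm 1 k] at this
      have a2 : Commute (v 1) (v k) := by
        have := shift 0 (k - 1) 1 (ih (k - 1) (by omega))
        rwa [show 1 + (k - 1) = k by omega] at this
      have a3 : Commute (v 0) (v (k + 1) * v k) := by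
        have := (a1.mul_right a2).inv_left.mul_left h0
        simpa using this
      have := a3.mul_right (ih k le_rfl).inv_right
      simpa using this
  change Commute (v i) (v j)
  rcases le_total i j with h | h
  · have := shift 0 (j - i) i (key _ _ le_rfl)
    rwa [show i + (j - i) = j by omega] at this
  · have := shift 0 (i - j) j (key _ _ le_rfl)
    rw [show j + (i - j) = i by omega] at this
    exact this.symm

theorem baum {F : Type} [Field F] {u A B H : Γ} (hAB : Commute A B) (h2 : Commute u (A * u * A⁻¹))
    (h3 : B * u * B⁻¹ = A * u * A⁻¹ * u) (hAH : Commute A H) {τ : ℕ} (hH : H * u * H⁻¹ = u ^ τ)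
    {e1 e2 : Ex} {θ : F} (hlift : ∀ (R : Type) [Ring R] (θ' : R), e1.eval τ θ' = 0 →
      e2.eval τ θ' = 0 → ∃ f : F →+* R, f θ = θ')
    (he1 : e1.val u A H = 1) (he2 : e2.val u A H = 1) :
    ∃ X : F → Γ, (∀ r s, X (r + s) = X r * X s) ∧ X 1 = u ∧ (∀ r, A * X r * A⁻¹ = X (θ * r)) ∧
      (∀ r, H * X r * H⁻¹ = X ((τ : F) * r)) := by
  set S : Set Γ := Set.range fun i : ℕ => A ^ i * u * (A ^ i)⁻¹ with hS
  have hcomm : ∀ x ∈ S, ∀ y ∈ S, x * y = y * x := by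
    rintro _ ⟨i, rfl⟩ _ ⟨j, rfl⟩
    exact baum_comm hAB h2 h3 i j
  let _ : CommGroup (Subgroup.closure S) := Subgroup.closureCommGroupOfComm hcomm
  have hu : u ∈ Subgroup.closure S := Subgroup.subset_closure ⟨0, by simp⟩
  have hA : ∀ m ∈ Subgroup.closure S, A * m * A⁻¹ ∈ Subgroup.closure S := by
    intro m hm
    have : Subgroup.closure S ≤ (Subgroup.closure S).comap (MulAut.conj A).toMonoidHom := by
      rw [Subgroup.closure_le]
      rintro _ ⟨i, rfl⟩
      refine Subgroup.subset_closure ⟨i + 1, ?_⟩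
      simp [pow_succ']
      group
    exact this hm
  let cA : Subgroup.closure S →* Subgroup.closure S :=
    ((MulAut.conj A).toMonoidHom.comp (Subgroup.closure S).subtype).codRestrict _ (fun m => hA m.1 m.2)
  let R := AddMonoid.End (Additive (Subgroup.closure S))
  let θ' : R := MonoidHom.toAdditive cA
  let u' : Additive (Subgroup.closure S) := Additive.ofMul ⟨u, hu⟩
  let X : R → Γ := fun φ => (Additive.toMul (φ u')).1
  have hpow : ∀ i : ℕ, (Additive.toMul ((θ' ^ i) u')).1 = A ^ i * u * (A ^ i)⁻¹ := by
    intro i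
    induction i with
    | zero => change u = _; simp
    | succ i ih =>
      rw [pow_succ']
      change A * (Additive.toMul ((θ' ^ i) u')).1 * A⁻¹ = _
      rw [ih, pow_succ']; group
  have hext : ∀ φ : R, (∀ i : ℕ, φ ((θ' ^ i) u') = 0) → φ = 0 := by
    intro φ h
    ext m
    obtain ⟨m, hm⟩ := m
    have : ∀ m (hm : m ∈ Subgroup.closure S), φ (Additive.ofMul ⟨m, hm⟩) = 0 := by
      intro m hm
      induction hm using Subgroup.closure_induction with
      | mem x hx =>
        obtain ⟨i, rfl⟩ := hx
        rw [← h i]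
        congr 1
        exact congrArg Additive.ofMul (Subtype.ext (hpow i).symm)
      | one => exact φ.map_zero
      | mul x y hx hy h1 h2 =>
        exact (φ.map_add (Additive.ofMul ⟨x, hx⟩) (Additive.ofMul ⟨y, hy⟩)).trans
          ((congrArg₂ (fun a b => a + b) h1 h2).trans (add_zero _))
      | inv x hx h1 =>
        exact (φ.map_neg (Additive.ofMul ⟨x, hx⟩)).trans ((congrArg (fun a => -a) h1).trans neg_zero)
    exact congrArg (fun y : Additive (Subgroup.closure S) => (Additive.toMul y).1) (this m hm)
  have hadd : ∀ φ χ : R, X (φ + χ) = X φ * X χ := fun _ _ => rfl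
  have hXA : ∀ φ, A * X φ * A⁻¹ = X (θ' * φ) := fun φ => rfl
  have hXH : ∀ φ, H * X φ * H⁻¹ = X ((τ : R) * φ) := by
    have e0 : ∀ m : Additive (Subgroup.closure S),
        (Additive.toMul (((τ : ℕ) : R) m)).1 = (Additive.toMul m).1 ^ τ := by
      intro m
      rw [AddMonoid.End.natCast_apply]; rfl
    have : ∀ m ∈ Subgroup.closure S, H * m * H⁻¹ = m ^ τ := by
      intro m hm
      induction hm using Subgroup.closure_induction with
      | mem x hx =>
        obtain ⟨i, rfl⟩ := hx
        have hc : Commute H (A ^ i) := (hAH.symm).pow_right i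
        have hc' : Commute (A ^ i)⁻¹ H⁻¹ := hc.symm.inv_inv
        simp only
        rw [conj_pow, ← hH]
        calc _ = (H * A ^ i) * u * ((A ^ i)⁻¹ * H⁻¹) := by simp only [mul_assoc]
          _ = _ := by rw [hc.eq, hc'.eq]; simp only [mul_assoc]
      | one => simp
      | mul x y hx hy h1 h2 =>
        have hxy : Commute x y := congrArg Subtype.val
          (mul_comm (⟨x, hx⟩ : Subgroup.closure S) ⟨y, hy⟩)
        rw [hxy.mul_pow, ← h1, ← h2]; group
      | inv x hx h1 => rw [inv_pow, ← h1]; group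
    intro φ
    rw [this _ (Additive.toMul (φ u')).2]
    exact (e0 (φ u')).symm
  have hval : ∀ e : Ex, e.val u A H = X (e.eval τ θ') :=
    Ex.val_eq (θ := θ') (X := X) hadd rfl hXA hXH
  have hc : ∀ e : Ex, Commute (e.eval τ θ') θ' := by
    intro e
    induction e with
    | zero => exact Commute.zero_left _
    | one => exact Commute.one_left _
    | add a b ha hb => exact ha.add_left hb
    | mulX a ha => exact (Commute.refl _).mul_left ha
    | mulT a ha => exact (Nat.cast_commute _ _).mul_left ha
  have hz : ∀ e : Ex, e.val u A H = 1 → e.eval τ θ' = 0 := by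
    intro e he
    apply hext
    intro i
    rw [hval] at he
    have he' : (e.eval τ θ') u' = 0 := Subtype.ext he
    have := (hc e).pow_right i
    calc (e.eval τ θ') ((θ' ^ i) u') = (e.eval τ θ' * θ' ^ i) u' := rfl
      _ = (θ' ^ i) ((e.eval τ θ') u') := by rw [this.eq]; rfl
      _ = 0 := by rw [he', map_zero]
  obtain ⟨f, hf⟩ := hlift R θ' (hz e1 he1) (hz e2 he2)
  refine ⟨fun r => X (f r), ?_, ?_, ?_, ?_⟩
  · intro r s; simp only; rw [map_add, hadd]
  · simp only; rw [map_one]; rfl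
  · intro r; simp only; rw [hXA, map_mul, hf]
  · intro r; simp only; rw [hXH, map_mul, map_natCast]

end baum
end SLP


set_option linter.unusedSectionVars false
set_option linter.unusedSimpArgs false
set_option linter.unusedVariables false

namespace SLP
open scoped commutatorElement
open Matrix

structure SL2D {F Γ : Type} [Field F] [Group Γ] (X : F → Γ) (w : Γ) (h : Fˣ →* Γ) : Prop where
  add : ∀ r s, X (r + s) = X r * X s
  hX : ∀ t r, h t * X r = X ((t : F) ^ 2 * r) * h t
  hw : ∀ t, h t * w = w * (h t)⁻¹
  ww : w * w = h (-1)
  wXw : ∀ t : Fˣ, w * X t * w = X (-(t : F)⁻¹) * w * h (-t) * X (-(t : F)⁻¹)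

variable {F Γ Γ' : Type} [Field F] [Group Γ] [Group Γ']

theorem SL2D.prod {X : F → Γ} {w : Γ} {h : Fˣ →* Γ} {X' : F → Γ'} {w' : Γ'} {h' : Fˣ →* Γ'}
    (d : SL2D X w h) (d' : SL2D X' w' h') :
    SL2D (fun r => (X r, X' r)) (w, w') (h.prod h') where
  add r s := Prod.ext (d.add r s) (d'.add r s)
  hX r s := Prod.ext (d.hX r s) (d'.hX r s)
  hw r := Prod.ext (d.hw r) (d'.hw r)
  ww := Prod.ext d.ww d'.ww
  wXw r := Prod.ext (d.wXw r) (d'.wXw r)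

theorem val_mul {I : Type} [Fintype I] [DecidableEq I] (a b : SL I F) : (a * b).1 = a.1 * b.1 := rfl

def wM : SL (Fin 2) F := ⟨!![0, 1; -1, 0], by simp [det_fin_two]⟩

def hM : Fˣ →* SL (Fin 2) F where
  toFun t := ⟨!![(t : F), 0; 0, (t : F)⁻¹], by simp [det_fin_two]⟩
  map_one' := by ext i j; fin_cases i <;> fin_cases j <;> simp
  map_mul' s t := by
    apply Subtype.ext
    change _ = (!![(s : F), 0; 0, (s : F)⁻¹] * !![(t : F), 0; 0, (t : F)⁻¹] : Matrix (Fin 2) (Fin 2) F)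
    ext i j; fin_cases i <;> fin_cases j <;> simp [Matrix.mul_apply, Fin.sum_univ_two, mul_comm]

theorem tv01 (r : F) : (tv 0 1 r : SL (Fin 2) F).1 = !![1, r; 0, 1] := by
  rw [tv_coe (by simp)]
  ext i j; fin_cases i <;> fin_cases j <;> simp [Matrix.single_apply]

theorem tv10 (r : F) : (tv 1 0 r : SL (Fin 2) F).1 = !![1, 0; r, 1] := by
  rw [tv_coe (by simp)]
  ext i j; fin_cases i <;> fin_cases j <;> simp [Matrix.single_apply]

theorem wM_coe : (wM : SL (Fin 2) F).1 = !![0, 1; -1, 0] := rfl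
theorem hM_coe (t : Fˣ) : (hM t : SL (Fin 2) F).1 = !![(t : F), 0; 0, (t : F)⁻¹] := rfl

theorem sl2d_matrix : SL2D (tv 0 1 : F → SL (Fin 2) F) wM hM where
  add r s := tv_stein.add (by simp) r s
  hX t r := by
    apply Subtype.ext
    simp only [val_mul, tv01, hM_coe, Matrix.mul_fin_two]
    ext i j; fin_cases i <;> fin_cases j <;> simp
    field_simp
  hw t := by
    rw [eq_mul_inv_iff_mul_eq]
    apply Subtype.ext
    simp only [val_mul, wM_coe, hM_coe, Matrix.mul_fin_two]
    ext i j; fin_cases i <;> fin_cases j <;> simp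
  ww := by
    apply Subtype.ext
    simp only [val_mul, wM_coe, hM_coe, Matrix.mul_fin_two]
    ext i j; fin_cases i <;> fin_cases j <;> simp
  wXw t := by
    apply Subtype.ext
    simp only [val_mul, wM_coe, hM_coe, tv01, Matrix.mul_fin_two]
    ext i j; fin_cases i <;> fin_cases j <;> simp

theorem wM_conj (r : F) : (wM : SL (Fin 2) F) * tv 0 1 (-r) * wM⁻¹ = tv 1 0 r := by
  rw [mul_inv_eq_iff_eq_mul]
  apply Subtype.ext
  simp only [val_mul, wM_coe, tv01, tv10, Matrix.mul_fin_two]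
  ext i j; fin_cases i <;> fin_cases j <;> simp

theorem SL2D.hM_eq {X : F → Γ} {w : Γ} {h : Fˣ →* Γ} (d : SL2D X w h) (t : Fˣ) :
    h t = w⁻¹ * X (-(t : F)⁻¹) * w * X (-t) * w * X (-(t : F)⁻¹) := by
  have h0 : X 0 = 1 := by simpa using d.add 0 0
  have := d.wXw (-t)
  have hi : X (-((-t : Fˣ) : F)⁻¹) * X (-(t : F)⁻¹) = 1 := by
    rw [← d.add, ← h0]; congr 1; simp [inv_neg]
  have hi' : X (-(t : F)⁻¹) * X (-((-t : Fˣ) : F)⁻¹) = 1 := by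
    rw [← d.add, ← h0]; congr 1; simp [inv_neg]
  calc h t = w⁻¹ * (X (-(t : F)⁻¹) * X (-((-t : Fˣ) : F)⁻¹)) * w * h t *
        (X (-((-t : Fˣ) : F)⁻¹) * X (-(t : F)⁻¹)) := by rw [hi, hi']; simp
    _ = w⁻¹ * X (-(t : F)⁻¹) * (w * X ((-t : Fˣ) : F) * w) * X (-(t : F)⁻¹) := by
        rw [this, neg_neg]; simp only [mul_assoc]
    _ = _ := by simp only [mul_assoc, Units.val_neg]

theorem SL2D.hom {X : F → Γ} {w : Γ} {h : Fˣ →* Γ} (d : SL2D X w h) :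
    ∃ ψ : SL (Fin 2) F →* Γ, (∀ r, ψ (tv 0 1 r) = X r) ∧ ψ wM = w ∧ ∀ t, ψ (hM t) = h t := by
  suffices hh : ∃ ψ : SL (Fin 2) F →* Γ, (∀ r, ψ (tv 0 1 r) = X r) ∧ ψ wM = w by
    obtain ⟨ψ, h1, h2⟩ := hh
    refine ⟨ψ, h1, h2, fun t => ?_⟩
    rw [d.hM_eq, sl2d_matrix.hM_eq]
    simp only [map_mul, map_inv, h1, h2]
  have D := sl2d_matrix.prod d
  set Y : F → SL (Fin 2) F × Γ := fun r => (tv 0 1 r, X r) with hY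
  set v : SL (Fin 2) F × Γ := (wM, w) with hv
  set k : Fˣ →* SL (Fin 2) F × Γ := hM.prod h with hk
  have Y0 : Y 0 = 1 := by simpa using D.add 0 0
  have Yneg : ∀ r, (Y r)⁻¹ = Y (-r) := fun r => by
    rw [inv_eq_iff_mul_eq_one, ← D.add, add_neg_cancel, Y0]
  let K : Subgroup (SL (Fin 2) F × Γ) := Subgroup.closure ({v} ∪ Set.range Y)
  have hvinv : v⁻¹ = k (-1) * v := by
    have h4 : k (-1) * k (-1) = 1 := by rw [← map_mul]; simp
    rw [inv_eq_iff_mul_eq_one, ← h4, ← D.ww]; simp only [mul_assoc]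
  let P : SL (Fin 2) F × Γ → Prop := fun g =>
    (∃ r t, g = Y r * k t) ∨ ∃ r t s, g = Y r * k t * v * Y s
  have PY : ∀ r g, P g → P (Y r * g) := by
    rintro r g (⟨r', t, rfl⟩ | ⟨r', t, s, rfl⟩)
    · exact Or.inl ⟨r + r', t, by rw [D.add, mul_assoc]⟩
    · exact Or.inr ⟨r + r', t, s, by rw [D.add]; simp only [mul_assoc]⟩
  have Pk : ∀ r g, P g → P (k r * g) := by
    rintro r g (⟨r', t, rfl⟩ | ⟨r', t, s, rfl⟩)
    · exact Or.inl ⟨_, r * t, by rw [map_mul, ← mul_assoc, D.hX, mul_assoc]⟩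
    · exact Or.inr ⟨_, r * t, s, by
        rw [map_mul]; simp only [← mul_assoc]; rw [D.hX]⟩
  have Pv : ∀ g, P g → P (v * g) := by
    have vk : ∀ t, v * k t = k t⁻¹ * v := by
      intro t; rw [D.hw, map_inv, inv_inv]
    rintro g (⟨r', t, rfl⟩ | ⟨r', t, s, rfl⟩)
    · refine Or.inr ⟨0, t⁻¹, (t⁻¹ : F) ^ 2 * r', ?_⟩
      have : Y r' * k t = k t * Y ((t⁻¹ : F) ^ 2 * r') := by
        rw [D.hX]; congr 2; field_simp
      rw [this, ← mul_assoc, vk, Y0, one_mul]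
    · have hh : P (v * (Y r' * v)) := by
        by_cases hr : r' = 0
        · subst hr
          refine Or.inl ⟨0, -1, ?_⟩
          rw [Y0, one_mul, one_mul, D.ww]
        · refine Or.inr ?_
          have := D.wXw (Units.mk0 r' hr)
          rw [Units.val_mk0] at this
          rw [← mul_assoc, this]
          refine ⟨-r'⁻¹, (-(Units.mk0 r' hr))⁻¹, -r'⁻¹, ?_⟩
          simp only [mul_assoc]
          rw [← mul_assoc v, vk]
          simp only [mul_assoc]
      have e : v * (Y r' * k t * v * Y s) = (v * (Y r' * v)) * (k t⁻¹ * Y s) := by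
        rw [mul_assoc (Y r'), ← inv_inv t, ← vk, inv_inv]; simp only [mul_assoc]
      rw [e]
      have Pr : ∀ g t s, P g → P (g * (k t * Y s)) := by
        have kY : ∀ (t : Fˣ) s, k t * Y s = Y ((t : F) ^ 2 * s) * k t := D.hX
        rintro g t s (⟨r1, t1, rfl⟩ | ⟨r1, t1, s1, rfl⟩)
        · refine Or.inl ⟨r1 + (t1 : F) ^ 2 * ((t : F) ^ 2 * s), t1 * t, ?_⟩
          rw [D.add, map_mul, kY]
          simp only [mul_assoc]
          rw [← mul_assoc (k t1), kY]
          simp only [mul_assoc]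
        · refine Or.inr ⟨r1, t1 * t⁻¹, (t⁻¹ : F) ^ 2 * s1 + s, ?_⟩
          have : Y s1 * k t = k t * Y ((t⁻¹ : F) ^ 2 * s1) := by
            rw [D.hX]; congr 2; field_simp
          rw [D.add, map_mul]
          simp only [mul_assoc]
          rw [← mul_assoc (Y s1), this, ← mul_assoc (k t⁻¹) v, ← vk]
          simp only [mul_assoc]
      exact Pr _ _ _ hh
  have hK : ∀ g ∈ K, P g := by
    intro g hg
    induction hg using Subgroup.closure_induction_left with
    | one => exact Or.inl ⟨0, 1, by simp [Y0]⟩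
    | mul_left a ha y hy ih =>
      rcases ha with ha | ⟨r, rfl⟩
      · rw [Set.mem_singleton_iff.1 ha]; exact Pv _ ih
      · exact PY _ _ ih
    | inv_mul_cancel a ha y hy ih =>
      rcases ha with ha | ⟨r, rfl⟩
      · rw [Set.mem_singleton_iff.1 ha, hvinv, mul_assoc]; exact Pk _ _ (Pv _ ih)
      · rw [Yneg]; exact PY _ _ ih
  suffices hh : (∀ g, ((1 : SL (Fin 2) F), g) ∈ K → g = 1) ∧ ∀ a, ∃ g, (a, g) ∈ K by
    obtain ⟨ψ, hψ⟩ := graph_hom K hh.1 hh.2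
    refine ⟨ψ, fun r => hψ _ _ ?_, hψ _ _ ?_⟩
    · exact Subgroup.subset_closure (Or.inr ⟨r, rfl⟩)
    · exact Subgroup.subset_closure (Or.inl rfl)
  refine ⟨?_, ?_⟩
  · intro g hg
    rcases hK _ hg with ⟨r, t, e⟩ | ⟨r, t, s, e⟩
    · have e1 := congrArg (fun y : SL (Fin 2) F × Γ => y.1.1) e
      simp only [Prod.fst_mul, hY, hk, hv, val_mul, tv01, MonoidHom.prod_apply,
        hM_coe, Matrix.mul_fin_two] at e1
      have a1 := congrFun (congrFun e1 0) 0
      have a2 := congrFun (congrFun e1 0) 1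
      simp at a1 a2
      subst a2
      have : t = 1 := Units.ext a1.symm
      subst this
      rw [Y0, map_one, mul_one] at e
      exact (Prod.ext_iff.1 e).2
    · have e1 := congrArg (fun y : SL (Fin 2) F × Γ => y.1.1) e
      simp only [Prod.fst_mul, hY, hk, hv, val_mul, tv01, MonoidHom.prod_apply,
        hM_coe, wM_coe, Matrix.mul_fin_two] at e1
      have a1 := congrFun (congrFun e1 1) 0
      simp at a1
  · have : K.map (MonoidHom.fst _ _) = ⊤ := by
      have m1 : ∀ r, tv 0 1 r ∈ K.map (MonoidHom.fst (SL (Fin 2) F) Γ) := fun r =>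
        ⟨Y r, Subgroup.subset_closure (Or.inr ⟨r, rfl⟩), rfl⟩
      have m2 : wM ∈ K.map (MonoidHom.fst (SL (Fin 2) F) Γ) :=
        ⟨v, Subgroup.subset_closure (Or.inl rfl), rfl⟩
      refine tv_gen2 _ m1 fun r => ?_
      rw [← wM_conj]
      exact mul_mem (mul_mem m2 (m1 _)) (inv_mem m2)
    intro a
    have ha : a ∈ K.map (MonoidHom.fst _ _) := by rw [this]; trivial
    obtain ⟨⟨a', g⟩, hg, rfl⟩ := ha
    exact ⟨g, hg⟩

/-- The word for a diagonal element. -/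
def Vw (X : F → Γ) (w : Γ) (t : F) : Γ := w⁻¹ * X (-t⁻¹) * w * X (-t) * w * X (-t⁻¹)

theorem sl2d_of {X : F → Γ} {w H : Γ} (g : Fˣ) (hg : ∀ t : Fˣ, ∃ k : ℕ, t = g ^ k)
    (add : ∀ r s, X (r + s) = X r * X s) (hX : ∀ r, H * X r * H⁻¹ = X ((g : F) ^ 2 * r))
    (hw : H * w * H = w) (V1 : Vw X w 1 = 1) (Vg : Vw X w g = H) (Vm : w * w = Vw X w (-1)) :
    ∃ h : Fˣ →* Γ, SL2D X w h ∧ ∀ t : Fˣ, h t = Vw X w t := by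
  have X0 : X 0 = 1 := by simpa using add 0 0
  have hX' : ∀ r, H * X r = X ((g : F) ^ 2 * r) * H := fun r => by rw [← hX]; simp
  have hX2 : ∀ r, H⁻¹ * X r = X (((g : F)⁻¹) ^ 2 * r) * H⁻¹ := fun r => by
    rw [inv_mul_eq_iff_eq_mul, ← mul_assoc, hX', ← mul_assoc]; simp [← mul_assoc]
  have hw1 : H * w = w * H⁻¹ := by rw [eq_mul_inv_iff_mul_eq, hw]
  have hw2 : H⁻¹ * w = w * H := by rw [inv_mul_eq_iff_eq_mul, ← mul_assoc, hw]
  have hw3 : H * w⁻¹ = w⁻¹ * H⁻¹ := by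
    rw [eq_inv_mul_iff_mul_eq, ← mul_assoc, ← hw2]; simp
  have step : ∀ t : F, Vw X w ((g : F) ^ 2 * t) = H * Vw X w t * H := by
    intro t
    have h1 : ∀ r Z, H⁻¹ * (X r * Z) = X (((g : F)⁻¹) ^ 2 * r) * (H⁻¹ * Z) := fun r Z => by
      rw [← mul_assoc, hX2, mul_assoc]
    have h2 : ∀ r Z, H * (X r * Z) = X (((g : F)) ^ 2 * r) * (H * Z) := fun r Z => by
      rw [← mul_assoc, hX', mul_assoc]
    have h3 : ∀ Z, H * (w * Z) = w * (H⁻¹ * Z) := fun Z => by rw [← mul_assoc, hw1, mul_assoc]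
    have h4 : ∀ Z, H⁻¹ * (w * Z) = w * (H * Z) := fun Z => by rw [← mul_assoc, hw2, mul_assoc]
    have h5 : ∀ Z, H * (w⁻¹ * Z) = w⁻¹ * (H⁻¹ * Z) := fun Z => by rw [← mul_assoc, hw3, mul_assoc]
    simp only [Vw, mul_assoc, h1, h2, h3, h4, h5, inv_mul_cancel, mul_one]
    simp [_root_.mul_inv_rev, mul_comm]
  have hV : ∀ k : ℕ, Vw X w ((g : F) ^ k) = H ^ k := by
    intro k
    induction k using Nat.strong_induction_on with
    | _ k ih =>
      match k with
      | 0 => simpa using V1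
      | 1 => simpa using Vg
      | k + 2 =>
        have := step ((g : F) ^ k)
        rw [ih k (by omega)] at this
        rw [add_comm k 2, pow_add, this, ← pow_succ', ← pow_succ]
        congr 1; omega
  have hV' : ∀ k : ℕ, Vw X w (((g ^ k : Fˣ) : F)) = H ^ k := fun k => by
    rw [Units.val_pow_eq_pow_val, hV]
  let h : Fˣ →* Γ := MonoidHom.mk' (fun t => Vw X w t) (by
    intro s t
    obtain ⟨i, rfl⟩ := hg s
    obtain ⟨j, rfl⟩ := hg t
    rw [← pow_add, hV', hV', hV', pow_add])
  have hh : ∀ k : ℕ, h (g ^ k) = H ^ k := hV'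
  refine ⟨h, ⟨add, ?_, ?_, ?_, ?_⟩, fun t => rfl⟩
  · intro t r
    obtain ⟨k, rfl⟩ := hg t
    rw [hh]
    induction k generalizing r with
    | zero => simp
    | succ k ih =>
      rw [pow_succ, mul_assoc, hX', ← mul_assoc, ih, mul_assoc]
      congr 2
      simp; ring
  · intro t
    obtain ⟨k, rfl⟩ := hg t
    rw [hh]
    induction k with
    | zero => simp
    | succ k ih =>
      rw [pow_succ, mul_assoc, hw1, ← mul_assoc, ih, mul_assoc, ← _root_.mul_inv_rev,
        ← pow_succ', pow_succ]
  · rw [Vm]; change _ = Vw X w _; simp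
  · intro t
    have hc : X (-(t : F)⁻¹) * X (t : F)⁻¹ = 1 := by rw [← add, neg_add_cancel, X0]
    have hc' : X (t : F)⁻¹ * X (-(t : F)⁻¹) = 1 := by rw [← add, add_neg_cancel, X0]
    change _ = _ * w * Vw X w ((-t : Fˣ) : F) * _
    simp only [Vw, Units.val_neg, inv_neg, neg_neg, mul_assoc, hc', mul_one]
    rw [mul_inv_cancel_left, ← mul_assoc (X (-(t : F)⁻¹)), hc, one_mul]

end SLP


set_option linter.unusedSectionVars false
set_option linter.unusedSimpArgs false
set_option linter.unusedVariables false

namespace SLP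
open scoped commutatorElement
open Matrix

section fieldchoice
variable {F : Type} [Field F] [Fintype F]

theorem exists_gen : ∃ g : Fˣ, (∀ t : Fˣ, ∃ k : ℕ, t = g ^ k) ∧ orderOf g = Fintype.card F - 1 := by
  classical
  obtain ⟨g, hg⟩ := IsCyclic.exists_generator (α := Fˣ)
  refine ⟨g, fun t => ?_, ?_⟩
  · have := hg t
    rw [← mem_powers_iff_mem_zpowers] at this
    obtain ⟨k, hk⟩ := this
    exact ⟨k, hk.symm⟩
  · rw [orderOf_eq_card_of_forall_mem_zpowers hg, Nat.card_eq_fintype_card, Fintype.card_units]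

theorem closure_top_of_gen {g : Fˣ} (hg : ∀ t : Fˣ, ∃ k : ℕ, t = g ^ k) (K : Subring F)
    (h : (g : F) ∈ K) : K = ⊤ := by
  rw [eq_top_iff]
  intro x _
  by_cases hx : x = 0
  · rw [hx]; exact K.zero_mem
  · obtain ⟨k, hk⟩ := hg (Units.mk0 x hx)
    have : x = (g : F) ^ k := by
      have := congrArg Units.val hk
      simpa using this
    rw [this]; exact K.pow_mem h k

theorem subring_card (K : Subring F) (hK : K ≠ ⊤) : ∃ q0 : ℕ, q0 * q0 ≤ Fintype.card F ∧ 2 ≤ q0 ∧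
    (∀ x ∈ K, x ^ q0 = x) ∧ ∀ x y : F, (x + y) ^ q0 = x ^ q0 + y ^ q0 := by
  classical
  let K' : Subfield F := { K with
    inv_mem' := by
      intro x hx
      by_cases h0 : x = 0
      · subst h0; simpa using hx
      · have h1 : x * x ^ (Fintype.card F - 2) = 1 := by
          rw [← pow_succ']
          have := FiniteField.pow_card_sub_one_eq_one x h0
          have h2 := Fintype.one_lt_card (α := F)
          rw [← this]; congr 1; omega
        rw [inv_eq_of_mul_eq_one_right h1]
        exact K.pow_mem hx _ }
  have hc := Module.card_eq_pow_finrank (K := K') (V := F)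
  obtain ⟨p, hp⟩ := CharP.exists K'
  obtain ⟨⟨n, hn⟩, hpp, hcard⟩ := FiniteField.card K' p
  have : Fact p.Prime := ⟨hpp⟩
  have hpF : CharP F p := (RingHom.charP_iff (algebraMap K' F) (algebraMap K' F).injective p).1 hp
  refine ⟨Nat.card K', ?_, ?_, ?_, ?_⟩
  · have hd : 2 ≤ Module.finrank K' F := by
      by_contra hlt
      have h1 : Module.finrank K' F = 1 := by
        have := Module.finrank_pos (R := K') (M := F)
        omega
      rw [h1, pow_one] at hc
      apply hK
      rw [eq_top_iff]
      intro x _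
      have hsub : Function.Bijective (Subtype.val : K' → F) := by
        rw [Fintype.bijective_iff_injective_and_card]
        exact ⟨Subtype.val_injective, hc.symm⟩
      obtain ⟨y, rfl⟩ := hsub.2 x
      exact y.2
    rw [hc, ← pow_two, Nat.card_eq_fintype_card]
    exact Nat.pow_le_pow_right Fintype.card_pos hd
  · rw [Nat.card_eq_fintype_card]; exact Fintype.one_lt_card
  · intro x hx
    rw [Nat.card_eq_fintype_card]
    have := FiniteField.pow_card (⟨x, hx⟩ : K')
    exact congrArg Subtype.val this
  · intro x y
    rw [Nat.card_eq_fintype_card, hcard]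
    exact add_pow_char_pow x y p n

theorem exists_ab (hq : 9 < Fintype.card F) : ∃ g a b : Fˣ, (∀ t : Fˣ, ∃ k : ℕ, t = g ^ k) ∧
    (b : F) ^ 2 = (a : F) ^ 2 + 1 ∧ Subring.closure {(a : F) ^ 2} = ⊤ := by
  classical
  obtain ⟨g, hg, ho⟩ := exists_gen (F := F)
  have hne : ∀ k : ℕ, 0 < k → k < 9 → (g : F) ^ k ≠ 1 := by
    intro k hk hk' h
    have : g ^ k = 1 := Units.ext (by simpa using h)
    have := Nat.le_of_dvd hk (orderOf_dvd_of_pow_eq_one this)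
    omega
  have g0 : (g : F) ≠ 0 := g.ne_zero
  by_cases h2 : (2 : F) = 0
  · have hch : CharP F 2 := CharTwo.of_one_ne_zero_of_two_eq_zero one_ne_zero h2
    have hb : (g : F) + 1 ≠ 0 := by
      intro h
      apply hne 1 (by norm_num) (by norm_num)
      rw [pow_one]
      linear_combination h - h2
    refine ⟨g, g, Units.mk0 _ hb, hg, ?_, ?_⟩
    · rw [Units.val_mk0]; linear_combination (g : F) * h2
    · apply closure_top_of_gen hg
      have hm : (g : F) ^ 2 ∈ Subring.closure {(g : F) ^ 2} := Subring.subset_closure rfl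
      have hcard : Fintype.card F = 2 * (Fintype.card F / 2) := by
        obtain ⟨n, -, h⟩ := FiniteField.card F 2
        have : 2 ∣ Fintype.card F := by rw [h]; exact dvd_pow_self 2 n.ne_zero
        omega
      have : (g : F) = ((g : F) ^ 2) ^ (Fintype.card F / 2) := by
        rw [← pow_mul, ← hcard, FiniteField.pow_card]
      have h3 := Subring.pow_mem _ hm (Fintype.card F / 2)
      rwa [← this] at h3
  · have ha : ((g : F)⁻¹ - g) / 2 ≠ 0 := by
      intro h
      apply hne 2 (by norm_num) (by norm_num)
      field_simp at h
      linear_combination -h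
    have hb : ((g : F)⁻¹ + g) / 2 ≠ 0 := by
      intro h
      apply hne 4 (by norm_num) (by norm_num)
      field_simp at h
      linear_combination ((g : F) ^ 2 - 1) * h
    refine ⟨g, Units.mk0 _ ha, Units.mk0 _ hb, hg, ?_, ?_⟩
    · rw [Units.val_mk0, Units.val_mk0]; field_simp; ring
    · by_contra hK
      set K := Subring.closure {((Units.mk0 _ ha : Fˣ) : F) ^ 2} with hKd
      obtain ⟨q0, h1, h2q, h3, h4⟩ := subring_card K hK
      have hm : ((Units.mk0 _ ha : Fˣ) : F) ^ 2 ∈ K := Subring.subset_closure rfl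
      rw [Units.val_mk0] at hm
      set t : F := (g : F) ^ 2 with ht
      have t0 : t ≠ 0 := pow_ne_zero _ g0
      have hs : t + t⁻¹ ∈ K := by
        have : t + t⁻¹ = 4 * (((g : F)⁻¹ - g) / 2) ^ 2 + 2 := by
          rw [ht]; field_simp; ring
        rw [this]
        exact K.add_mem (K.mul_mem (by exact_mod_cast natCast_mem K 4) hm)
          (by exact_mod_cast natCast_mem K 2)
      have e := h3 _ hs
      rw [h4, inv_pow] at e
      have T0 : t ^ q0 ≠ 0 := pow_ne_zero _ t0
      have key : (t ^ q0 - t) * (t ^ q0 * t - 1) = 0 := by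
        field_simp at e
        linear_combination e
      have bound : ∀ k : ℕ, 0 < k → t ^ k = 1 → Fintype.card F - 1 ≤ 2 * k := by
        intro k hk h
        have : g ^ (2 * k) = 1 := Units.ext (by simpa [ht, pow_mul] using h)
        rw [← ho]
        exact Nat.le_of_dvd (by omega) (orderOf_dvd_of_pow_eq_one this)
      have hle : Fintype.card F - 1 ≤ 2 * (q0 + 1) := by
        rcases mul_eq_zero.1 key with h | h
        · have := bound (q0 - 1) (by omega) (by
            have h' : t * t ^ (q0 - 1) = t * 1 := by
              rw [← pow_succ', Nat.sub_add_cancel (by omega), mul_one]; exact sub_eq_zero.1 h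
            exact mul_left_cancel₀ t0 h')
          omega
        · exact bound (q0 + 1) (by omega) (by rw [pow_succ]; exact sub_eq_zero.1 h)
      have : q0 ≤ 3 := by nlinarith [Nat.sub_add_cancel (show 1 ≤ Fintype.card F by omega)]
      interval_cases q0 <;> omega

end fieldchoice

/-- Elements given by short words. -/
def Reach {G : Type} [Group G] {ι : Type} (γ : ι → G) (L : ℕ) (g : G) : Prop :=
  ∃ w, Len w L ∧ FreeGroup.lift γ w = g

namespace Reach
variable {G : Type} [Group G] {ι : Type} {γ : ι → G} {L L' : ℕ} {g h : G}
theorem mono (r : Reach γ L g) (hl : L ≤ L') : Reach γ L' g :=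
  let ⟨w, h1, h2⟩ := r; ⟨w, h1.mono hl, h2⟩
theorem of (i : ι) : Reach γ 1 (γ i) := ⟨_, Len.of i, by simp⟩
theorem one : Reach γ L 1 := ⟨1, Len.one, by simp⟩
theorem mul (r : Reach γ L g) (r' : Reach γ L' h) : Reach γ (L + L') (g * h) := by
  obtain ⟨w, h1, rfl⟩ := r
  obtain ⟨v, h2, rfl⟩ := r'
  exact ⟨w * v, h1.mul h2, by simp⟩
theorem inv (r : Reach γ L g) : Reach γ L g⁻¹ := by
  obtain ⟨w, h1, rfl⟩ := r
  exact ⟨w⁻¹, h1.inv, by simp⟩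
theorem map {G' ι' : Type} [Group G'] {γ2 : ι' → G'} (f : ι → ι') (φ : G →* G')
    (hf : ∀ i, γ2 (f i) = φ (γ i)) (r : Reach γ L g) : Reach γ2 L (φ g) := by
  obtain ⟨w, h1, rfl⟩ := r
  refine ⟨FreeGroup.map f w, h1.map f, ?_⟩
  rw [FreeGroup.map_eq_lift]
  have : (FreeGroup.lift γ2).comp (FreeGroup.lift (FreeGroup.of ∘ f)) =
      φ.comp (FreeGroup.lift γ) := by ext i; simp [hf]
  exact DFunLike.congr_fun this w
theorem mem_closure (r : Reach γ L g) : g ∈ Subgroup.closure (Set.range γ) := by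
  obtain ⟨w, -, rfl⟩ := r
  rw [← FreeGroup.range_lift_eq_closure]
  exact ⟨w, rfl⟩
end Reach

theorem Pres.extend {G : Type} [Group G] {ι κ : Type} [Fintype κ] {γ : ι → G} {C L : ℕ}
    (h : Pres γ C L) (γ0 : κ → G) (hr : ∀ k, Reach γ L (γ0 k)) :
    Pres (Sum.elim γ γ0) (C + Fintype.card κ * 1) (L + 1) := by
  choose w hw hw' using hr
  have key : ∀ (Γ : Type) [Group Γ] (γ' : ι ⊕ κ → Γ) (w : FreeGroup ι),
      FreeGroup.lift γ' (FreeGroup.map Sum.inl w) = FreeGroup.lift (γ' ∘ Sum.inl) w := by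
    intro Γ _ γ' w
    rw [FreeGroup.map_eq_lift]
    have : (FreeGroup.lift γ').comp (FreeGroup.lift (FreeGroup.of ∘ Sum.inl)) =
        FreeGroup.lift (γ' ∘ Sum.inl) := by ext i; simp
    exact DFunLike.congr_fun this w
  have h1 := Enf.map (γ2 := Sum.elim γ γ0) Sum.inl (MonoidHom.id G) (fun _ => rfl) h
  have h2 := Enf.forall_fintype fun k : κ => Enf.word_eq (γ := Sum.elim γ γ0)
    (w := FreeGroup.map Sum.inl (w k)) (v := FreeGroup.of (Sum.inr k)) ((hw k).map _) (Len.of _)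
    (by rw [key]; simpa using hw' k)
  refine ((h1.mono le_rfl (Nat.le_succ _) fun _ _ _ h => h).and h2).mono le_rfl le_rfl ?_
  rintro Γ _ γ' ⟨⟨ψ, hψ⟩, hk⟩
  refine ⟨ψ, ?_⟩
  rintro (i | k)
  · exact hψ i
  · have := hk k
    rw [key] at this
    simp only [FreeGroup.lift_apply_of] at this
    rw [← this, Sum.elim_inr, ← hw' k]
    have e : ψ.comp (FreeGroup.lift γ) = FreeGroup.lift (γ' ∘ Sum.inl) := by
      ext i; simpa using hψ i
    exact DFunLike.congr_fun e (w k)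

end SLP


set_option linter.unusedSectionVars false
set_option linter.unusedSimpArgs false
set_option linter.unusedVariables false

namespace SLP
open scoped commutatorElement
open Matrix

theorem Pres.table {G : Type} [Group G] [Fintype G] :
    Pres (id : G → G) ((2 * Fintype.card G + 1) ^ 3) 3 := by
  refine (Enf.short 3).mono le_rfl le_rfl ?_
  intro Γ _ γ' hs
  refine ⟨MonoidHom.mk' γ' fun a b => ?_, fun i => rfl⟩
  exact Near.unique hs (Near.of (a * b)) ((Near.of a).mul (Near.of b)) (by simp) (by norm_num)

theorem Vw_map {F Γ Γ' : Type} [Field F] [Group Γ] [Group Γ'] (f : Γ →* Γ') (X : F → Γ) (w : Γ)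
    (t : F) : f (Vw X w t) = Vw (fun r => f (X r)) (f w) t := by
  simp [Vw]

theorem Vw_len {F ι : Type} [Field F] {X : F → FreeGroup ι} {w : FreeGroup ι} {k : ℕ}
    (hX : ∀ r, Len (X r) k) (hw : Len w 1) (t : F) : Len (Vw X w t) (3 + 3 * k) :=
  (((((hw.inv.mul (hX _)).mul hw).mul (hX _)).mul hw).mul (hX _)).mono (by omega)

theorem sl2_decomp {F : Type} [Field F] (M : SL (Fin 2) F) :
    ∃ a b c d : F, M = tv 0 1 a * tv 1 0 b * tv 0 1 c * tv 1 0 d := by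
  have main : ∀ M : SL (Fin 2) F, M.1 1 0 ≠ 0 → ∃ a b c : F, M = tv 0 1 a * tv 1 0 b * tv 0 1 c := by
    intro M h
    have hd : M.1 0 0 * M.1 1 1 - M.1 0 1 * M.1 1 0 = 1 := by
      have := M.2; rwa [det_fin_two] at this
    refine ⟨(M.1 0 0 - 1) / M.1 1 0, M.1 1 0, (M.1 1 1 - 1) / M.1 1 0, ?_⟩
    apply Subtype.ext
    rw [val_mul, val_mul, tv01, tv10, tv01, Matrix.mul_fin_two, Matrix.mul_fin_two]
    ext i j
    fin_cases i <;> fin_cases j <;> simp <;> field_simp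
    · ring
    · linear_combination -hd
    · ring
  by_cases h : M.1 1 0 = 0
  · have hd : M.1 0 0 * M.1 1 1 - M.1 0 1 * M.1 1 0 = 1 := by
      have := M.2; rwa [det_fin_two] at this
    rw [h, mul_zero, sub_zero] at hd
    have h1 : M.1 1 1 ≠ 0 := right_ne_zero_of_mul_eq_one hd
    obtain ⟨a, b, c, e⟩ := main (M * tv 1 0 1) (by
      rw [val_mul, tv10, Matrix.mul_apply]; simp [Fin.sum_univ_two, h, h1])
    refine ⟨a, b, c, -1, ?_⟩
    rw [← e, mul_assoc, ← tv_stein.add (by simp), add_neg_cancel, tv_stein.zero (by simp), mul_one]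
  · obtain ⟨a, b, c, e⟩ := main M h
    refine ⟨a, b, c, 0, ?_⟩
    rw [tv_stein.zero (by simp), mul_one, e]

theorem sl2_large : ∃ C : ℕ, ∀ (F : Type) [Field F] [Fintype F], 9 < Fintype.card F →
    ∃ γ : Fin 6 → SL (Fin 2) F, Pres γ C (C * (1 + Nat.log 2 (Fintype.card F))) ∧
      ∀ g, Reach γ (C * (1 + Nat.log 2 (Fintype.card F))) g := by
  refine ⟨(2 * Fintype.card (Fin 6) + 1) ^ 20 + 5000, ?_⟩
  intro F _ _ hq
  set ℓ := Nat.log 2 (Fintype.card F) with hℓ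
  obtain ⟨g, a, b, hg, hab, htop⟩ := exists_ab hq
  obtain ⟨c, hc⟩ := CharP.exists F
  have hcp : Fact c.Prime := ⟨CharP.char_is_prime F c⟩
  obtain ⟨hE, e1, e2, s1, s2, z1, z2, hlift⟩ := field_prog ((a : F) ^ 2) htop c
  choose E hEs hEe using hE
  obtain ⟨η, hη⟩ : ∃ η : Fˣ, (η : F) ^ 2 = (tau c : ℕ) := by
    by_cases h : c = 2
    · exact ⟨1, by simp [tau, h]⟩
    · have : (2 : F) ≠ 0 := by
        intro h2
        have := (CharP.cast_eq_zero_iff F c 2).1 (by exact_mod_cast h2)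
        exact h ((Nat.prime_dvd_prime_iff_eq hcp.out Nat.prime_two).1 this)
      refine ⟨Units.mk0 2 this, ?_⟩
      rw [Units.val_mk0, tau, if_neg h]; norm_num
  let γ : Fin 6 → SL (Fin 2) F := ![tv 0 1 1, wM, hM a, hM b, hM g, hM η]
  have D := sl2d_matrix (F := F)
  have hconj : ∀ (t : Fˣ) r, hM t * tv 0 1 r * (hM t)⁻¹ = tv 0 1 ((t : F) ^ 2 * r) := by
    intro t r; rw [D.hX]; simp
  let u : FreeGroup (Fin 6) := FreeGroup.of 0
  let w : FreeGroup (Fin 6) := FreeGroup.of 1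
  let A : FreeGroup (Fin 6) := FreeGroup.of 2
  let H2 : FreeGroup (Fin 6) := FreeGroup.of 5
  let EV : F → FreeGroup (Fin 6) := fun r => (E r).val u A H2
  have EVlen : ∀ r, Len (EV r) (200 * ℓ) := fun r =>
    ((E r).val_len (Len.of 0) (Len.of 2) (Len.of 5)).mono (by have := hEs r; omega)
  have GX : ∀ e : Ex, FreeGroup.lift γ (e.val u A H2) = tv 0 1 (e.eval (tau c) ((a : F) ^ 2)) := by
    intro e
    rw [Ex.val_map]
    refine Ex.val_eq D.add ?_ ?_ ?_ e
    · simp [u, γ]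
    · intro r; rw [← hconj]; simp [A, γ]
    · intro r; rw [← hη, ← hconj]; simp [H2, γ]
  have GEV : ∀ r, FreeGroup.lift γ (EV r) = tv 0 1 r := fun r => by rw [GX, hEe]
  have GV : ∀ t : Fˣ, FreeGroup.lift γ (Vw EV w t) = hM t := by
    intro t
    rw [Vw_map, D.hM_eq]
    simp only [GEV, Vw]; simp [w, γ]
  have Vlen : ∀ t, Len (Vw EV w t) (600 * ℓ + 3) := fun t => (Vw_len EVlen (Len.of 1) t).mono (by omega)
  have reach : ∀ M, Reach γ (2000 * (1 + ℓ)) M := by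
    intro M
    have r1 : ∀ r, Reach γ (200 * ℓ) (tv 0 1 r) := fun r => ⟨_, EVlen r, GEV r⟩
    have r2 : ∀ r, Reach γ (1 + 200 * ℓ + 1) (tv 1 0 r) := fun r => by
      rw [← wM_conj]
      exact ((Reach.of (γ := γ) 1).mul (r1 _)).mul (Reach.of (γ := γ) 1).inv
    obtain ⟨x, y, z, t, rfl⟩ := sl2_decomp M
    exact ((((r1 x).mul (r2 y)).mul (r1 z)).mul (r2 t)).mono (by omega)
  refine ⟨γ, ?_, fun M => (reach M).mono (Nat.mul_le_mul_right _ (by norm_num))⟩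
  have k0 := Enf.short (γ := γ) 20
  have k1 := Enf.word (γ := γ) (w := e1.val u A H2) (L := 1000 * (1 + ℓ))
    ((e1.val_len (Len.of 0) (Len.of 2) (Len.of 5)).mono (by omega)) (by
      rw [GX, z1]; exact tv_stein.zero (by simp))
  have k2 := Enf.word (γ := γ) (w := e2.val u A H2) (L := 1000 * (1 + ℓ))
    ((e2.val_len (Len.of 0) (Len.of 2) (Len.of 5)).mono (by omega)) (by
      rw [GX, z2]; exact tv_stein.zero (by simp))
  have k3 := Enf.word_eq (γ := γ) (w := EV ((g : F) ^ 2)) (L := 1000 * (1 + ℓ))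
    ((EVlen _).mono (by omega)) (((Len.of (ι := Fin 6) 4).mul (Len.of 0)).mul (Len.of 4).inv) (by
      rw [GEV, ← mul_one ((g : F) ^ 2), ← hconj]; simp [γ])
  have kV : ∀ (i : Fin 6) (t : Fˣ), γ i = hM t → Enf γ 1 (1000 * (1 + ℓ) + 3) fun _ _ γ' =>
      FreeGroup.lift γ' (Vw EV w t) = γ' i := fun i t hi =>
    (Enf.word_eq (γ := γ) (w := Vw EV w t) (v := FreeGroup.of i) (Vlen _) (Len.of i) (by
      rw [GV, FreeGroup.lift_apply_of, hi])).mono le_rfl (by omega) fun _ _ _ h => by simpa using h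
  have k4 := kV 2 a rfl
  have k5 := kV 3 b rfl
  have k6 := kV 4 g rfl
  have k7 := kV 5 η rfl
  have up : ∀ {C L P}, Enf γ C L P → L ≤ 1000 * (1 + ℓ) + 3 → Enf γ C (1000 * (1 + ℓ) + 3) P :=
    fun h h' => h.mono le_rfl h' fun _ _ _ h => h
  refine ((((((((up k0 (by omega)).and (up k1 (by omega))).and (up k2 (by omega))).and
    (up k3 (by omega))).and k4).and k5).and k6).and k7).mono (by omega)
    ((by omega : 1000 * (1 + ℓ) + 3 ≤ 5000 * (1 + ℓ)).trans
      (Nat.mul_le_mul_right _ (by norm_num))) ?_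
  rintro Γ _ γ' ⟨⟨⟨⟨⟨⟨⟨hs, h1⟩, h2⟩, h3⟩, h4⟩, h5⟩, h6⟩, h7⟩
  have N : ∀ i, Near γ γ' 1 (γ i) (γ' i) := fun i => Near.of i
  have hAB : Commute (γ' 2) (γ' 3) := Near.unique hs ((N 2).mul (N 3)) ((N 3).mul (N 2)) (by
    change hM a * hM b = hM b * hM a; rw [← map_mul, mul_comm, map_mul]) (by norm_num)
  have hAH : Commute (γ' 2) (γ' 5) := Near.unique hs ((N 2).mul (N 5)) ((N 5).mul (N 2)) (by
    change hM a * hM η = hM η * hM a; rw [← map_mul, mul_comm, map_mul]) (by norm_num)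
  have hAg : Commute (γ' 2) (γ' 4) := Near.unique hs ((N 2).mul (N 4)) ((N 4).mul (N 2)) (by
    change hM a * hM g = hM g * hM a; rw [← map_mul, mul_comm, map_mul]) (by norm_num)
  have huA : Commute (γ' 0) (γ' 2 * γ' 0 * (γ' 2)⁻¹) :=
    Near.unique hs ((N 0).mul ((N 2).conj (N 0))) (((N 2).conj (N 0)).mul (N 0)) (by
      change tv 0 1 1 * (hM a * tv 0 1 1 * (hM a)⁻¹) = (hM a * tv 0 1 1 * (hM a)⁻¹) * tv 0 1 1
      rw [hconj, ← tv_stein.add (by simp), ← tv_stein.add (by simp), add_comm]) (by norm_num)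
  have hB : γ' 3 * γ' 0 * (γ' 3)⁻¹ = γ' 2 * γ' 0 * (γ' 2)⁻¹ * γ' 0 :=
    Near.unique hs ((N 3).conj (N 0)) (((N 2).conj (N 0)).mul (N 0)) (by
      change hM b * tv 0 1 1 * (hM b)⁻¹ = hM a * tv 0 1 1 * (hM a)⁻¹ * tv 0 1 1
      rw [hconj, hconj, ← tv_stein.add (by simp), hab]; congr 1; ring) (by norm_num)
  have hH : γ' 5 * γ' 0 * (γ' 5)⁻¹ = γ' 0 ^ tau c := by
    have tpow : ∀ n : ℕ, (tv 0 1 1 : SL (Fin 2) F) ^ n = tv 0 1 (n : F) := by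
      intro n
      induction n with
      | zero => simp [tv_stein.zero (show (0 : Fin 2) ≠ 1 by simp)]
      | succ n ih => rw [pow_succ, ih, ← tv_stein.add (by simp)]; simp
    have npow : ∀ n : ℕ, Near γ γ' n (γ 0 ^ n) (γ' 0 ^ n) := by
      intro n
      induction n with
      | zero => simpa using Near.one
      | succ n ih => rw [pow_succ, pow_succ]; exact ih.mul (N 0)
    refine Near.unique hs ((N 5).conj (N 0)) (npow (tau c)) ?_ ?_
    · change hM η * tv 0 1 1 * (hM η)⁻¹ = (tv 0 1 1) ^ tau c
      rw [hconj, tpow, hη, mul_one]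
    · unfold tau; split_ifs <;> norm_num
  rw [Ex.val_map] at h1 h2
  obtain ⟨X, Xadd, X1, XA, XH⟩ := baum (u := γ' 0) (A := γ' 2) (B := γ' 3) (H := γ' 5) hAB huA hB
    hAH hH hlift (by simpa [u, A, H2] using h1) (by simpa [u, A, H2] using h2)
  have lX : ∀ r, FreeGroup.lift γ' (EV r) = X r := by
    intro r
    simp only [EV]
    rw [Ex.val_map]
    conv_rhs => rw [← hEe r]
    exact Ex.val_eq Xadd (by simp [X1, u]) (by simpa [A] using XA) (by simpa [H2] using XH) _
  have lV : ∀ t, FreeGroup.lift γ' (Vw EV w t) = Vw X (γ' 1) t := by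
    intro t; rw [Vw_map]; simp only [lX]; simp [w]
  rw [lV] at h4 h5 h6 h7
  have hXg : ∀ r, γ' 4 * X r * (γ' 4)⁻¹ = X ((g : F) ^ 2 * r) := by
    have X0 : X 0 = 1 := by simpa using Xadd 0 0
    have Xneg : ∀ r, X (-r) = (X r)⁻¹ := fun r => by
      rw [eq_inv_iff_mul_eq_one, ← Xadd, neg_add_cancel, X0]
    have gen : ∀ e : Ex, γ' 4 * X (e.eval (tau c) ((a : F) ^ 2)) * (γ' 4)⁻¹ =
        X ((g : F) ^ 2 * e.eval (tau c) ((a : F) ^ 2)) := by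
      have hmul : ∀ r s, γ' 4 * X r * (γ' 4)⁻¹ = X ((g : F) ^ 2 * r) →
          γ' 4 * X s * (γ' 4)⁻¹ = X ((g : F) ^ 2 * s) →
          γ' 4 * X (r + s) * (γ' 4)⁻¹ = X ((g : F) ^ 2 * (r + s)) := by
        intro r s hr hs
        rw [Xadd, mul_add, Xadd, ← hr, ← hs]; group
      intro e
      induction e with
      | zero => simp [Ex.eval, X0]
      | one =>
        simp only [Ex.eval, mul_one, X1]
        rw [lX] at h3
        rw [h3]; simp
      | add x y hx hy => exact hmul _ _ hx hy
      | mulX x hx =>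
        simp only [Ex.eval]
        rw [← XA, mul_left_comm, ← XA, ← hx]
        have := hAg.eq
        calc γ' 4 * (γ' 2 * X (x.eval (tau c) ((a : F) ^ 2)) * (γ' 2)⁻¹) * (γ' 4)⁻¹
            = (γ' 4 * γ' 2) * X (x.eval (tau c) ((a : F) ^ 2)) * (γ' 4 * γ' 2)⁻¹ := by group
          _ = _ := by rw [← this]; group
      | mulT x hx =>
        simp only [Ex.eval]
        have : ∀ n : ℕ, γ' 4 * X ((n : F) * x.eval (tau c) ((a : F) ^ 2)) * (γ' 4)⁻¹ =
            X ((g : F) ^ 2 * ((n : F) * x.eval (tau c) ((a : F) ^ 2))) := by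
          intro n
          induction n with
          | zero => simp [X0]
          | succ n ih => rw [Nat.cast_succ, add_mul, one_mul]; exact hmul _ _ ih hx
        exact this _
    intro r; rw [← hEe r]; exact gen _
  have Xm1 : X (-1) = (γ' 0)⁻¹ := by
    have X0 : X 0 = 1 := by simpa using Xadd 0 0
    rw [eq_inv_iff_mul_eq_one, ← X1, ← Xadd, neg_add_cancel, X0]
  have tm1 : (tv 0 1 (-1) : SL (Fin 2) F) = (tv 0 1 1)⁻¹ := tv_stein.neg (by simp) 1
  obtain ⟨h, Dh, hh⟩ := sl2d_of (X := X) (w := γ' 1) (H := γ' 4) g hg Xadd hXg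
    (Near.unique hs (((N 4).mul (N 1)).mul (N 4)) (N 1) (by
      change hM g * wM * hM g = wM
      rw [D.hw]; simp) (by norm_num))
    (by
      simp only [Vw, inv_one, Xm1]
      refine Near.unique hs (((((((N 1).inv).mul (N 0).inv).mul (N 1)).mul (N 0).inv).mul
        (N 1)).mul (N 0).inv) (Near.one (k := 0)) ?_ (by norm_num)
      change wM⁻¹ * (tv 0 1 1)⁻¹ * wM * (tv 0 1 1)⁻¹ * wM * (tv 0 1 1)⁻¹ = 1
      have := D.hM_eq 1
      rw [map_one] at this
      rw [this, ← tm1]; simp)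
    h6
    (by
      simp only [Vw, inv_neg, inv_one, neg_neg, X1]
      refine Near.unique hs ((N 1).mul (N 1)) (((((((N 1).inv).mul (N 0)).mul (N 1)).mul
        (N 0)).mul (N 1)).mul (N 0)) ?_ (by norm_num)
      change wM * wM = wM⁻¹ * (tv 0 1 1) * wM * (tv 0 1 1) * wM * (tv 0 1 1)
      have := D.hM_eq (-1)
      rw [D.ww, this]; simp [inv_neg])
  obtain ⟨ψ, p1, p2, p3⟩ := Dh.hom
  refine ⟨ψ, ?_⟩
  intro i
  fin_cases i
  · exact (p1 1).trans X1
  · exact p2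
  · exact (p3 a).trans ((hh a).trans h4)
  · exact (p3 b).trans ((hh b).trans h5)
  · exact (p3 g).trans ((hh g).trans h6)
  · exact (p3 η).trans ((hh η).trans h7)

end SLP


set_option linter.unusedSectionVars false
set_option linter.unusedSimpArgs false
set_option linter.unusedVariables false

namespace SLP
open scoped commutatorElement
open Matrix

theorem Pres.mono {G : Type} [Group G] {ι : Type} {γ : ι → G} {C C' L L' : ℕ} (h : Pres γ C L)
    (hC : C ≤ C') (hL : L ≤ L') : Pres γ C' L' := Enf.mono h hC hL fun _ _ _ h => h

theorem sl2_base : ∃ C : ℕ, ∀ (F : Type) [Field F] [Fintype F],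
    ∃ (ι : Type) (_ : Fintype ι) (γ : ι → SL (Fin 2) F), Fintype.card ι ≤ C ∧
      Pres γ C (C * (1 + Nat.log 2 (Fintype.card F))) ∧
      ∀ g, Reach γ (C * (1 + Nat.log 2 (Fintype.card F))) g := by
  obtain ⟨C, hC⟩ := sl2_large
  obtain ⟨B, hB⟩ : ∃ B : ℕ, B = 9 ^ 4 := ⟨_, rfl⟩
  obtain ⟨M, hM⟩ : ∃ M : ℕ, M = (2 * B + 1) ^ 3 := ⟨_, rfl⟩
  refine ⟨C + 6 + M, ?_⟩
  intro F _ _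
  classical
  by_cases hq : 9 < Fintype.card F
  · obtain ⟨γ, h1, h2⟩ := hC F hq
    exact ⟨Fin 6, inferInstance, γ, by simp; omega,
      h1.mono (by omega) (Nat.mul_le_mul_right _ (by omega)),
      fun g => (h2 g).mono (Nat.mul_le_mul_right _ (by omega))⟩
  · have hcard : Fintype.card (SL (Fin 2) F) ≤ B := by
      have h1 : Fintype.card (SL (Fin 2) F) ≤ Fintype.card (Matrix (Fin 2) (Fin 2) F) :=
        Fintype.card_le_of_injective (fun A : SL (Fin 2) F => A.1) Subtype.val_injective
      have h2 : Fintype.card (Matrix (Fin 2) (Fin 2) F) = (Fintype.card F ^ 2) ^ 2 := by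
        have : Fintype.card (Matrix (Fin 2) (Fin 2) F) = Fintype.card (Fin 2 → Fin 2 → F) := rfl
        rw [this]; simp
      rw [h2] at h1
      have h3 : Fintype.card F ≤ 9 := by omega
      calc _ ≤ _ := h1
        _ ≤ (9 ^ 2) ^ 2 := by gcongr
        _ = B := by rw [hB]; norm_num
    have hpow : (2 * Fintype.card (SL (Fin 2) F) + 1) ^ 3 ≤ M := by rw [hM]; gcongr
    have h9 : B ≤ M := by
      rw [hM]; calc B ≤ 2 * B + 1 := by omega
        _ ≤ _ := Nat.le_self_pow (by norm_num) _
    have h3 : 3 ≤ (C + 6 + M) * (1 + Nat.log 2 (Fintype.card F)) :=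
      (by omega : 3 ≤ (C + 6 + M)).trans (Nat.le_mul_of_pos_right _ (by omega))
    exact ⟨SL (Fin 2) F, inferInstance, id, by omega, Pres.table.mono (by omega) h3,
      fun g => (Reach.of (γ := id) g).mono (by omega)⟩

theorem sl2_named (N : ℕ) : ∃ C : ℕ, ∀ (F : Type) [Field F] [Fintype F] (κ : Type) [Fintype κ]
    (δ : κ → SL (Fin 2) F), Fintype.card κ ≤ N →
    ∃ (ι : Type) (_ : Fintype ι) (γ : ι → SL (Fin 2) F), Fintype.card ι ≤ C ∧
      Pres (Sum.elim γ δ) C (C * (1 + Nat.log 2 (Fintype.card F))) ∧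
      ∀ g, Reach (Sum.elim γ δ) (C * (1 + Nat.log 2 (Fintype.card F))) g := by
  obtain ⟨C, hC⟩ := sl2_base
  refine ⟨C + 1 + N, ?_⟩
  intro F _ _ κ _ δ hκ
  obtain ⟨ι, _, γ, h1, h2, h3⟩ := hC F
  refine ⟨ι, inferInstance, γ, by omega, (h2.extend δ fun k => h3 _).mono (by omega) ?_, fun g => ?_⟩
  · have : 1 ≤ (1 + N) * (1 + Nat.log 2 (Fintype.card F)) := Nat.mul_pos (by omega) (by omega)
    rw [add_assoc C, add_mul]; omega
  · exact ((h3 g).map (γ2 := Sum.elim γ δ) Sum.inl (MonoidHom.id _) fun i => rfl).mono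
      (Nat.mul_le_mul_right _ (by omega))

/-- The result for a given `n`, with a given constant. -/
def Good (C n : ℕ) : Prop := ∀ (F : Type) [Field F] [Fintype F] (z : SL (Fin n) F),
  z ∈ Subgroup.center (SL (Fin n) F) → ∃ (ι : Type) (_ : Fintype ι) (γ : ι → SL (Fin n) F) (i0 : ι),
    Fintype.card ι ≤ C ∧ Pres γ C (C * (1 + Nat.log 2 n + Nat.log 2 (Fintype.card F))) ∧
      γ i0 = z ∧ Subgroup.closure (Set.range γ) = ⊤

theorem Good.mono {C C' n : ℕ} (h : Good C n) (hC : C ≤ C') : Good C' n := by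
  intro F _ _ z hz
  obtain ⟨ι, _, γ, i0, h1, h2, h3, h4⟩ := h F z hz
  exact ⟨ι, inferInstance, γ, i0, h1.trans hC, h2.mono hC (Nat.mul_le_mul_right _ hC), h3, h4⟩

theorem good_two : ∃ C, Good C 2 := by
  obtain ⟨C, hC⟩ := sl2_named 1
  refine ⟨C + 1, ?_⟩
  intro F _ _ z hz
  obtain ⟨ι, _, γ, h1, h2, h3⟩ := hC F Unit (fun _ => z) (by simp)
  refine ⟨ι ⊕ Unit, inferInstance, _, Sum.inr (), by simpa using h1, h2.mono (by omega) ?_, rfl, ?_⟩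
  · exact Nat.mul_le_mul (by omega) (by omega)
  · rw [eq_top_iff]; intro g _; exact (h3 g).mem_closure

theorem center_cyclic {n : ℕ} (hn : 2 ≤ n) {F : Type} [Field F] [Fintype F]
    (Z : Subgroup (SL (Fin n) F)) (hZ : Z ≤ Subgroup.center (SL (Fin n) F)) :
    ∃ z ∈ Subgroup.center (SL (Fin n) F), Z = Subgroup.zpowers z := by
  have : NeZero n := ⟨by omega⟩
  have hc : IsCyclic (Subgroup.center (SL (Fin n) F)) := by
    have e := Matrix.SpecialLinearGroup.center_equiv_rootsOfUnity (n := Fin n) (R := F)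
    have : NeZero (max (Fintype.card (Fin n)) 1) := ⟨by simp⟩
    exact isCyclic_of_injective e.toMonoidHom e.injective
  have hc' : IsCyclic Z := isCyclic_of_injective (Subgroup.inclusion hZ) (Subgroup.inclusion_injective hZ)
  obtain ⟨⟨z, hz⟩, h⟩ := hc'.exists_generator
  refine ⟨z, hZ hz, le_antisymm ?_ (by simpa using hz)⟩
  intro y hy
  obtain ⟨k, hk⟩ := h ⟨y, hy⟩
  exact ⟨k, congrArg Subtype.val hk⟩

theorem HBP_mono {G : Type} [Group G] {g g' r r' : ℕ} {L L' : ℝ}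
    (h : HasBoundedPresentation G g r L) (h1 : g ≤ g') (h2 : r ≤ r') (h3 : L ≤ L') :
    HasBoundedPresentation G g' r' L' := by
  obtain ⟨m, π, R, a, b, c, d, e⟩ := h
  exact ⟨m, π, R, a.trans h1, b, c.trans h2, d, e.trans h3⟩

theorem Good.final {C n : ℕ} (hn : 2 ≤ n) (h : Good C n) (F : Type) [Field F] [Fintype F]
    (Z : Subgroup (SL (Fin n) F)) (hZ : Z ≤ Subgroup.center (SL (Fin n) F)) :
    @HasBoundedPresentation (SL (Fin n) F ⧸ Z)
      (@QuotientGroup.Quotient.group _ _ Z (normal_of_le_center hZ)) (C + (C + 1) * (C + 1))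
        (C + (C + 1) * (C + 1))
      ((C + (C + 1) * (C + 1) : ℕ) * (1 + Real.logb 2 n + Real.logb 2 (Fintype.card F))) := by
  have := normal_of_le_center hZ
  obtain ⟨z, hz, rfl⟩ := center_cyclic hn Z hZ
  obtain ⟨ι, _, γ, i0, h1, h2, h3, h4⟩ := h F z hz
  have h5 := (h2.mono le_rfl (Nat.le_succ _)).quotient (Subgroup.zpowers z) i0 (by rw [h3])
  have h6 := h5.bounded (by
    have : Set.range (fun i => QuotientGroup.mk' (Subgroup.zpowers z) (γ i)) =
      (QuotientGroup.mk' (Subgroup.zpowers z)) '' Set.range γ := by rw [← Set.range_comp]; rfl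
    rw [this, ← MonoidHom.map_closure, h4, Subgroup.map_top_of_surjective _ (QuotientGroup.mk'_surjective _)])
  refine HBP_mono h6 (by omega) (by nlinarith) ?_
  have l1 : (Nat.log 2 n : ℝ) ≤ Real.logb 2 n := by
    have := Real.natLog_le_logb n 2; simpa using this
  have l2 : (Nat.log 2 (Fintype.card F) : ℝ) ≤ Real.logb 2 (Fintype.card F) := by
    have := Real.natLog_le_logb (Fintype.card F) 2; simpa using this
  set ℓ : ℕ := 1 + Nat.log 2 n + Nat.log 2 (Fintype.card F) with hℓ
  have l3 : (ℓ : ℝ) ≤ 1 + Real.logb 2 n + Real.logb 2 (Fintype.card F) := by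
    rw [hℓ]; push_cast; linarith
  have l4 : Fintype.card ι + (C + 1) * (C * ℓ).succ ≤ (C + (C + 1) * (C + 1)) * ℓ := by
    have : 1 ≤ ℓ := by omega
    have e : (C * ℓ).succ ≤ (C + 1) * ℓ := by rw [Nat.succ_eq_add_one]; nlinarith
    have e2 : (C + 1) * (C * ℓ).succ ≤ (C + 1) * ((C + 1) * ℓ) := Nat.mul_le_mul_left _ e
    have e3 : C ≤ C * ℓ := Nat.le_mul_of_pos_right _ this
    nlinarith
  calc ((Fintype.card ι + (C + 1) * (C * ℓ).succ : ℕ) : ℝ) ≤ (((C + (C + 1) * (C + 1)) * ℓ : ℕ) : ℝ) := by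
        exact_mod_cast l4
    _ = ((C + (C + 1) * (C + 1) : ℕ) : ℝ) * ℓ := by push_cast; ring
    _ ≤ _ := by gcongr

end SLP


set_option linter.unusedSectionVars false
set_option linter.unusedSimpArgs false
set_option linter.unusedVariables false

namespace SLP
open scoped commutatorElement
open Matrix

/-- `H` acts on the family `x` as multiplication by `t`. -/
def Acts {F Γ : Type} [Field F] [Group Γ] (H : Γ) (x : F → Γ) (t : Fˣ) : Prop :=
  ∀ s, H * x s * H⁻¹ = x ((t : F) * s)

namespace Acts
variable {F Γ : Type} [Field F] [Group Γ] {H H' : Γ} {x : F → Γ} {t t' : Fˣ}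

theorem one : Acts (1 : Γ) x 1 := fun s => by simp

theorem mul (h : Acts H x t) (h' : Acts H' x t') : Acts (H * H') x (t * t') := fun s => by
  rw [Units.val_mul, mul_assoc (t : F), ← h, ← h']; group

theorem inv (h : Acts H x t) : Acts H⁻¹ x t⁻¹ := fun s => by
  have := h (((t⁻¹ : Fˣ) : F) * s)
  rw [← mul_assoc, Units.mul_inv, one_mul] at this
  rw [← this]; group

theorem pow (h : Acts H x t) (n : ℕ) : Acts (H ^ n) x (t ^ n) := by
  induction n with
  | zero => simpa using one
  | succ n ih => rw [pow_succ, pow_succ]; exact ih.mul h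

theorem zpow (h : Acts H x t) (n : ℤ) : Acts (H ^ n) x (t ^ n) := by
  cases n with
  | ofNat n => simpa using h.pow n
  | negSucc n => rw [zpow_negSucc, zpow_negSucc]; exact (h.pow _).inv

/-- extending a torus action from two values. -/
theorem of_two {K : Γ} {g : Fˣ} (hg : ∀ t : Fˣ, ∃ k : ℕ, t = g ^ k) (hx0 : x 0 = 1)
    (hK : Acts K x (g ^ 2)) (hc : Commute H K) (h0 : H * x 1 * H⁻¹ = x t)
    (h1 : H * x g * H⁻¹ = x ((t : F) * g)) : Acts H x t := by
  have key : ∀ k : ℕ, H * x ((g : F) ^ k) * H⁻¹ = x ((t : F) * (g : F) ^ k) := by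
    intro k
    induction k using Nat.strong_induction_on with
    | _ k ih =>
      match k with
      | 0 => simpa using h0
      | 1 => simpa using h1
      | k + 2 =>
        have a1 := hK ((g : F) ^ k)
        have a2 := hK ((t : F) * (g : F) ^ k)
        have e1 : (g : F) ^ (k + 2) = ((g ^ 2 : Fˣ) : F) * (g : F) ^ k := by
          rw [Units.val_pow_eq_pow_val]; ring
        rw [e1, ← a1, mul_left_comm, ← a2, ← ih k (by omega)]
        calc H * (K * x ((g : F) ^ k) * K⁻¹) * H⁻¹ = (H * K) * x ((g : F) ^ k) * (H * K)⁻¹ := by group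
          _ = _ := by rw [hc.eq]; group
  intro s
  by_cases hs : s = 0
  · subst hs; simp [hx0]
  · obtain ⟨k, hk⟩ := hg (Units.mk0 s hs)
    have : s = (g : F) ^ k := by simpa using congrArg Units.val hk
    rw [this, key]

end Acts

theorem two_param {F : Type} [Field F] {g : Fˣ} (hg : ∀ t : Fˣ, ∃ k : ℕ, t = g ^ k)
    (Q : F → F → Prop) (h0 : ∀ r, Q r 0) (h0' : ∀ s, Q 0 s)
    (hb : ∀ a b : ℕ, a < 4 → b < 4 → Q ((g : F) ^ a) ((g : F) ^ b)) {m m' : ℕ} (hm : m ≤ 4) (hm' : m' ≤ 4)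
    (mp : 0 < m) (mp' : 0 < m')
    (h1 : ∀ r s, Q r s → Q ((g : F) ^ m * r) s) (h2 : ∀ r s, Q r s → Q r ((g : F) ^ m' * s)) (r s : F) :
    Q r s := by
  have s1 : ∀ a b : ℕ, b < 4 → Q ((g : F) ^ a) ((g : F) ^ b) := by
    intro a b hb'
    induction a using Nat.strong_induction_on with
    | _ a ih =>
      by_cases h : a < 4
      · exact hb a b h hb'
      · have := h1 _ _ (ih (a - m) (by omega))
        rwa [← pow_add, show m + (a - m) = a by omega] at this
  have s2 : ∀ a b : ℕ, Q ((g : F) ^ a) ((g : F) ^ b) := by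
    intro a b
    induction b using Nat.strong_induction_on with
    | _ b ih =>
      by_cases h : b < 4
      · exact s1 a b h
      · have := h2 _ _ (ih (b - m') (by omega))
        rwa [← pow_add, show m' + (b - m') = b by omega] at this
  by_cases hr : r = 0
  · subst hr; exact h0' s
  by_cases hs : s = 0
  · subst hs; exact h0 r
  obtain ⟨k, hk⟩ := hg (Units.mk0 r hr)
  obtain ⟨l, hl⟩ := hg (Units.mk0 s hs)
  have e1 : r = (g : F) ^ k := by simpa using congrArg Units.val hk
  have e2 : s = (g : F) ^ l := by simpa using congrArg Units.val hl
  rw [e1, e2]; exact s2 k l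

/-- weight of the root `i j` with respect to the coroot `k l`. -/
def wt {I : Type} [DecidableEq I] (k l i j : I) : ℤ :=
  (if k = i then 1 else 0) - (if l = i then 1 else 0) - (if k = j then 1 else 0) +
    (if l = j then 1 else 0)

section
variable {I : Type} [DecidableEq I] {i j k l : I}
theorem wt_self (h : i ≠ j) : wt i j i j = 2 := by simp [wt, h, h.symm]
theorem wt_comm (h : j ≠ k) (h' : i ≠ l) :
    wt i j k l = (if i = k then 1 else 0) + (if j = l then 1 else 0) := by simp [wt, h, h']
theorem wt_ijjk (h1 : i ≠ j) (h2 : j ≠ k) (h3 : i ≠ k) : wt i j j k = -1 := by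
  simp [wt, h1, h2, h3]
theorem wt_jkij (h1 : i ≠ j) (h2 : j ≠ k) (h3 : i ≠ k) : wt j k i j = -1 := by
  simp [wt, h1.symm, h2.symm, h3.symm]
theorem wt_ijik (h1 : i ≠ j) (h2 : j ≠ k) (h3 : i ≠ k) : wt i j i k = 1 := by
  simp [wt, h1.symm, h2, h3]
theorem wt_jkik (h1 : i ≠ j) (h2 : j ≠ k) (h3 : i ≠ k) : wt j k i k = 1 := by
  simp [wt, h1.symm, h2, h3.symm]
end

/-- A Steinberg system from torus data. -/
theorem torus_stein {I F Γ : Type} [DecidableEq I] [Field F] [Group Γ] {x : I → I → F → Γ}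
    {H : I → I → Γ} {g : Fˣ} (hg : ∀ t : Fˣ, ∃ k : ℕ, t = g ^ k)
    (add : ∀ i j, i ≠ j → ∀ r s, x i j (r + s) = x i j r * x i j s)
    (self : ∀ i j, i ≠ j → Acts (H i j) (x i j) (g ^ 2))
    (hH : ∀ i j k l, i ≠ j → k ≠ l → Commute (H i j) (H k l))
    (act : ∀ k l i j, k ≠ l → i ≠ j → ∀ a : ℕ, a < 2 →
      H k l * x i j ((g ^ (a : ℤ) : Fˣ) : F) * (H k l)⁻¹ = x i j ((g ^ (wt k l i j + a : ℤ) : Fˣ) : F))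
    (comm : ∀ i j k l, i ≠ j → k ≠ l → j ≠ k → i ≠ l → ∀ a b : ℕ, a < 4 → b < 4 →
      Commute (x i j ((g ^ (a : ℤ) : Fˣ) : F)) (x k l ((g ^ (b : ℤ) : Fˣ) : F)))
    (mul : ∀ i j k, i ≠ j → j ≠ k → i ≠ k → ∀ a b : ℕ, a < 4 → b < 4 →
      ⁅x i j ((g ^ (a : ℤ) : Fˣ) : F), x j k ((g ^ (b : ℤ) : Fˣ) : F)⁆ =
        x i k ((g ^ (a + b : ℤ) : Fˣ) : F)) :
    Stein x ∧ ∀ k l i j, k ≠ l → i ≠ j → Acts (H k l) (x i j) (g ^ wt k l i j) := by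
  have zero : ∀ i j, i ≠ j → x i j 0 = 1 := fun i j h => by simpa using add i j h 0 0
  have acts : ∀ k l i j, k ≠ l → i ≠ j → Acts (H k l) (x i j) (g ^ wt k l i j) := by
    intro k l i j hkl hij
    refine Acts.of_two hg (zero i j hij) (self i j hij) (hH _ _ _ _ hkl hij) ?_ ?_
    · simpa using act k l i j hkl hij 0 (by norm_num)
    · have := act k l i j hkl hij 1 (by norm_num)
      rw [Nat.cast_one, zpow_one, _root_.zpow_add_one, Units.val_mul] at this
      exact this
  have T : ∀ i j k l, i ≠ j → k ≠ l → ∀ a b, a ≠ b → Acts (H i j ^ (2 : ℤ) * H k l ^ (-wt i j k l)) (x a b)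
      (g ^ (2 * wt i j a b - wt i j k l * wt k l a b)) := by
    intro i j k l hij hkl a b hab
    have := ((acts i j a b hij hab).zpow 2).mul ((acts k l a b hkl hab).zpow (-wt i j k l))
    rw [← _root_.zpow_mul, ← _root_.zpow_mul, ← _root_.zpow_add] at this
    convert this using 2; ring
  refine ⟨⟨fun h => add _ _ h, ?_, ?_⟩, acts⟩
  · intro i j k l hij hkl hjk hil r s
    by_cases hsame : i = k ∧ j = l
    · obtain ⟨rfl, rfl⟩ := hsame
      change _ = _
      rw [← add i j hij, ← add i j hij, add_comm]
    have hcase : ∃ m : ℕ, 0 < m ∧ m ≤ 4 ∧ (4 : ℤ) - wt i j k l * wt i j k l = m := by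
      rw [wt_comm hjk hil]
      by_cases h1 : i = k
      · have h2 : j ≠ l := fun h => hsame ⟨h1, h⟩
        exact ⟨3, by norm_num, by norm_num, by simp [h1, h2]⟩
      · by_cases h2 : j = l
        · exact ⟨3, by norm_num, by norm_num, by simp [h1, h2]⟩
        · exact ⟨4, by norm_num, by norm_num, by simp [h1, h2]⟩
    have hsym : wt k l i j = wt i j k l := by
      rw [wt_comm hjk hil, wt_comm hil.symm hjk.symm]; simp only [eq_comm]
    have hw1 : ∃ m : ℕ, 0 < m ∧ m ≤ 4 ∧ 2 * wt i j i j - wt i j k l * wt k l i j = m ∧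
        2 * wt i j k l - wt i j k l * wt k l k l = 0 := by
      obtain ⟨m, h1, h2, h3⟩ := hcase
      exact ⟨m, h1, h2, by rw [hsym, wt_self hij, ← h3]; ring, by rw [wt_self hkl]; ring⟩
    have hw2 : ∃ m : ℕ, 0 < m ∧ m ≤ 4 ∧ 2 * wt k l k l - wt k l i j * wt i j k l = m ∧
        2 * wt k l i j - wt k l i j * wt i j i j = 0 := by
      obtain ⟨m, h1, h2, h3⟩ := hcase
      exact ⟨m, h1, h2, by rw [hsym, wt_self hkl, ← h3]; ring, by rw [wt_self hij]; ring⟩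
    obtain ⟨m, hm0, hm4, hm, hm'⟩ := hw1
    obtain ⟨m2, hn0, hn4, hn, hn'⟩ := hw2
    have A1 := T i j k l hij hkl i j hij
    have A2 := T i j k l hij hkl k l hkl
    have B1 := T k l i j hkl hij i j hij
    have B2 := T k l i j hkl hij k l hkl
    rw [hm] at A1; rw [hm', zpow_zero] at A2; rw [hn] at B2; rw [hn', zpow_zero] at B1
    refine two_param hg (fun r s => Commute (x i j r) (x k l s)) ?_ ?_ ?_ hm4 hn4 hm0 hn0 ?_ ?_ r s
    · intro r; simp [zero k l hkl]
    · intro r; simp [zero i j hij]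
    · intro a b ha hb; simpa using comm i j k l hij hkl hjk hil a b ha hb
    · intro r s h
      have e1 := A1 r
      have e2 := A2 s
      simp only [zpow_natCast, Units.val_pow_eq_pow_val, Units.val_one, one_mul] at e1 e2
      rw [← e1, ← e2]
      exact h.map (MulAut.conj _).toMonoidHom
    · intro r s h
      have e1 := B1 r
      have e2 := B2 s
      simp only [zpow_natCast, Units.val_pow_eq_pow_val, Units.val_one, one_mul] at e1 e2
      rw [← e1, ← e2]
      exact h.map (MulAut.conj _).toMonoidHom
  · intro i j k hij hjk hik r s
    have A := T i j j k hij hjk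
    have B := T j k i j hjk hij
    have A1 := A i j hij
    have A2 := A j k hjk
    have A3 := A i k hik
    have B1 := B i j hij
    have B2 := B j k hjk
    have B3 := B i k hik
    have w1 : 2 * wt i j i j - wt i j j k * wt j k i j = (3 : ℕ) := by
      rw [wt_self hij, wt_ijjk hij hjk hik, wt_jkij hij hjk hik]; norm_num
    have w2 : 2 * wt i j j k - wt i j j k * wt j k j k = 0 := by
      rw [wt_ijjk hij hjk hik, wt_self hjk]; norm_num
    have w3 : 2 * wt i j i k - wt i j j k * wt j k i k = (3 : ℕ) := by
      rw [wt_ijik hij hjk hik, wt_ijjk hij hjk hik, wt_jkik hij hjk hik]; norm_num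
    have v1 : 2 * wt j k i j - wt j k i j * wt i j i j = 0 := by
      rw [wt_jkij hij hjk hik, wt_self hij]; norm_num
    have v2 : 2 * wt j k j k - wt j k i j * wt i j j k = (3 : ℕ) := by
      rw [wt_self hjk, wt_jkij hij hjk hik, wt_ijjk hij hjk hik]; norm_num
    have v3 : 2 * wt j k i k - wt j k i j * wt i j i k = (3 : ℕ) := by
      rw [wt_jkik hij hjk hik, wt_jkij hij hjk hik, wt_ijik hij hjk hik]; norm_num
    rw [w1] at A1; rw [w2, zpow_zero] at A2; rw [w3] at A3
    rw [v1, zpow_zero] at B1; rw [v2] at B2; rw [v3] at B3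
    refine two_param hg (fun r s => ⁅x i j r, x j k s⁆ = x i k (r * s)) ?_ ?_ ?_ (m := 3) (m' := 3)
      (by norm_num) (by norm_num) (by norm_num) (by norm_num) ?_ ?_ r s
    · intro r; simp [zero j k hjk, zero i k hik]
    · intro r; simp [zero i j hij, zero i k hik]
    · intro a b ha hb
      have := mul i j k hij hjk hik a b ha hb
      rw [_root_.zpow_add] at this
      simpa using this
    · intro r s h
      have e1 := A1 r
      have e2 := A2 s
      have e3 := A3 (r * s)
      simp only [zpow_natCast, Units.val_pow_eq_pow_val, Units.val_one, one_mul] at e1 e2 e3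
      rw [mul_assoc, ← e1, ← e2, ← e3, ← h]
      exact (map_commutatorElement (MulAut.conj _).toMonoidHom _ _).symm
    · intro r s h
      have e1 := B1 r
      have e2 := B2 s
      have e3 := B3 (r * s)
      simp only [zpow_natCast, Units.val_pow_eq_pow_val, Units.val_one, one_mul] at e1 e2 e3
      rw [mul_left_comm, ← e1, ← e2, ← e3, ← h]
      exact (map_commutatorElement (MulAut.conj _).toMonoidHom _ _).symm

end SLP


set_option linter.unusedSectionVars false
set_option linter.unusedSimpArgs false
set_option linter.unusedVariables false

namespace SLP
open scoped commutatorElement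
open Matrix

section diag
variable {I F : Type} [Fintype I] [DecidableEq I] [Field F]

theorem diag_conj {M : SL I F} {d : I → Fˣ} (hM : M.1 = diagonal fun a => (d a : F)) {i j : I} (h : i ≠ j)
    (r : F) : M * tv i j r * M⁻¹ = tv i j (((d i * (d j)⁻¹ : Fˣ) : F) * r) := by
  rw [mul_inv_eq_iff_eq_mul]
  apply Subtype.ext
  rw [val_mul, val_mul, tv_coe h, tv_coe h, hM]
  rw [Matrix.mul_add, Matrix.add_mul, Matrix.mul_one, Matrix.one_mul]
  congr 1
  ext a b
  rw [diagonal_mul, mul_diagonal, single_apply, single_apply]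
  split_ifs with hab
  · obtain ⟨rfl, rfl⟩ := hab
    simp; field_simp
  · simp

theorem diag_commute {M N : SL I F} {d e : I → F} (hM : M.1 = diagonal d) (hN : N.1 = diagonal e) :
    Commute M N := by
  apply Subtype.ext
  rw [val_mul, val_mul, hM, hN, diagonal_mul_diagonal, diagonal_mul_diagonal]
  congr 1; ext a; ring

theorem pr_inj {i j : I} (h : i ≠ j) : Function.Injective ![i, j] := by
  intro a b hab
  fin_cases a <;> fin_cases b <;> simp_all

/-- The embedding of `SL_2` at positions `i`, `j`. -/
def em {i j : I} (h : i ≠ j) : SL (Fin 2) F →* SL I F := emb ![i, j] (pr_inj h)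

theorem em_tv01 {i j : I} (h : i ≠ j) (r : F) : em h (tv 0 1 r) = tv i j r := emb_tv _ _ _ _ _
theorem em_tv10 {i j : I} (h : i ≠ j) (r : F) : em h (tv 1 0 r) = tv j i r := emb_tv _ _ _ _ _

theorem em_hM {i j : I} (h : i ≠ j) (t : Fˣ) : (em h (hM t)).1 =
    diagonal fun a => ((t ^ ((if i = a then 1 else 0) - (if j = a then 1 else 0) : ℤ) : Fˣ) : F) := by
  rw [em, emb_coe, inc_mul_mul, hM_coe]
  ext a b
  simp only [Fin.sum_univ_two, Matrix.add_apply, single_apply, diagonal_apply, Matrix.one_apply]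
  by_cases hab : a = b
  · subst hab
    by_cases h1 : i = a
    · subst h1; simp [h.symm]
    · by_cases h2 : j = a
      · subst h2; simp [h1]
      · simp [h1, h2]
  · simp [hab]
    by_cases h1 : i = a <;> by_cases h2 : j = a <;> by_cases h3 : i = b <;> by_cases h4 : j = b <;>
      simp_all

theorem em_hM_conj {k l i j : I} (h : k ≠ l) (h' : i ≠ j) (t : Fˣ) (r : F) :
    em h (hM t) * tv i j r * (em h (hM t))⁻¹ = tv i j (((t ^ wt k l i j : Fˣ) : F) * r) := by
  rw [diag_conj (em_hM h t) h', ← _root_.zpow_neg, ← _root_.zpow_add]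
  congr 4
  simp [wt]; ring

theorem scalar_reach {ι : Type} {γ : ι → SL I F} {L : ℕ} (h : ∀ (i j : I) (h : i ≠ j) g, Reach γ L (em h g))
    (i0 : I) (z : SL I F) (hz : z ∈ Subgroup.center (SL I F)) : Reach γ (Fintype.card I * L) z := by
  classical
  obtain ⟨ζ, hζ, hs⟩ := Matrix.SpecialLinearGroup.mem_center_iff.1 hz
  have hI : 0 < Fintype.card I := Fintype.card_pos_iff.2 ⟨i0⟩
  have ζ0 : ζ ≠ 0 := by
    rintro rfl
    rw [zero_pow hI.ne'] at hζ; exact zero_ne_one hζ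
  have key : ∀ S : Finset I, i0 ∉ S → ∃ M : SL I F, Reach γ (S.card * L) M ∧ M.1 =
      diagonal fun i => if i ∈ S then ζ else if i = i0 then (ζ ^ S.card)⁻¹ else 1 := by
    intro S
    induction S using Finset.induction_on with
    | empty => intro _; exact ⟨1, Reach.one, by ext a b; simp [diagonal_apply, Matrix.one_apply]⟩
    | insert a S ha ih =>
      intro h0
      rw [Finset.mem_insert, not_or] at h0
      obtain ⟨M, h1, h2⟩ := ih h0.2
      refine ⟨M * em (Ne.symm h0.1) (hM (Units.mk0 ζ ζ0)), ?_, ?_⟩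
      · rw [Finset.card_insert_of_notMem ha]
        exact (h1.mul (h _ _ _ _)).mono (by rw [add_mul, one_mul])
      · rw [val_mul, h2, em_hM, diagonal_mul_diagonal]
        congr 1; ext i
        by_cases hi : i = a
        · subst hi; simp [ha, h0.1, Ne.symm h0.1]
        · by_cases hi0 : i = i0
          · subst hi0
            rw [Finset.card_insert_of_notMem ha]
            simp [h0.2, hi, Ne.symm hi, pow_succ, mul_comm]
          · simp [hi, hi0, Ne.symm hi, Ne.symm hi0]
  obtain ⟨M, h1, h2⟩ := key (Finset.univ.erase i0) (by simp)
  have : z = M := by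
    apply Subtype.ext
    have hs' : z.1 = scalar I ζ := hs.symm
    rw [h2, hs', scalar_apply]
    congr 1; ext i
    by_cases hi : i = i0
    · subst hi
      rw [Finset.card_erase_of_mem (Finset.mem_univ _), Finset.card_univ]
      have : ζ * ζ ^ (Fintype.card I - 1) = 1 := by
        rw [← pow_succ', Nat.sub_add_cancel hI, hζ]
      simp
      exact eq_inv_of_mul_eq_one_left this
    · simp [hi]
  rw [this]
  refine h1.mono (Nat.mul_le_mul_right _ ?_)
  exact Finset.card_le_univ _

end diag

theorem wtb {I : Type} [DecidableEq I] (k l i j : I) : -2 ≤ wt k l i j ∧ wt k l i j ≤ 2 := by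
  unfold wt
  split_ifs <;> omega

theorem good_small (n : ℕ) (hn : 3 ≤ n) : ∃ C, Good C n := by
  obtain ⟨C0, hC0⟩ := sl2_named 15
  obtain ⟨N, hN⟩ : ∃ N, N = n * n * (C0 + 15) := ⟨_, rfl⟩
  refine ⟨n * n * C0 + (2 * N + 1) ^ 30 + N + n * C0 + 30 + 1 + 1, ?_⟩
  intro F _ _ z hz
  classical
  set ℓ := 1 + Nat.log 2 (Fintype.card F) with hℓ
  obtain ⟨g, hg, -⟩ := exists_gen (F := F)
  let κ := Fin 12 ⊕ Fin 2 ⊕ Unit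
  let δ : κ → SL (Fin 2) F := Sum.elim (fun k => tv 0 1 ((g ^ ((k.1 : ℤ) - 3) : Fˣ) : F))
    (Sum.elim (fun k => tv 1 0 ((g ^ ((k.1 : ℤ)) : Fˣ) : F)) fun _ => hM g)
  obtain ⟨ι, _, γ0, b1, b2, b3⟩ := hC0 F κ δ (by simp [κ])
  let I := Fin n
  let P := {p : I × I // p.1 ≠ p.2}
  let γ2 : ι ⊕ κ → SL (Fin 2) F := Sum.elim γ0 δ
  let γ : P × (ι ⊕ κ) → SL I F := fun q => em q.1.2 (γ2 q.2)
  have cP : Fintype.card P ≤ n * n := by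
    calc Fintype.card P ≤ Fintype.card (I × I) := Fintype.card_subtype_le _
      _ = n * n := by simp [I]
  have cN : Fintype.card (P × (ι ⊕ κ)) ≤ N := by
    rw [Fintype.card_prod, hN]
    refine Nat.mul_le_mul cP ?_
    simp [κ]; omega
  have rch : ∀ (i j : I) (h : i ≠ j) g, Reach γ (C0 * ℓ) (em h g) := by
    intro i j h g
    exact (b3 g).map (γ2 := γ) (fun i' => (⟨(i, j), h⟩, i')) (em h) (fun _ => rfl)
  have hgen : Subgroup.closure (Set.range γ) = ⊤ := by
    have : Nontrivial (Fin n) := Fin.nontrivial_iff_two_le.2 (by omega)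
    refine tv_gen _ fun i j hij r => ?_
    rw [← em_tv01 hij]
    exact (rch i j hij _).mem_closure
  have hpres : Pres γ (n * n * C0 + (2 * N + 1) ^ 30) (C0 * ℓ + 30) := by
    have k1 := Enf.forall_fintype (κ := P) fun p => Enf.map (γ2 := γ) (fun i' => (p, i')) (em p.2)
      (fun _ => rfl) b2
    have k2 := Enf.short (γ := γ) 30
    refine ((k1.mono le_rfl (show _ ≤ C0 * ℓ + 30 from Nat.le_add_right _ _) fun _ _ _ h => h).and
      (k2.mono le_rfl (show 30 ≤ C0 * ℓ + 30 by omega) fun _ _ _ h => h)).mono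
      (add_le_add (Nat.mul_le_mul_right _ cP) (by gcongr)) le_rfl ?_
    rintro Γ _ γ' ⟨h1, hs⟩
    choose ψ hψ using h1
    let x : I → I → F → Γ := fun i j r => if h : i ≠ j then ψ ⟨(i, j), h⟩ (tv 0 1 r) else 1
    let H : I → I → Γ := fun i j => if h : i ≠ j then ψ ⟨(i, j), h⟩ (hM g) else 1
    have xd : ∀ i j (h : i ≠ j) r, x i j r = ψ ⟨(i, j), h⟩ (tv 0 1 r) := fun i j h r => by
      simp only [x]; rw [dif_pos h]
    have Hd : ∀ i j (h : i ≠ j), H i j = ψ ⟨(i, j), h⟩ (hM g) := fun i j h => by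
      simp only [H]; rw [dif_pos h]
    have Nx : ∀ i j (h : i ≠ j) (a : ℤ), -3 ≤ a → a < 9 →
        Near γ γ' 1 (tv i j ((g ^ a : Fˣ) : F)) (x i j ((g ^ a : Fˣ) : F)) := by
      intro i j h a h1 h2
      have hδ : γ2 (Sum.inr (Sum.inl ⟨(a + 3).toNat, by omega⟩)) = tv 0 1 ((g ^ a : Fˣ) : F) := by
        change tv 0 1 ((g ^ (((a + 3).toNat : ℤ) - 3) : Fˣ) : F) = _
        rw [Int.toNat_of_nonneg (by omega), add_sub_cancel_right]
      have := Near.of (γ := γ) (γ' := γ')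
        ((⟨(i, j), h⟩, Sum.inr (Sum.inl ⟨(a + 3).toNat, by omega⟩)) : P × (ι ⊕ κ))
      rw [xd i j h, ← em_tv01 h, ← hδ]
      change Near γ γ' 1 _ (ψ _ (Sum.elim γ0 δ _))
      rw [hψ]; exact this
    have Ny : ∀ i j (h : i ≠ j) (a : ℤ), 0 ≤ a → a < 2 →
        Near γ γ' 1 (tv j i ((g ^ a : Fˣ) : F)) (ψ ⟨(i, j), h⟩ (tv 1 0 ((g ^ a : Fˣ) : F))) := by
      intro i j h a h1 h2
      have hδ : γ2 (Sum.inr (Sum.inr (Sum.inl ⟨a.toNat, by omega⟩))) = tv 1 0 ((g ^ a : Fˣ) : F) := by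
        change tv 1 0 ((g ^ ((a.toNat : ℤ)) : Fˣ) : F) = _
        rw [Int.toNat_of_nonneg (by omega)]
      have := Near.of (γ := γ) (γ' := γ')
        ((⟨(i, j), h⟩, Sum.inr (Sum.inr (Sum.inl ⟨a.toNat, by omega⟩))) : P × (ι ⊕ κ))
      rw [← em_tv10 h, ← hδ]
      change Near γ γ' 1 _ (ψ _ (Sum.elim γ0 δ _))
      rw [hψ]; exact this
    have NH : ∀ i j (h : i ≠ j), Near γ γ' 1 (em h (hM g)) (H i j) := by
      intro i j h
      have := Near.of (γ := γ) (γ' := γ')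
        ((⟨(i, j), h⟩, Sum.inr (Sum.inr (Sum.inr ()))) : P × (ι ⊕ κ))
      rw [Hd i j h]
      have e : hM g = Sum.elim γ0 δ (Sum.inr (Sum.inr (Sum.inr ()))) := rfl
      rw [e, hψ]; exact this
    have D := sl2d_matrix (F := F)
    suffices hh : Stein x ∧ ∀ k l i j, k ≠ l → i ≠ j → Acts (H k l) (x i j) (g ^ wt k l i j) by
      obtain ⟨hx, hact⟩ := hh
      have low : ∀ i j (h : i ≠ j) r, ψ ⟨(i, j), h⟩ (tv 1 0 r) = x j i r := by
        intro i j h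
        have a1 : Acts (H i j) (fun r => ψ ⟨(i, j), h⟩ (tv 1 0 r)) (g ^ wt i j j i) := by
          intro r
          rw [Hd i j h]
          have := em_hM_conj (I := Fin 2) (k := 0) (l := 1) (i := 1) (j := 0) (by simp) (by simp) g r
          have e : (em (show (0 : Fin 2) ≠ 1 by simp) (hM g) : SL (Fin 2) F) = hM g := by
            apply Subtype.ext
            rw [em_hM, hM_coe]
            ext a b; fin_cases a <;> fin_cases b <;> simp
          rw [e] at this
          have w : wt i j j i = wt (0 : Fin 2) 1 1 0 := by simp [wt, h, h.symm]
          simp only [w, ← this, map_mul, map_inv]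
        have a2 := hact i j j i h h.symm
        have w : wt i j j i = -2 := by simp [wt, h, h.symm]
        rw [w] at a1 a2
        replace a1 := a1.inv
        replace a2 := a2.inv
        rw [_root_.zpow_neg, inv_inv] at a1 a2
        have key : ∀ k : ℕ, ψ ⟨(i, j), h⟩ (tv 1 0 ((g : F) ^ k)) = x j i ((g : F) ^ k) := by
          intro k
          induction k using Nat.strong_induction_on with
          | _ k ih =>
            match k with
            | 0 =>
              have := Near.unique hs (Ny i j h 0 (by norm_num) (by norm_num))
                (Nx j i h.symm 0 (by norm_num) (by norm_num)) rfl (by norm_num)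
              simpa using this
            | 1 =>
              have := Near.unique hs (Ny i j h 1 (by norm_num) (by norm_num))
                (Nx j i h.symm 1 (by norm_num) (by norm_num)) rfl (by norm_num)
              simpa using this
            | k + 2 =>
              have e1 : (g : F) ^ (k + 2) = ((g ^ (2 : ℤ) : Fˣ) : F) * (g : F) ^ k := by
                rw [show (g ^ (2 : ℤ) : Fˣ) = g ^ 2 from zpow_natCast g 2,
                  Units.val_pow_eq_pow_val]; ring
              have a1' := a1 ((g : F) ^ k)
              simp only [ih k (by omega)] at a1'
              rw [e1, ← a2, ← a1']
        intro r
        by_cases hr : r = 0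
        · subst hr
          rw [tv_stein.zero (by simp), map_one, hx.zero h.symm]
        · obtain ⟨k, hk⟩ := hg (Units.mk0 r hr)
          have : r = (g : F) ^ k := by simpa using congrArg Units.val hk
          rw [this, key]
      have i01 : (⟨0, by omega⟩ : I) ≠ ⟨1, by omega⟩ := by simp
      obtain ⟨Ψ, hΨ⟩ := steinberg_hom' hx ⟨0, by omega⟩ ⟨1, by omega⟩ i01 (ψ ⟨(_, _), i01⟩)
        (fun r => (xd _ _ i01 r).symm) (fun r => low _ _ i01 r)
      refine ⟨Ψ, ?_⟩
      rintro ⟨⟨⟨i, j⟩, h⟩, q⟩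
      have hψ' : ψ ⟨(i, j), h⟩ (γ2 q) = γ' (⟨(i, j), h⟩, q) := hψ ⟨(i, j), h⟩ q
      rw [← hψ']
      change Ψ (em h (γ2 q)) = ψ _ (γ2 q)
      have : (Ψ.comp (em h)).eqLocus (ψ ⟨(i, j), h⟩) = ⊤ := by
        refine tv_gen2 _ (fun r => ?_) fun r => ?_
        · change Ψ (em h _) = _
          rw [em_tv01, hΨ i j h, xd i j h]
        · change Ψ (em h _) = _
          rw [em_tv10, hΨ j i h.symm, low i j h]
      have h2 : γ2 q ∈ (Ψ.comp (em h)).eqLocus (ψ ⟨(i, j), h⟩) := by rw [this]; trivial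
      exact h2
    refine torus_stein hg ?_ ?_ ?_ ?_ ?_ ?_
    · intro i j h r s
      rw [xd i j h, xd i j h, xd i j h, ← map_mul, tv_stein.add (by simp)]
    · intro i j h s
      rw [xd i j h, xd i j h, Hd i j h, ← map_mul, ← map_inv, ← map_mul, D.hX]
      simp
    · intro i j k l h1 h2
      refine Near.unique hs ((NH i j h1).mul (NH k l h2)) ((NH k l h2).mul (NH i j h1)) ?_ (by norm_num)
      exact diag_commute (em_hM _ _) (em_hM _ _)
    · intro k l i j h1 h2 a ha
      have hb := wtb k l i j
      refine Near.unique hs ((NH k l h1).conj (Nx i j h2 a (by omega) (by omega)))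
        (Nx i j h2 (wt k l i j + a) (by omega) (by omega)) ?_ (by norm_num)
      rw [em_hM_conj h1 h2, _root_.zpow_add, Units.val_mul]
    · intro i j k l h1 h2 h3 h4 a b ha hb
      refine Near.unique hs ((Nx i j h1 a (by omega) (by omega)).mul (Nx k l h2 b (by omega) (by omega)))
        ((Nx k l h2 b (by omega) (by omega)).mul (Nx i j h1 a (by omega) (by omega))) ?_ (by norm_num)
      exact tv_stein.comm h1 h2 h3 h4 _ _
    · intro i j k h1 h2 h3 a b ha hb
      refine Near.unique hs ((Nx i j h1 a (by omega) (by omega)).comm (Nx j k h2 b (by omega) (by omega)))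
        (Nx i k h3 (a + b) (by omega) (by omega)) ?_ (by norm_num)
      rw [_root_.zpow_add, Units.val_mul, ← tv_stein.mul h1 h2 h3]; rfl
  have zr : Reach γ (n * (C0 * ℓ)) z := by
    have := scalar_reach rch ⟨0, by omega⟩ z hz
    rwa [show Fintype.card I = n from Fintype.card_fin n] at this
  set L := n * (C0 * ℓ) + 30 with hL
  have hL' : C0 * ℓ + 30 ≤ L := by
    rw [hL]; have := Nat.le_mul_of_pos_left (C0 * ℓ) (show 0 < n by omega); omega
  have e := (hpres.mono le_rfl hL').extend (fun _ : Unit => z) fun _ => zr.mono (by omega)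
  refine ⟨_ ⊕ Unit, inferInstance, _, Sum.inr (), ?_, e.mono (by simp; omega) ?_, rfl, ?_⟩
  · rw [Fintype.card_sum]; simp only [Fintype.card_unit]; omega
  · have l1 : ℓ ≤ 1 + Nat.log 2 n + Nat.log 2 (Fintype.card F) := by omega
    have l2 : 1 ≤ ℓ := by omega
    calc L + 1 = n * C0 * ℓ + 31 := by rw [hL]; ring
      _ ≤ n * C0 * ℓ + 31 * ℓ := by omega
      _ = (n * C0 + 31) * ℓ := by ring
      _ ≤ _ := Nat.mul_le_mul (by omega) l1
  · rw [eq_top_iff, ← hgen]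
    apply Subgroup.closure_mono
    rintro _ ⟨i, rfl⟩
    exact ⟨Sum.inl i, rfl⟩

end SLP


set_option linter.unusedSectionVars false
set_option linter.unusedSimpArgs false
set_option linter.unusedVariables false

namespace SLP
open scoped commutatorElement
open Matrix

theorem reassoc {Γ : Type} [Group Γ] {a b c : Γ} (h1 : Commute a c) (h2 : Commute ⁅a, b⁆ ⁅b, c⁆)
    (h3 : Commute c ⁅b, c⁆) : ⁅⁅a, b⁆, c⁆ = ⁅a, ⁅b, c⁆⁆ := by
  obtain ⟨g, hg⟩ : ∃ g, g = ⁅a, b⁆ := ⟨_, rfl⟩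
  obtain ⟨k, hk⟩ : ∃ k, k = ⁅b, c⁆ := ⟨_, rfl⟩
  rw [← hg, ← hk] at h2
  rw [← hk] at h3
  rw [← hg, ← hk]
  have e1 : a * b * a⁻¹ = g * b := by rw [hg, commutatorElement_def]; group
  have e2 : a * c * a⁻¹ = c := by rw [h1.eq]; group
  have e3 : a * k * a⁻¹ = k * ⁅g, c⁆ := by
    have : a * k * a⁻¹ = (a * b * a⁻¹) * (a * c * a⁻¹) * (a * b * a⁻¹)⁻¹ * (a * c * a⁻¹)⁻¹ := by
      rw [hk, commutatorElement_def]; group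
    rw [this, e1, e2]
    have : g * b * c * (g * b)⁻¹ * c⁻¹ = g * k * g⁻¹ * ⁅g, c⁆ := by
      rw [hk, commutatorElement_def, commutatorElement_def]; group
    rw [this, h2.eq]; group
  have hc : Commute k ⁅g, c⁆ := by
    rw [commutatorElement_def]
    exact ((h2.symm.mul_right h3.symm).mul_right h2.symm.inv_right).mul_right h3.symm.inv_right
  rw [commutatorElement_def a k, e3, hc.eq]; group

theorem Commute.commutator_right {Γ : Type} [Group Γ] {a b c : Γ} (h1 : Commute a b) (h2 : Commute a c) :
    Commute a ⁅b, c⁆ := by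
  rw [commutatorElement_def]
  exact ((h1.mul_right h2).mul_right h1.inv_right).mul_right h2.inv_right

theorem commutator_mul_left {Γ : Type} [Group Γ] {a b c : Γ} (h : Commute a ⁅b, c⁆) :
    ⁅a * b, c⁆ = ⁅b, c⁆ * ⁅a, c⁆ := by
  have : ⁅a * b, c⁆ = a * ⁅b, c⁆ * a⁻¹ * ⁅a, c⁆ := by simp only [commutatorElement_def]; group
  rw [this, h.eq]; group

theorem commutator_mul_right {Γ : Type} [Group Γ] {a b c : Γ} (h : Commute b ⁅a, c⁆) :
    ⁅a, b * c⁆ = ⁅a, b⁆ * ⁅a, c⁆ := by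
  have : ⁅a, b * c⁆ = ⁅a, b⁆ * (b * ⁅a, c⁆ * b⁻¹) := by simp only [commutatorElement_def]; group
  rw [this, h.eq]; group

/-- There are many regular indices. -/
def Fresh {Q : Type} (reg : Q → Prop) : Prop :=
  ∀ a b c d e : Q, ∃ k, reg k ∧ k ≠ a ∧ k ≠ b ∧ k ≠ c ∧ k ≠ d ∧ k ≠ e

/-- The relations among names. -/
structure KM {Q S Γ : Type} [Group Γ] (reg : Q → Prop) (o : S) (x : Q → Q → S → Γ) : Prop where
  comm : ∀ {i j k l}, i ≠ j → k ≠ l → j ≠ k → i ≠ l → ∀ r s, Commute (x i j r) (x k l s)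
  mulr : ∀ {i j k}, reg j → i ≠ j → j ≠ k → i ≠ k → ∀ r, ⁅x i j r, x j k o⁆ = x i k r
  mull : ∀ {i j k}, reg j → i ≠ j → j ≠ k → i ≠ k → ∀ r, ⁅x i j o, x j k r⁆ = x i k r

section km
variable {Q S Γ : Type} [Group Γ] {reg : Q → Prop} {o : S} {x : Q → Q → S → Γ}

noncomputable def fr (hf : Fresh reg) (i j : Q) : Q := (hf i j i j i).choose

theorem fr_spec (hf : Fresh reg) (i j : Q) : reg (fr hf i j) ∧ i ≠ fr hf i j ∧ fr hf i j ≠ j :=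
  have h := (hf i j i j i).choose_spec; ⟨h.1, h.2.1.symm, h.2.2.1⟩

/-- Elements attached to words in the names. -/
noncomputable def XW (hf : Fresh reg) (o : S) (x : Q → Q → S → Γ) : List S → Q → Q → Γ
  | [], i, j => x i j o
  | s :: w, i, j => ⁅x i (fr hf i j) s, XW hf o x w (fr hf i j) j⁆

variable (hf : Fresh reg) (h : KM reg o x)
include h

theorem KM.step (w : List S) :
    (∀ i j k l, i ≠ j → k ≠ l → j ≠ k → i ≠ l → ∀ s, Commute (x i j s) (XW hf o x w k l)) ∧
    (∀ i j k l, i ≠ j → k ≠ l → j ≠ k → i ≠ l → Commute (XW hf o x w i j) (XW hf o x w k l)) ∧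
    (∀ i j k, reg j → i ≠ j → j ≠ k → i ≠ k → ⁅x i j o, XW hf o x w j k⁆ = XW hf o x w i k) ∧
    (∀ i j k, reg j → i ≠ j → j ≠ k → i ≠ k → ∀ s,
      ⁅x i j s, XW hf o x w j k⁆ = XW hf o x (s :: w) i k) := by
  induction w with
  | nil =>
    refine ⟨fun i j k l h1 h2 h3 h4 s => h.comm h1 h2 h3 h4 _ _,
      fun i j k l h1 h2 h3 h4 => h.comm h1 h2 h3 h4 _ _,
      fun i j k h0 h1 h2 h3 => h.mull h0 h1 h2 h3 _, fun i j k h0 h1 h2 h3 s => ?_⟩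
    obtain ⟨f0, f1, f2⟩ := fr_spec hf i k
    simp only [XW]
    rw [h.mulr h0 h1 h2 h3, h.mulr f0 f1 f2 h3]
  | cons t w ih =>
    obtain ⟨A, C, B, D⟩ := ih
    have A' : ∀ i j k l, i ≠ j → k ≠ l → j ≠ k → i ≠ l → ∀ s,
        Commute (x i j s) (XW hf o x (t :: w) k l) := by
      intro i j k l h1 h2 h3 h4 s
      obtain ⟨m, hm, m1, m2, m3, m4, -⟩ := hf i j k l i
      rw [← D k m l hm m3.symm m4 h2]
      exact Commute.commutator_right (h.comm h1 m3.symm h3 m1.symm _ _)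
        (A _ _ _ _ h1 m4 m2.symm h4 _)
    have AC : ∀ i j k l, i ≠ j → k ≠ l → j ≠ k → i ≠ l →
        Commute (XW hf o x (t :: w) i j) (XW hf o x w k l) := by
      intro i j k l h1 h2 h3 h4
      obtain ⟨m, hm, m1, m2, m3, m4, -⟩ := hf i j k l i
      rw [← D i m j hm m1.symm m2 h1]
      exact (Commute.commutator_right (A _ _ _ _ m1.symm h2 m3 h4 _).symm
        (C _ _ _ _ m2 h2 h3 m4).symm).symm
    have C' : ∀ i j k l, i ≠ j → k ≠ l → j ≠ k → i ≠ l →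
        Commute (XW hf o x (t :: w) i j) (XW hf o x (t :: w) k l) := by
      intro i j k l h1 h2 h3 h4
      obtain ⟨m, hm, m1, m2, m3, m4, -⟩ := hf i j k l i
      rw [← D k m l hm m3.symm m4 h2]
      exact Commute.commutator_right (A' _ _ _ _ m3.symm h1 m1 h3.symm _).symm
        (AC _ _ _ _ h1 m4 m2.symm h4)
    have B' : ∀ i j k, reg j → i ≠ j → j ≠ k → i ≠ k →
        ⁅x i j o, XW hf o x (t :: w) j k⁆ = XW hf o x (t :: w) i k := by
      intro i j k h0 h1 h2 h3
      obtain ⟨m, hm, m1, m2, m3, -, -⟩ := hf i j k i i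
      have e1 := D j m k hm m2.symm m3 h2 t
      have e2 := D i m k hm m1.symm m3 h3 t
      have e3 := h.mull h0 h1 m2.symm m1.symm t
      rw [← e2, ← e3, ← e1]
      refine (reassoc (A _ _ _ _ h1 m3 m2.symm h3 _) ?_ ?_).symm
      · rw [e1, e3]; exact A' _ _ _ _ m1.symm h2 m2 h3 _
      · rw [e1]; exact (AC _ _ _ _ h2 m3 m3.symm h2).symm
    refine ⟨A', C', B', ?_⟩
    have half : ∀ i j m k, reg j → reg m → i ≠ j → j ≠ k → i ≠ k → i ≠ m → m ≠ k → j ≠ m → ∀ s,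
        ⁅x i j s, XW hf o x (t :: w) j k⁆ = ⁅x i m s, XW hf o x (t :: w) m k⁆ := by
      intro i j m k h0 hm h1 h2 h3 m1 m3 m2 s
      have e1 := B' j m k hm m2 m3 h2
      have e3 := h.mulr h0 h1 m2 m1 s
      rw [← e3, ← e1]
      refine (reassoc (A' _ _ _ _ h1 m3 m2 h3 _) ?_ ?_).symm
      · rw [e1, e3]; exact A' _ _ _ _ m1 h2 m2.symm h3 _
      · rw [e1]; exact C' _ _ _ _ m3 h2 h2.symm m3
    intro i j k h0 h1 h2 h3 s
    obtain ⟨f0, f1, f2⟩ := fr_spec hf i k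
    change _ = ⁅x i (fr hf i k) s, XW hf o x (t :: w) (fr hf i k) k⁆
    by_cases hj : j = fr hf i k
    · rw [← hj]
    · exact half i j _ k h0 f0 h1 h2 h3 f1 f2 hj s

theorem KM.XW_cons (w : List S) {i j k} (h0 : reg j) (h1 : i ≠ j) (h2 : j ≠ k) (h3 : i ≠ k) (s : S) :
    XW hf o x (s :: w) i k = ⁅x i j s, XW hf o x w j k⁆ :=
  ((h.step hf w).2.2.2 i j k h0 h1 h2 h3 s).symm

theorem KM.XW_comm (v w : List S) : ∀ i j k l, i ≠ j → k ≠ l → j ≠ k → i ≠ l →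
    Commute (XW hf o x v i j) (XW hf o x w k l) := by
  induction v with
  | nil => intro i j k l h1 h2 h3 h4; exact (h.step hf w).1 i j k l h1 h2 h3 h4 o
  | cons s v ih =>
    intro i j k l h1 h2 h3 h4
    obtain ⟨m, hm, m1, m2, m3, m4, -⟩ := hf i j k l i
    rw [h.XW_cons hf v hm m1.symm m2 h1]
    exact (Commute.commutator_right ((h.step hf w).1 _ _ _ _ m1.symm h2 m3 h4 _).symm
      (ih _ _ _ _ m2 h2 h3 m4).symm).symm

theorem KM.XW_mul (v w : List S) : ∀ i j k, reg j → i ≠ j → j ≠ k → i ≠ k →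
    ⁅XW hf o x v i j, XW hf o x w j k⁆ = XW hf o x (v ++ w) i k := by
  induction v with
  | nil => intro i j k h0 h1 h2 h3; exact (h.step hf w).2.2.1 i j k h0 h1 h2 h3
  | cons s v ih =>
    intro i j k h0 h1 h2 h3
    obtain ⟨m, hm, m1, m2, m3, -, -⟩ := hf i j k i i
    have e1 := ih m j k h0 m2 h2 m3
    have e2 := h.XW_cons hf v hm m1.symm m2 h1 s
    rw [e2, List.cons_append, h.XW_cons hf (v ++ w) hm m1.symm m3 h3 s, ← e1]
    refine reassoc ((h.step hf w).1 _ _ _ _ m1.symm h2 m2 h3 _) ?_ ?_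
    · rw [e1, ← e2]; exact h.XW_comm hf _ _ _ _ _ _ h1 m3 m2.symm h3
    · rw [e1]; exact h.XW_comm hf _ _ _ _ _ _ h2 m3 m3.symm h2

theorem KM.XW_single (s : S) {i j} (hij : i ≠ j) : XW hf o x [s] i j = x i j s := by
  obtain ⟨f0, f1, f2⟩ := fr_spec hf i j
  exact h.mulr f0 f1 f2 hij s

end km

/-- Generalised Steinberg relations with idempotents. -/
structure GS {Q R Γ : Type} [Ring R] [Group Γ] (ε : Q → R) (x : Q → Q → R → Γ) : Prop where
  add : ∀ {i j}, i ≠ j → ∀ r s, x i j (r + s) = x i j r * x i j s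
  comm : ∀ {i j k l}, i ≠ j → k ≠ l → j ≠ k → i ≠ l → ∀ r s, Commute (x i j r) (x k l s)
  mul : ∀ {i j k}, i ≠ j → j ≠ k → i ≠ k → ∀ r s, ⁅x i j r, x j k s⁆ = x i k (r * ε j * s)

end SLP


set_option linter.unusedSectionVars false
set_option linter.unusedSimpArgs false
set_option linter.unusedVariables false

namespace SLP
open scoped commutatorElement
open Matrix

theorem exists_ab_hom {α Γ : Type} [Group Γ] (f : α → Γ) (hc : ∀ a b, Commute (f a) (f b)) :
    ∃ X : FreeAbelianGroup α → Γ, (∀ r s, X (r + s) = X r * X s) ∧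
      ∀ a, X (FreeAbelianGroup.of a) = f a := by
  letI : CommGroup (Subgroup.closure (Set.range f)) :=
    Subgroup.closureCommGroupOfComm (by rintro _ ⟨a, rfl⟩ _ ⟨b, rfl⟩; exact hc a b)
  let φ : FreeAbelianGroup α →+ Additive (Subgroup.closure (Set.range f)) :=
    FreeAbelianGroup.lift fun a => Additive.ofMul ⟨f a, Subgroup.subset_closure ⟨a, rfl⟩⟩
  refine ⟨fun r => ((φ r).toMul : Subgroup.closure (Set.range f)), fun r s => ?_, fun a => ?_⟩
  · simp only [map_add]; rfl
  · simp only [φ, FreeAbelianGroup.lift_apply_of]; rfl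

theorem ab_induction {α Γ : Type} [Group Γ] (X : FreeAbelianGroup α → Γ)
    (hadd : ∀ r s, X (r + s) = X r * X s) (H : Subgroup Γ)
    (h : ∀ a, X (FreeAbelianGroup.of a) ∈ H) (r : FreeAbelianGroup α) : X r ∈ H := by
  have h0 : X 0 = 1 := by have := hadd 0 0; simpa using this
  induction r using FreeAbelianGroup.induction_on with
  | zero => rw [h0]; exact H.one_mem
  | of a => exact h a
  | neg a ha =>
    have : X (-FreeAbelianGroup.of a) = (X (FreeAbelianGroup.of a))⁻¹ := by
      apply eq_inv_of_mul_eq_one_left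
      rw [← hadd, neg_add_cancel, h0]
    rw [this]; exact H.inv_mem ha
  | add a b ha hb => rw [hadd]; exact H.mul_mem ha hb

theorem ab_commute {α Γ : Type} [Group Γ] {X : FreeAbelianGroup α → Γ}
    (hadd : ∀ r s, X (r + s) = X r * X s) {g : Γ}
    (h : ∀ a, Commute g (X (FreeAbelianGroup.of a))) (r : FreeAbelianGroup α) : Commute g (X r) := by
  have := ab_induction X hadd (Subgroup.centralizer {g})
    (fun a => by rw [Subgroup.mem_centralizer_singleton_iff]; exact (h a).eq.symm) r
  rw [Subgroup.mem_centralizer_singleton_iff] at this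
  exact Eq.symm this

/-- Two multiplicative maps that agree on generators agree. -/
theorem ab_eq {α Γ : Type} [Group Γ] {X Y : FreeAbelianGroup α → Γ}
    (hX : ∀ r s, X (r + s) = X r * X s) (hY : ∀ r s, Y (r + s) = Y r * Y s)
    (h : ∀ a, X (FreeAbelianGroup.of a) = Y (FreeAbelianGroup.of a)) (r : FreeAbelianGroup α) :
    X r = Y r := by
  have hX0 : X 0 = 1 := by have := hX 0 0; simpa using this
  have hY0 : Y 0 = 1 := by have := hY 0 0; simpa using this
  induction r using FreeAbelianGroup.induction_on with
  | zero => rw [hX0, hY0]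
  | of a => exact h a
  | neg a ha =>
    have e1 : X (-FreeAbelianGroup.of a) = (X (FreeAbelianGroup.of a))⁻¹ := by
      apply eq_inv_of_mul_eq_one_left
      rw [← hX, neg_add_cancel, hX0]
    have e2 : Y (-FreeAbelianGroup.of a) = (Y (FreeAbelianGroup.of a))⁻¹ := by
      apply eq_inv_of_mul_eq_one_left
      rw [← hY, neg_add_cancel, hY0]
    rw [e1, e2, h a]
  | add a b ha hb => rw [hX, hY, ha, hb]

theorem comm_ext_left {α C Γ : Type} [AddCommGroup C] [Group Γ] {X : FreeAbelianGroup α → Γ} {Z : C → Γ} {c : Γ}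
    (hX : ∀ r s, X (r + s) = X r * X s) (hZ : ∀ r s, Z (r + s) = Z r * Z s)
    (hc : ∀ r s, Commute (X r) (Z s)) (m : FreeAbelianGroup α → C) (hm : ∀ r s, m (r + s) = m r + m s)
    (h : ∀ a, ⁅X (FreeAbelianGroup.of a), c⁆ = Z (m (FreeAbelianGroup.of a))) (r) : ⁅X r, c⁆ = Z (m r) := by
  have m0 : m 0 = 0 := by have := hm 0 0; simpa using this
  have X0 : X 0 = 1 := by have := hX 0 0; simpa using this
  have Z0 : Z 0 = 1 := by have := hZ 0 0; simpa using this
  have ad : ∀ r s, ⁅X s, c⁆ = Z (m s) → ⁅X (r + s), c⁆ = ⁅X s, c⁆ * ⁅X r, c⁆ := by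
    intro r s hs
    rw [hX]; exact commutator_mul_left (by rw [hs]; exact hc _ _)
  induction r using FreeAbelianGroup.induction_on with
  | zero => rw [m0, X0, Z0, commutatorElement_one_left]
  | of a => exact h a
  | neg a ha =>
    have h1 := ad (-FreeAbelianGroup.of a) _ ha
    rw [neg_add_cancel, X0, commutatorElement_one_left, ha] at h1
    have h2 : Z (m (FreeAbelianGroup.of a)) * Z (m (-FreeAbelianGroup.of a)) = 1 := by
      rw [← hZ, ← hm, add_neg_cancel, m0, Z0]
    exact mul_left_cancel (h1.symm.trans h2.symm)
  | add a b ha hb => rw [ad _ _ hb, ha, hb, ← hZ, ← hm, add_comm]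

theorem comm_ext_right {α C Γ : Type} [AddCommGroup C] [Group Γ] {X : FreeAbelianGroup α → Γ} {Z : C → Γ} {c : Γ}
    (hX : ∀ r s, X (r + s) = X r * X s) (hZ : ∀ r s, Z (r + s) = Z r * Z s)
    (hc : ∀ r s, Commute (X r) (Z s)) (m : FreeAbelianGroup α → C) (hm : ∀ r s, m (r + s) = m r + m s)
    (h : ∀ a, ⁅c, X (FreeAbelianGroup.of a)⁆ = Z (m (FreeAbelianGroup.of a))) (r) : ⁅c, X r⁆ = Z (m r) := by
  have Z0 : Z 0 = 1 := by have := hZ 0 0; simpa using this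
  have m0 : m 0 = 0 := by have := hm 0 0; simpa using this
  have Zn : ∀ t, (Z t)⁻¹ = Z (-t) := fun t => by
    apply inv_eq_of_mul_eq_one_left; rw [← hZ, neg_add_cancel, Z0]
  have mn : ∀ t, m (-t) = - m t := fun t => by
    apply eq_neg_of_add_eq_zero_left; rw [← hm, neg_add_cancel, m0]
  have := comm_ext_left (c := c) hX hZ hc (fun r => - m r) (fun r s => by rw [hm, neg_add])
    (fun a => by rw [← commutatorElement_inv, h, Zn]) r
  rw [← commutatorElement_inv, this, Zn, neg_neg]

section
variable {Q S Γ : Type} [Group Γ] {reg : Q → Prop} {o : S} {x : Q → Q → S → Γ}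

theorem KM.free (hf : Fresh reg) (h : KM reg o x) : ∃ Y : Q → Q → FreeAbelianGroup (FreeMonoid S) → Γ,
    (∀ {i j}, i ≠ j → ∀ r s, Y i j (r + s) = Y i j r * Y i j s) ∧
    (∀ {i j k l}, i ≠ j → k ≠ l → j ≠ k → i ≠ l → ∀ r s, Commute (Y i j r) (Y k l s)) ∧
    (∀ {i j k}, reg j → i ≠ j → j ≠ k → i ≠ k → ∀ r s, ⁅Y i j r, Y j k s⁆ = Y i k (r * s)) ∧
    (∀ {i j}, i ≠ j → Y i j 1 = x i j o) ∧
    (∀ {i j}, i ≠ j → ∀ s, Y i j (FreeAbelianGroup.of (FreeMonoid.of s)) = x i j s) := by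
  classical
  have ex : ∀ i j : Q, ∃ X : FreeAbelianGroup (FreeMonoid S) → Γ, i ≠ j →
      ((∀ r s, X (r + s) = X r * X s) ∧
      ∀ a, X (FreeAbelianGroup.of a) = XW hf o x (FreeMonoid.toList a) i j) := by
    intro i j
    by_cases hij : i = j
    · exact ⟨fun _ => 1, fun h => absurd hij h⟩
    · obtain ⟨X, h1, h2⟩ := exists_ab_hom (fun a => XW hf o x (FreeMonoid.toList a) i j)
        fun a b => h.XW_comm hf _ _ i j i j hij hij (Ne.symm hij) hij
      exact ⟨X, fun _ => ⟨h1, h2⟩⟩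
  choose Y hY using ex
  have cm : ∀ {i j k l}, i ≠ j → k ≠ l → j ≠ k → i ≠ l → ∀ r s, Commute (Y i j r) (Y k l s) := by
    intro i j k l h1 h2 h3 h4 r s
    refine ab_commute (hY k l h2).1 (fun b => ?_) s
    refine (ab_commute (hY i j h1).1 (fun a => ?_) r).symm
    rw [(hY i j h1).2, (hY k l h2).2]
    exact (h.XW_comm hf _ _ i j k l h1 h2 h3 h4).symm
  have A := fun {i j} (hij : i ≠ j) => (hY i j hij).1
  have B : ∀ {i j k}, reg j → i ≠ j → j ≠ k → i ≠ k → ∀ a b,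
      ⁅Y i j (FreeAbelianGroup.of a), Y j k (FreeAbelianGroup.of b)⁆ =
        Y i k (FreeAbelianGroup.of a * FreeAbelianGroup.of b) := by
    intro i j k h0 h1 h2 h3 a b
    rw [← FreeAbelianGroup.of_mul, (hY i j h1).2, (hY j k h2).2, (hY i k h3).2,
      h.XW_mul hf _ _ i j k h0 h1 h2 h3]
    rfl
  have L : ∀ {i j k}, reg j → i ≠ j → j ≠ k → i ≠ k → ∀ r b,
      ⁅Y i j r, Y j k (FreeAbelianGroup.of b)⁆ = Y i k (r * FreeAbelianGroup.of b) := by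
    intro i j k h0 h1 h2 h3 r b
    exact comm_ext_left (A h1) (A h3) (cm h1 h3 h1.symm h3) (fun r => r * FreeAbelianGroup.of b)
      (fun r s => add_mul _ _ _) (fun a => B h0 h1 h2 h3 a b) r
  refine ⟨Y, A, cm, ?_, ?_, ?_⟩
  · intro i j k h0 h1 h2 h3 r s
    exact comm_ext_right (A h2) (A h3) (cm h2 h3 h3.symm h2) (fun s => r * s)
      (fun a b => mul_add _ _ _) (fun b => L h0 h1 h2 h3 r b) s
  · intro i j h1
    rw [FreeAbelianGroup.one_def, (hY i j h1).2]; rfl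
  · intro i j h1 s
    rw [(hY i j h1).2]
    exact h.XW_single hf s h1

end

end SLP


set_option linter.unusedSectionVars false
set_option linter.unusedSimpArgs false
set_option linter.unusedVariables false

namespace SLP
open scoped commutatorElement
open Matrix

section
variable {Q S Γ : Type} [Group Γ] {reg : Q → Prop} {o : S} {x : Q → Q → S → Γ}

theorem KM.ring (hf : Fresh reg) (h : KM reg o x) (ε : Q → S) (hε : ∀ j, reg j → ε j = o)
    (hm : ∀ i j k, i ≠ j → j ≠ k → i ≠ k → ⁅x i j o, x j k o⁆ = x i k (ε j)) :
    ∃ (R : Type) (_ : Ring R) (nm : S → R) (X : Q → Q → R → Γ), nm o = 1 ∧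
      GS (fun j => nm (ε j)) X ∧ (∀ i j, i ≠ j → ∀ s, X i j (nm s) = x i j s) ∧
      (∀ r s, (∀ i j, i ≠ j → X i j r = X i j s) → r = s) := by
  classical
  obtain ⟨Y, ad, cm, ml, Y1, Ys⟩ := h.free hf
  let c : RingCon (FreeAbelianGroup (FreeMonoid S)) :=
    { r := fun r s => ∀ i j, i ≠ j → Y i j r = Y i j s
      iseqv := ⟨fun r i j _ => rfl, fun h i j hij => (h i j hij).symm,
        fun h h' i j hij => (h i j hij).trans (h' i j hij)⟩
      add' := fun {a b c d} h1 h2 i j hij => by rw [ad hij, ad hij, h1 i j hij, h2 i j hij]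
      mul' := fun {a b c d} h1 h2 i j hij => by
        obtain ⟨k, hk, k1, k2, -, -, -⟩ := hf i j i i i
        rw [← ml hk k1.symm k2 hij, ← ml hk k1.symm k2 hij, h1 i k k1.symm, h2 k j k2] }
  let mk : FreeAbelianGroup (FreeMonoid S) →+* c.Quotient := c.mk'
  have mks : Function.Surjective mk := c.mk'_surjective
  have mke : ∀ r s, mk r = mk s ↔ ∀ i j, i ≠ j → Y i j r = Y i j s := fun r s => c.eq
  let X : Q → Q → c.Quotient → Γ := fun i j q => Y i j (Function.surjInv mks q)
  have hX : ∀ i j, i ≠ j → ∀ r, X i j (mk r) = Y i j r := by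
    intro i j hij r
    exact (mke _ _).1 (Function.surjInv_eq mks (mk r)) i j hij
  let e : Q → FreeAbelianGroup (FreeMonoid S) := fun j => FreeAbelianGroup.of (FreeMonoid.of (ε j))
  have e0 : ∀ i j k, i ≠ j → j ≠ k → i ≠ k → ⁅Y i j 1, Y j k 1⁆ = Y i k (e j) := by
    intro i j k h1 h2 h3
    rw [Y1 h1, Y1 h2, Ys h3, hm i j k h1 h2 h3]
  have e1 : ∀ i j k, i ≠ j → j ≠ k → i ≠ k → ∀ r, ⁅Y i j r, Y j k 1⁆ = Y i k (r * e j) := by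
    intro i j k h1 h2 h3 r
    obtain ⟨K, hK, k1, k2, k3, -, -⟩ := hf i j k i i
    have a1 : ⁅Y i K r, Y K j 1⁆ = Y i j r := by rw [ml hK k1.symm k2 h1, mul_one]
    have a2 := e0 K j k k2 h2 k3
    rw [← a1, reassoc (cm k1.symm h2 k2 h3 _ _), a2, ml hK k1.symm k3 h3]
    · rw [a1, a2]; exact cm h1 k3 k2.symm h3 _ _
    · rw [a2]; exact cm h2 k3 k3.symm h2 _ _
  have e2 : ∀ i j k, i ≠ j → j ≠ k → i ≠ k → ∀ r s, ⁅Y i j r, Y j k s⁆ = Y i k (r * e j * s) := by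
    intro i j k h1 h2 h3 r s
    obtain ⟨K, hK, k1, k2, k3, -, -⟩ := hf i j k i i
    have a1 : ⁅Y j K 1, Y K k s⁆ = Y j k s := by rw [ml hK k2.symm k3 h2, one_mul]
    have a2 := e1 i j K h1 k2.symm k1.symm r
    rw [← a1, ← reassoc (cm h1 k3 k2.symm h3 _ _), a2, ml hK k1.symm k3 h3]
    · rw [a1, a2]; exact cm k1.symm h2 k2 h3 _ _
    · rw [a1]; exact cm k3 h2 h2.symm k3 _ _
  have hnm : ∀ i j, i ≠ j → ∀ s, X i j (mk (FreeAbelianGroup.of (FreeMonoid.of s))) = x i j s := by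
    intro i j hij s
    rw [hX i j hij, Ys hij]
  refine ⟨c.Quotient, inferInstance, fun s => mk (FreeAbelianGroup.of (FreeMonoid.of s)), X, ?_, ?_, hnm, ?_⟩
  · rw [← map_one mk, mke]
    intro i j hij
    rw [Ys hij, Y1 hij]
  · refine ⟨?_, ?_, ?_⟩
    · intro i j hij r s
      obtain ⟨r, rfl⟩ := mks r
      obtain ⟨s, rfl⟩ := mks s
      rw [← map_add, hX _ _ hij, hX _ _ hij, hX _ _ hij, ad hij]
    · intro i j k l h1 h2 h3 h4 r s
      exact cm h1 h2 h3 h4 _ _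
    · intro i j k h1 h2 h3 r s
      obtain ⟨r, rfl⟩ := mks r
      obtain ⟨s, rfl⟩ := mks s
      show _ = X i k (mk r * mk (e j) * mk s)
      rw [← map_mul, ← map_mul, hX _ _ h1, hX _ _ h2, hX _ _ h3, e2 i j k h1 h2 h3]
  · intro r s hrs
    obtain ⟨r, rfl⟩ := mks r
    obtain ⟨s, rfl⟩ := mks s
    rw [mke]
    intro i j hij
    rw [← hX i j hij, ← hX i j hij, hrs i j hij]

end

end SLP


set_option linter.unusedSectionVars false
set_option linter.unusedSimpArgs false
set_option linter.unusedVariables false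

namespace SLP
open scoped commutatorElement
open Matrix

/-- Steinberg relations between different blocks only. -/
structure PS {I B F Γ : Type} [Ring F] [Group Γ] (b : I → B) (x : I → I → F → Γ) : Prop where
  add : ∀ {i j}, b i ≠ b j → ∀ r s, x i j (r + s) = x i j r * x i j s
  comm : ∀ {i j k l}, b i ≠ b j → b k ≠ b l → j ≠ k → i ≠ l → ∀ r s, Commute (x i j r) (x k l s)
  mul : ∀ {i j k}, b i ≠ b j → b j ≠ b k → b i ≠ b k → ∀ r s, ⁅x i j r, x j k s⁆ = x i k (r * s)

theorem PS.extend {I B F Γ : Type} [Ring F] [Group Γ] {b : I → B} {x : I → I → F → Γ} (h : PS b x)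
    (hf : ∀ a c d e f : B, ∃ i, b i ≠ a ∧ b i ≠ c ∧ b i ≠ d ∧ b i ≠ e ∧ b i ≠ f) :
    ∃ y : I → I → F → Γ, Stein y ∧ ∀ i j, b i ≠ b j → y i j = x i j := by
  classical
  have nb : ∀ {i j}, b i ≠ b j → i ≠ j := fun hb hij => hb (by rw [hij])
  have Z1 : ∀ i j k l, i ≠ j → b k ≠ b i → b k ≠ b j → b l ≠ b i → b l ≠ b j → b k ≠ b l → ∀ r s t,
      ⁅x i k (r * s), x k j t⁆ = ⁅x i l r, x l j (s * t)⁆ := by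
    intro i j k l h0 h1 h2 h3 h4 h5 r s t
    have a1 := h.mul h3.symm h5.symm h1.symm r s
    have a2 := h.mul h5.symm h2 h4 s t
    rw [← a1, ← a2]
    refine reassoc (h.comm h3.symm h2 (nb h5).symm h0 _ _) ?_ ?_
    · rw [a1, a2]; exact h.comm h1.symm h4 (nb h5) h0 _ _
    · rw [a2]; exact h.comm h2 h4 (nb h4).symm (nb h2) _ _
  have Z2 : ∀ i j k l, i ≠ j → b k ≠ b i → b k ≠ b j → b l ≠ b i → b l ≠ b j → ∀ r s,
      ⁅x i k r, x k j s⁆ = ⁅x i l 1, x l j (r * s)⁆ := by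
    intro i j k l h0 h1 h2 h3 h4 r s
    obtain ⟨m, m1, m2, m3, m4, -⟩ := hf (b i) (b j) (b k) (b l) (b i)
    have e1 := Z1 i j k m h0 h1 h2 m1 m2 m3.symm 1 r s
    rw [one_mul] at e1
    have e2 := Z1 i j m l h0 m1 m2 h3 h4 m4 1 1 (r * s)
    rw [one_mul, one_mul] at e2
    exact e1.trans e2
  let fk : I → I → I := fun i j => (hf (b i) (b j) (b i) (b i) (b i)).choose
  have fk1 : ∀ i j, b (fk i j) ≠ b i := fun i j => (hf (b i) (b j) (b i) (b i) (b i)).choose_spec.1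
  have fk2 : ∀ i j, b (fk i j) ≠ b j := fun i j => (hf (b i) (b j) (b i) (b i) (b i)).choose_spec.2.1
  obtain ⟨y, hy⟩ : ∃ y : I → I → F → Γ, y = fun i j r => ⁅x i (fk i j) 1, x (fk i j) j r⁆ := ⟨_, rfl⟩
  have Y : ∀ i j k, i ≠ j → b k ≠ b i → b k ≠ b j → ∀ r s, ⁅x i k r, x k j s⁆ = y i j (r * s) := by
    intro i j k h0 h1 h2 r s
    rw [hy]; exact Z2 i j k _ h0 h1 h2 (fk1 i j) (fk2 i j) r s
  have Y1 : ∀ i j k, i ≠ j → b k ≠ b i → b k ≠ b j → ∀ r, ⁅x i k r, x k j 1⁆ = y i j r := by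
    intro i j k h0 h1 h2 r
    rw [Y i j k h0 h1 h2, mul_one]
  have yx : ∀ i j, b i ≠ b j → y i j = x i j := by
    intro i j hij
    funext r
    rw [hy]
    show ⁅x i (fk i j) 1, x (fk i j) j r⁆ = _
    rw [h.mul (fk1 i j).symm (fk2 i j) hij, one_mul]
  have c1 : ∀ i j k l, i ≠ j → b k ≠ b l → j ≠ k → i ≠ l → ∀ r s, Commute (y i j r) (x k l s) := by
    intro i j k l h0 h1 h2 h3 r s
    obtain ⟨m, m1, m2, m3, m4, -⟩ := hf (b i) (b j) (b k) (b l) (b i)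
    rw [← Y1 i j m h0 m1 m2]
    exact (Commute.commutator_right (h.comm m1.symm h1 (nb m3) h3 _ _).symm
      (h.comm m2 h1 h2 (nb m4) _ _).symm).symm
  have c2 : ∀ i j k l, i ≠ j → k ≠ l → j ≠ k → i ≠ l → ∀ r s, Commute (y i j r) (y k l s) := by
    intro i j k l h0 h1 h2 h3 r s
    obtain ⟨m, m1, m2, m3, m4, -⟩ := hf (b i) (b j) (b k) (b l) (b i)
    rw [← Y1 k l m h1 m3 m4]
    exact Commute.commutator_right (c1 _ _ _ _ h0 m3.symm h2 (nb m1).symm _ _)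
      (c1 _ _ _ _ h0 m4 (nb m2).symm h3 _ _)
  have m1 : ∀ i j k, i ≠ j → b k ≠ b i → b k ≠ b j → ∀ r s, ⁅y i j r, x j k s⁆ = x i k (r * s) := by
    intro i j k h0 h1 h2 r s
    obtain ⟨m, m1, m2, m3, -, -⟩ := hf (b i) (b j) (b k) (b i) (b i)
    have a1 := Y1 i j m h0 m1 m2 r
    have a2 := h.mul m2 h2.symm m3 1 s
    rw [one_mul] at a2
    rw [← a1, reassoc (h.comm m1.symm h2.symm (nb m2) (nb h1).symm _ _), a2, h.mul m1.symm m3 h1.symm]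
    · rw [a1, a2]; exact c1 _ _ _ _ h0 m3 (nb m2).symm (nb h1).symm _ _
    · rw [a2]; exact h.comm h2.symm m3 (nb m3).symm (nb h2).symm _ _
  refine ⟨y, ⟨?_, ?_, ?_⟩, yx⟩
  · intro i j h0 r s
    obtain ⟨m, m1, m2, -, -, -⟩ := hf (b i) (b j) (b i) (b i) (b i)
    rw [← Y1 i j m h0 m1 m2, h.add m1.symm, commutator_mul_left, Y1 i j m h0 m1 m2, Y1 i j m h0 m1 m2]
    · exact (c2 i j i j h0 h0 h0.symm h0 _ _).eq
    · rw [Y1 i j m h0 m1 m2]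
      exact (c1 _ _ _ _ h0 m1.symm h0.symm (nb m1).symm _ _).symm
  · intro i j k l h0 h1 h2 h3 r s
    first
    | exact c2 i j k l ‹_› ‹_› ‹_› ‹_› r s
    | exact (c2 i j k l ‹_› ‹_› ‹_› ‹_› r s).commutator_eq
  · intro i j k h0 h1 h2 r s
    obtain ⟨m, m1', m2, m3, -, -⟩ := hf (b i) (b j) (b k) (b i) (b i)
    have a1 := Y1 j k m h1 m2 m3 s
    have a2 := m1 i j m h0 m1' m2 r s
    rw [← a1, ← reassoc (c1 _ _ _ _ h0 m3 (nb m2).symm h2 _ _), a2, Y1 i k m h2 m1' m3]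
    · rw [a1, a2]; exact (c1 _ _ _ _ h1 m1'.symm h2.symm (nb m2).symm _ _).symm
    · rw [a1]; exact (c1 _ _ _ _ h1 m3 (nb m3).symm h1 _ _).symm

end SLP


set_option linter.unusedSectionVars false
set_option linter.unusedSimpArgs false
set_option linter.unusedVariables false

namespace SLP
open scoped commutatorElement
open Matrix

section gs
variable {Q R Γ : Type} [Ring R] [Group Γ] {ε : Q → R} {x : Q → Q → R → Γ}

theorem GS.zero (h : GS ε x) {i j} (hij : i ≠ j) : x i j 0 = 1 := by
  have := h.add hij 0 0; simpa using this

theorem GS.neg (h : GS ε x) {i j} (hij : i ≠ j) (r) : x i j (-r) = (x i j r)⁻¹ := by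
  apply eq_inv_of_mul_eq_one_left
  rw [← h.add hij, neg_add_cancel, h.zero hij]

theorem GS.comap (h : GS ε x) {R' : Type} [Ring R'] (φ : R' →+* R) {ε' : Q → R'} (he : ∀ j, φ (ε' j) = ε j) :
    GS ε' (fun i j r => x i j (φ r)) where
  add hij r s := by rw [map_add, h.add hij]
  comm h1 h2 h3 h4 r s := h.comm h1 h2 h3 h4 _ _
  mul h1 h2 h3 r s := by rw [h.mul h1 h2 h3, map_mul, map_mul, he]

end gs

section blk
variable {Q T F : Type} [Fintype Q] [DecidableEq Q] [Fintype T] [DecidableEq T] [CommRing F]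

/-- Index set of a (non-uniform) block decomposition. -/
abbrev Ind (supp : Q → T → Bool) : Type := {a : Q × T // supp a.1 a.2 = true}

def epsM (F : Type) [CommRing F] (supp : Q → T → Bool) (J : Q) : Matrix T T F :=
  Matrix.diagonal fun t => if supp J t = true then 1 else 0

def UM (F : Type) [CommRing F] (supp : Q → T → Bool) (I : Q) : Matrix (Ind supp) T F :=
  Matrix.of fun a t => if a.1.1 = I ∧ a.1.2 = t then 1 else 0

variable {supp : Q → T → Bool}

theorem UM_mul (J K : Q) : (UM F supp J)ᵀ * UM F supp K = if J = K then epsM F supp J else 0 := by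
  ext s t
  rw [Matrix.mul_apply]
  simp only [Matrix.transpose_apply, UM, Matrix.of_apply, ← ite_and, mul_ite, mul_one, mul_zero]
  by_cases hJK : J = K
  · subst hJK
    rw [if_pos rfl, epsM, Matrix.diagonal_apply]
    by_cases hs : supp J s = true
    · rw [Finset.sum_eq_single (⟨(J, s), hs⟩ : Ind supp)]
      · simp [hs]
      · rintro ⟨⟨a, a'⟩, ha⟩ - hne
        rw [if_neg]
        rintro ⟨⟨h1, h2⟩, h3, h4⟩
        simp only at h3 h4
        subst h3 h4
        exact hne rfl
      · intro h; exact absurd (Finset.mem_univ _) h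
    · rw [if_neg hs, ite_self]
      apply Finset.sum_eq_zero
      rintro ⟨⟨a, a'⟩, ha⟩ -
      rw [if_neg]
      rintro ⟨⟨h1, h2⟩, h3, h4⟩
      simp only at h3 h4
      subst h3 h4
      exact hs (by simpa using ha)
  · rw [if_neg hJK]
    apply Finset.sum_eq_zero
    rintro a -
    rw [if_neg]
    rintro ⟨⟨h1, h2⟩, h3, h4⟩
    exact hJK (h3.symm.trans h1)|>.elim

/-- Block elementary matrix minus one. -/
def BM (supp : Q → T → Bool) (I J : Q) (A : Matrix T T F) : Matrix (Ind supp) (Ind supp) F :=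
  UM F supp I * A * (UM F supp J)ᵀ

theorem BM_mul (I J K L : Q) (A B : Matrix T T F) :
    BM supp I J A * BM supp K L B = if J = K then BM supp I L (A * epsM F supp J * B) else 0 := by
  have : BM supp I J A * BM supp K L B =
      UM F supp I * A * ((UM F supp J)ᵀ * UM F supp K) * B * (UM F supp L)ᵀ := by
    simp only [BM, Matrix.mul_assoc]
  rw [this, UM_mul]
  split_ifs with h
  · simp only [BM, Matrix.mul_assoc]
  · simp

theorem BM_ne {J K : Q} (h : J ≠ K) (I L : Q) (A B : Matrix T T F) :
    BM supp I J A * BM supp K L B = 0 := by rw [BM_mul, if_neg h]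

theorem BM_eq (I J L : Q) (A B : Matrix T T F) :
    BM supp I J A * BM supp J L B = BM supp I L (A * epsM F supp J * B) := by rw [BM_mul, if_pos rfl]

theorem BM_apply (I J : Q) (A : Matrix T T F) (a b : Ind supp) :
    BM supp I J A a b = if a.1.1 = I ∧ b.1.1 = J then A a.1.2 b.1.2 else 0 := by
  rw [BM, Matrix.mul_apply]
  have : ∀ t, (UM F supp I * A) a t = if a.1.1 = I then A a.1.2 t else 0 := by
    intro t
    rw [Matrix.mul_apply]
    simp only [UM, Matrix.of_apply]
    by_cases h : a.1.1 = I <;> simp [h]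
  simp only [this]
  simp only [UM, Matrix.of_apply, Matrix.transpose_apply]
  by_cases h : a.1.1 = I <;> by_cases h' : b.1.1 = J <;> simp [h, h']

theorem BM_add (I J : Q) (A B : Matrix T T F) : BM supp I J (A + B) = BM supp I J A + BM supp I J B := by
  simp only [BM, Matrix.mul_add, Matrix.add_mul]

theorem BM_det {I J : Q} (h : I ≠ J) (A : Matrix T T F) : (1 + BM supp I J A).det = 1 := by
  rw [BM, Matrix.mul_assoc, Matrix.det_one_add_mul_comm, Matrix.mul_assoc, UM_mul, if_neg h.symm,
    Matrix.mul_zero, add_zero, Matrix.det_one]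

/-- Block elementary matrices. -/
def BX (supp : Q → T → Bool) (I J : Q) (A : Matrix T T F) : SL (Ind supp) F :=
  if h : I ≠ J then (⟨1 + BM supp I J A, BM_det h A⟩ : Matrix.SpecialLinearGroup (Ind supp) F) else 1

theorem BX_coe {I J : Q} (h : I ≠ J) (A : Matrix T T F) : (BX supp I J A).1 = 1 + BM supp I J A := by
  simp [BX, h]

theorem BX_gs : GS (epsM F supp) (BX (F := F) supp) where
  add hij r s := by
    apply Subtype.ext
    rw [Matrix.SpecialLinearGroup.coe_mul, BX_coe hij, BX_coe hij, BX_coe hij, BM_add, mul_add, add_mul, add_mul,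
      BM_ne hij.symm]
    simp; abel
  comm h1 h2 h3 h4 r s := commute_of (BX_coe h1 r) (BX_coe h2 s) (BM_ne h3 _ _ _ _) (BM_ne h4.symm _ _ _ _)
  mul h1 h2 h3 r s := by
    refine commutator_of (BX_coe h1 r) (BX_coe h2 s) ?_ (BM_ne h3.symm _ _ _ _) ?_
    · rw [BM_eq, BX_coe h3]
    · rw [BM_eq, BM_ne h2.symm]

theorem BX_left {I J : Q} (h : I ≠ J) (A : Matrix T T F) : BX supp I J (epsM F supp I * A) = BX supp I J A := by
  apply Subtype.ext
  rw [BX_coe h, BX_coe h]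
  congr 1
  ext a b
  rw [BM_apply, BM_apply, epsM, Matrix.diagonal_mul]
  split_ifs with h1 h2
  · rw [one_mul]
  · exact absurd (h1.1 ▸ a.2) h2
  · rfl

theorem BX_right {I J : Q} (h : I ≠ J) (A : Matrix T T F) : BX supp I J (A * epsM F supp J) = BX supp I J A := by
  apply Subtype.ext
  rw [BX_coe h, BX_coe h]
  congr 1
  ext a b
  rw [BM_apply, BM_apply, epsM, Matrix.mul_diagonal]
  split_ifs with h1 h2
  · rw [mul_one]
  · exact absurd (h1.2 ▸ b.2) h2
  · rfl

theorem BX_single (a b : Ind supp) (h : a.1.1 ≠ b.1.1) (r : F) :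
    BX supp a.1.1 b.1.1 (Matrix.single a.1.2 b.1.2 r) = tv a b r := by
  have hab : a ≠ b := fun e => h (by rw [e])
  apply Subtype.ext
  rw [BX_coe h, tv_coe hab]
  congr 1
  ext c d
  rw [BM_apply, Matrix.single_apply, Matrix.single_apply]
  by_cases h1 : a = c
  · by_cases h2 : b = d
    · subst h1 h2; simp
    · rw [if_neg (show ¬ (a = c ∧ b = d) from fun hh => h2 hh.2), ← ite_and, if_neg]
      rintro ⟨h3, h4⟩
      exact h2 (Subtype.ext (Prod.ext h3.2.symm h4.2))
  · rw [if_neg (show ¬ (a = c ∧ b = d) from fun hh => h1 hh.1), ← ite_and, if_neg]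
    rintro ⟨h3, h4⟩
    exact h1 (Subtype.ext (Prod.ext h3.1.symm h4.1))

end blk

section hom
variable {Q T F Γ : Type} [Fintype Q] [DecidableEq Q] [Fintype T] [DecidableEq T] [Field F] [Group Γ]
  {supp : Q → T → Bool} {X : Q → Q → Matrix T T F → Γ}

theorem mat_ext {Y Z : Matrix T T F → Γ} (hY : ∀ A B, Y (A + B) = Y A * Y B)
    (hZ : ∀ A B, Z (A + B) = Z A * Z B) (h : ∀ s t r, Y (Matrix.single s t r) = Z (Matrix.single s t r)) (A) :
    Y A = Z A := by
  have hX0 : Y 0 = 1 := by have := hY 0 0; simpa using this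
  have hY0 : Z 0 = 1 := by have := hZ 0 0; simpa using this
  induction A using Matrix.induction_on' with
  | h_zero => rw [hX0, hY0]
  | h_add p q hp hq => rw [hY, hZ, hp, hq]
  | h_std_basis i j x => exact h i j x

theorem single_eps (J : Q) (s t t' w : T) (r r' : F) : Matrix.single s t r * epsM F supp J * Matrix.single t' w r' =
    if t = t' ∧ supp J t = true then Matrix.single s w (r * r') else 0 := by
  have : Matrix.single s t r * epsM F supp J = Matrix.single s t (if supp J t = true then r else 0) := by
    ext a b
    rw [epsM, Matrix.mul_diagonal, Matrix.single_apply, Matrix.single_apply]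
    by_cases h : s = a ∧ t = b
    · obtain ⟨rfl, rfl⟩ := h; simp
    · simp [h]
  rw [this]
  by_cases h : t = t'
  · subst h
    rw [Matrix.single_mul_single_same]
    by_cases h' : supp J t = true <;> simp [h']
  · rw [Matrix.single_mul_single_of_ne (h := h), if_neg (by tauto)]

theorem block_ps (h : GS (epsM F supp) X) (hf : Fresh fun K => ∀ t, supp K t = true) :
    PS (fun a : Ind supp => a.1.1)
      (fun a b r => X a.1.1 b.1.1 (Matrix.single a.1.2 b.1.2 r)) where
  add hij r s := by rw [Matrix.single_add, h.add hij]
  mul {i j k} h1 h2 h3 r s := by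
    rw [h.mul h1 h2 h3, single_eps, if_pos ⟨rfl, j.2⟩]
  comm := by
    have P : ∀ I J K (s t t' w : T) (r r' : F), I ≠ J → J ≠ K → I ≠ K → t ≠ t' →
        Commute (X I J (Matrix.single s t r)) (X J K (Matrix.single t' w r')) := by
      intro I J K s t t' w r r' h1 h2 h3 h4
      rw [← commutatorElement_eq_one_iff_commute, h.mul h1 h2 h3, single_eps, if_neg (by tauto), h.zero h3]
    rintro ⟨⟨I, s⟩, hi⟩ ⟨⟨J, t⟩, hj⟩ ⟨⟨K, s'⟩, hk⟩ ⟨⟨L, t'⟩, hl⟩ h1 h2 h3 h4 r r'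
    simp only at h1 h2 ⊢
    by_cases hJK : J = K
    · subst hJK
      have hts : t ≠ s' := fun e => h3 (by subst e; rfl)
      by_cases hIL : I = L
      · subst hIL
        have hst : s ≠ t' := fun e => h4 (by subst e; rfl)
        obtain ⟨M, hM, m1, m2, -, -, -⟩ := hf I J I I I
        have e1 : ⁅X J M (Matrix.single s' t' r'), X M I (Matrix.single t' t' 1)⁆ =
            X J I (Matrix.single s' t' r') := by
          rw [h.mul m2.symm m1 h2, single_eps, if_pos ⟨rfl, hM _⟩, mul_one]
        rw [← e1]
        exact Commute.commutator_right (P _ _ _ _ _ _ _ _ _ h1 m2.symm m1.symm hts)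
          (P _ _ _ _ _ _ _ _ _ m1 h1 m2 hst.symm).symm
      · exact P _ _ _ _ _ _ _ _ _ h1 h2 hIL hts
    · by_cases hIL : I = L
      · subst hIL
        have hst : s ≠ t' := fun e => h4 (by subst e; rfl)
        exact (P _ _ _ _ _ _ _ _ _ h2 h1 (Ne.symm hJK) hst.symm).symm
      · exact h.comm h1 h2 hJK hIL _ _

theorem block_hom (h : GS (epsM F supp) X) (hf : Fresh fun K => ∀ t, supp K t = true)
    (hl : ∀ I J, I ≠ J → ∀ A, X I J (epsM F supp I * A) = X I J A)
    (hr : ∀ I J, I ≠ J → ∀ A, X I J (A * epsM F supp J) = X I J A)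
    (a0 b0 : Ind supp) (h01 : a0.1.1 ≠ b0.1.1) (ψ2 : SL (Fin 2) F →* Γ)
    (h0 : ∀ r, ψ2 (tv 0 1 r) = X a0.1.1 b0.1.1 (Matrix.single a0.1.2 b0.1.2 r))
    (h1 : ∀ r, ψ2 (tv 1 0 r) = X b0.1.1 a0.1.1 (Matrix.single b0.1.2 a0.1.2 r)) :
    ∃ ψ : SL (Ind supp) F →* Γ, ∀ I J, I ≠ J → ∀ A, ψ (BX supp I J A) = X I J A := by
  obtain ⟨y, hy, hyx⟩ := (block_ps h hf).extend (fun a c d e f => by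
    obtain ⟨K, hK, k1, k2, k3, k4, k5⟩ := hf a c d e f
    exact ⟨⟨(K, a0.1.2), hK _⟩, k1, k2, k3, k4, k5⟩)
  obtain ⟨ψ, hψ⟩ := steinberg_hom' hy a0 b0 (fun e => h01 (by rw [e])) ψ2
    (fun r => by rw [h0, hyx _ _ h01]) (fun r => by rw [h1, hyx _ _ h01.symm])
  refine ⟨ψ, fun I J hIJ A => mat_ext (Y := fun A => ψ (BX supp I J A)) ?_ (h.add hIJ) ?_ A⟩
  · intro A B
    simp only [BX_gs.add hIJ, map_mul]
  · intro s t r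
    show ψ (BX supp I J (Matrix.single s t r)) = X I J (Matrix.single s t r)
    by_cases hs : supp I s = true
    · by_cases ht : supp J t = true
      · have e1 := BX_single (supp := supp) ⟨(I, s), hs⟩ ⟨(J, t), ht⟩ hIJ r
        have e2 := hyx ⟨(I, s), hs⟩ ⟨(J, t), ht⟩ hIJ
        simp only at e1
        rw [e1, hψ _ _ (fun e => hIJ (congrArg (fun a => a.1.1) e)), e2]
      · have e : Matrix.single s t r * epsM F supp J = 0 := by
          ext a b
          rw [epsM, Matrix.mul_diagonal, Matrix.single_apply]
          by_cases hh : s = a ∧ t = b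
          · obtain ⟨rfl, rfl⟩ := hh; simp [ht]
          · simp [hh]
        rw [← BX_right hIJ, ← hr I J hIJ, e, BX_gs.zero hIJ, h.zero hIJ, map_one]
    · have e : epsM F supp I * Matrix.single s t r = 0 := by
        ext a b
        rw [epsM, Matrix.diagonal_mul, Matrix.single_apply]
        by_cases hh : s = a ∧ t = b
        · obtain ⟨rfl, rfl⟩ := hh; simp [hs]
        · simp [hh]
      rw [← BX_left hIJ, ← hl I J hIJ, e, BX_gs.zero hIJ, h.zero hIJ, map_one]

end hom

end SLP


set_option linter.unusedSectionVars false
set_option linter.unusedSimpArgs false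
set_option linter.unusedVariables false

namespace SLP
open scoped commutatorElement
open Matrix

section mu
variable {p : ℕ} [Fact p.Prime] {F R : Type} [Field F] [Ring R]

/-- Powers of `u` indexed by residues. -/
def us (u : R) (t : ZMod p) : R := u ^ t.val

theorem us_nat {u : R} (hu : u ^ p = 1) (k : ℕ) : us u (k : ZMod p) = u ^ k := by
  rw [us, ZMod.val_natCast, ← pow_eq_pow_mod k hu]

theorem us_add {u : R} (hu : u ^ p = 1) (s t : ZMod p) : us u (s + t) = us u s * us u t := by
  rw [us, ZMod.val_add, ← pow_eq_pow_mod _ hu, pow_add]; rfl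

theorem us_zero (u : R) : us u (0 : ZMod p) = 1 := by rw [us, ZMod.val_zero, pow_zero]

theorem us_neg {u : R} (hu : u ^ p = 1) (t : ZMod p) : us u (-t) * us u t = 1 := by
  rw [← us_add hu, neg_add_cancel, us_zero]

theorem us_neg' {u : R} (hu : u ^ p = 1) (t : ZMod p) : us u t * us u (-t) = 1 := by
  rw [← us_add hu, add_neg_cancel, us_zero]

/-- Matrix with one entry in each column. -/
def mono {T : Type} [DecidableEq T] (σ : T → T) (c : T → F) : Matrix T T F :=
  Matrix.of fun s t => if s = σ t then c t else 0

theorem mono_apply {T : Type} [DecidableEq T] (σ : T → T) (c : T → F) (s t : T) :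
    mono σ c s t = if s = σ t then c t else 0 := rfl

theorem mono_mul {T : Type} [DecidableEq T] [Fintype T] (σ σ' : T → T) (c c' : T → F) :
    mono σ c * mono σ' c' = mono (fun t => σ (σ' t)) (fun t => c (σ' t) * c' t) := by
  ext s t
  rw [Matrix.mul_apply]
  simp only [mono_apply, mul_ite, mul_zero]
  rw [Finset.sum_ite_eq']
  simp

theorem mono_one {T : Type} [DecidableEq T] : mono (fun t : T => t) (fun _ => (1 : F)) = 1 := by
  ext s t
  rw [mono_apply, Matrix.one_apply]

variable (f : F →+* R) (u e : R)

noncomputable def phi (A : Matrix (ZMod p) (ZMod p) F) : R :=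
  ∑ s, ∑ t, f (A s t) * (us u s * e * us u (-t))

theorem phi_add (A B : Matrix (ZMod p) (ZMod p) F) : phi f u e (A + B) = phi f u e A + phi f u e B := by
  simp only [phi, Matrix.add_apply, map_add, add_mul, Finset.sum_add_distrib]

theorem phi_zero : phi f u e (0 : Matrix (ZMod p) (ZMod p) F) = 0 := by simp [phi]

theorem phi_single (s t : ZMod p) (a : F) :
    phi f u e (Matrix.single s t a) = f a * (us u s * e * us u (-t)) := by
  rw [phi, Finset.sum_eq_single s, Finset.sum_eq_single t]
  · simp
  · intro b _ hb; simp [Matrix.single_apply, hb.symm]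
  · simp
  · intro b _ hb
    apply Finset.sum_eq_zero
    intro c _
    simp [Matrix.single_apply, hb.symm]
  · simp

theorem phi_mono (σ : ZMod p → ZMod p) (c : ZMod p → F) :
    phi f u e (mono σ c) = ∑ t, f (c t) * (us u (σ t) * e * us u (-t)) := by
  rw [phi, Finset.sum_comm]
  apply Finset.sum_congr rfl
  intro t _
  rw [Finset.sum_eq_single (σ t)]
  · simp [mono_apply]
  · intro b _ hb; simp [mono_apply, hb]
  · simp

variable {f u e}

theorem exists_phi (hu : u ^ p = 1) (he : ∀ t : ZMod p, e * us u t * e = if t = 0 then e else 0)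
    (cfu : ∀ a, Commute (f a) u) (cfe : ∀ a, Commute (f a) e)
    (hs : ∑ t : ZMod p, us u t * e * us u (-t) = 1) :
    ∃ φ : Matrix (ZMod p) (ZMod p) F →+* R, (∀ (σ : ZMod p → ZMod p) c a,
      (∀ t, a * (us u t * e) = f (c t) * (us u (σ t) * e)) → φ (mono σ c) = a) := by
  have cfs : ∀ a (t : ZMod p), Commute (f a) (us u t) := fun a t => (cfu a).pow_right _
  have hE : ∀ s t s' t' : ZMod p, (us u s * e * us u (-t)) * (us u s' * e * us u (-t')) =
      if t = s' then us u s * e * us u (-t') else 0 := by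
    intro s t s' t'
    have : (us u s * e * us u (-t)) * (us u s' * e * us u (-t')) =
        us u s * (e * (us u (-t) * us u s') * e) * us u (-t') := by noncomm_ring
    rw [this, ← us_add hu, he]
    by_cases h : t = s'
    · rw [if_pos h, if_pos (by rw [h, neg_add_cancel])]
    · rw [if_neg h, if_neg (by intro h'; exact h (by linear_combination -h')), mul_zero, zero_mul]
  have pin : ∀ (σ : ZMod p → ZMod p) c a,
      (∀ t, a * (us u t * e) = f (c t) * (us u (σ t) * e)) → phi f u e (mono σ c) = a := by
    intro σ c a h
    rw [phi_mono]
    calc _ = ∑ t : ZMod p, a * (us u t * e * us u (-t)) := by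
          apply Finset.sum_congr rfl
          intro t _
          rw [← mul_assoc (f (c t)), ← h]; noncomm_ring
      _ = a := by rw [← Finset.mul_sum, hs, mul_one]
  have cfE : ∀ a (s t : ZMod p), Commute (f a) (us u s * e * us u (-t)) := fun a s t =>
    ((cfs _ _).mul_right (cfe _)).mul_right (cfs _ _)
  refine ⟨⟨⟨⟨phi f u e, ?_⟩, ?_⟩, phi_zero f u e, phi_add f u e⟩, pin⟩
  · rw [← mono_one]
    exact pin _ _ _ fun t => by rw [map_one]
  · intro A B
    show phi f u e (A * B) = phi f u e A * phi f u e B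
    induction A using Matrix.induction_on' with
    | h_zero => rw [zero_mul, phi_zero, zero_mul]
    | h_add A A' h h' => rw [add_mul, phi_add, phi_add, add_mul, h, h']
    | h_std_basis s t a =>
      induction B using Matrix.induction_on' with
      | h_zero => rw [mul_zero, phi_zero, mul_zero]
      | h_add A A' h h' => rw [mul_add, phi_add, phi_add, mul_add, h, h']
      | h_std_basis s' t' b =>
        rw [phi_single, phi_single, mul_assoc, ← mul_assoc _ (f b), ← (cfE b _ _).eq, mul_assoc (f b), hE]
        by_cases h : t = s'
        · subst h
          rw [Matrix.single_mul_single_same, phi_single, if_pos rfl, map_mul, mul_assoc]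
        · rw [Matrix.single_mul_single_of_ne (h := h), phi_zero, if_neg h]; simp

/-- Completeness of the matrix units. -/
theorem units_complete (hp : (p : F) ≠ 0) (hu : u ^ p = 1)
    (he : ∀ t : ZMod p, e * us u t * e = if t = 0 then e else 0)
    (d : R) (hd : u * d + u = d * u + f (p : F) * e * u) (cfe : ∀ a, Commute (f a) e) :
    ∑ t : ZMod p, us u t * e * us u (-t) = 1 := by
  obtain ⟨q, hq⟩ : ∃ q, q = ∑ t : ZMod p, us u t * e * us u (-t) := ⟨_, rfl⟩
  have qe : q * e = e := by
    rw [hq, Finset.sum_mul, Finset.sum_eq_single 0]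
    · have := he 0
      rw [if_pos rfl] at this
      simpa [us_zero] using this
    · intro t _ ht
      rw [mul_assoc, mul_assoc, ← mul_assoc e, he, if_neg (by simpa using ht), mul_zero]
    · simp
  have eq : e * q = e := by
    rw [hq, Finset.mul_sum, Finset.sum_eq_single 0]
    · have := he 0
      rw [if_pos rfl] at this
      simpa [us_zero] using this
    · intro t _ ht
      rw [← mul_assoc, ← mul_assoc, he, if_neg ht, zero_mul]
    · simp
  have u1 : us u (1 : ZMod p) = u := by
    have := us_nat hu 1
    simpa using this
  have uq : u * q = q * u := by
    rw [hq, Finset.mul_sum, Finset.sum_mul]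
    refine Fintype.sum_equiv (Equiv.addRight 1) _ _ fun t => ?_
    have h1 : us u (Equiv.addRight 1 t) = u * us u t := by
      rw [show Equiv.addRight 1 t = 1 + t from add_comm _ _, us_add hu, u1]
    have h2 : us u (-t) = us u (-(Equiv.addRight 1 t)) * u := by
      have h3 : us u (-(Equiv.addRight 1 t)) * us u (1 : ZMod p) = us u (-t) := by
        rw [← us_add hu, show Equiv.addRight 1 t = t + 1 from rfl]; congr 1; ring
      rw [u1] at h3; exact h3.symm
    rw [h1, h2]; noncomm_ring
  obtain ⟨w, hw⟩ : ∃ w, w = 1 - q := ⟨_, rfl⟩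
  have wq : w * q = 0 := by
    have : q * q = q := by
      have : (∑ t : ZMod p, us u t * e * us u (-t)) * q = ∑ t : ZMod p, us u t * e * us u (-t) := by
       rw [Finset.sum_mul]
       apply Finset.sum_congr rfl
       intro t _
       have : ∀ k : ℕ, u ^ k * q = q * u ^ k := fun k => ((show Commute u q from uq).pow_left k).eq
       rw [mul_assoc, us, us, this, ← mul_assoc, mul_assoc _ e q, eq]
      rwa [← hq] at this
    rw [hw, sub_mul, one_mul, this, sub_self]
  have we : w * e = 0 := by rw [hw, sub_mul, one_mul, qe, sub_self]
  have ew : e * w = 0 := by rw [hw, mul_sub, mul_one, eq, sub_self]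
  have uw : u * w = w * u := by rw [hw, mul_sub, sub_mul, uq]; simp
  have wf : w * f (p : F) * e = 0 := by rw [mul_assoc, (cfe _).eq, ← mul_assoc, we, zero_mul]
  have step : w * (u * d) * w + u * (w * w) = w * (d * u) * w := by
    have h1 : w * (u * d + u) * w = w * (d * u + f (p : F) * e * u) * w := by rw [hd]
    have h2 : w * (f (p : F) * e * u) * w = 0 := by
      have : w * (f (p : F) * e * u) * w = w * f (p : F) * e * u * w := by noncomm_ring
      rw [this, wf]; simp
    have h3 : w * u * w = u * (w * w) := by rw [← uw, mul_assoc]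
    rw [mul_add, mul_add, add_mul, add_mul, h2, add_zero, h3] at h1
    exact h1
  obtain ⟨D, hD⟩ : ∃ D, D = w * d * w := ⟨_, rfl⟩
  have step' : u * D + u * (w * w) = D * u := by
    have e1 : u * D = w * (u * d) * w := by
      rw [hD, ← mul_assoc, ← mul_assoc, uw]; noncomm_ring
    have e2 : D * u = w * (d * u) * w := by
      rw [hD, mul_assoc, ← uw]; noncomm_ring
    rw [e1, e2, step]
  have it : ∀ k : ℕ, u ^ k * D + k * (u ^ k * (w * w)) = D * u ^ k := by
    intro k
    induction k with
    | zero => simp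
    | succ k ih =>
      have cu : w * w * u = u * (w * w) := by rw [mul_assoc, ← uw, ← mul_assoc, ← uw, mul_assoc]
      calc u ^ (k + 1) * D + ((k + 1 : ℕ) : R) * (u ^ (k + 1) * (w * w))
          = u ^ k * (u * D + u * (w * w)) + (k : R) * (u ^ k * (u * (w * w))) := by
            rw [pow_succ, Nat.cast_add, Nat.cast_one]; noncomm_ring
        _ = (u ^ k * D + k * (u ^ k * (w * w))) * u := by
            rw [step', ← cu]; noncomm_ring
        _ = D * u ^ (k + 1) := by rw [ih, pow_succ, mul_assoc]
  have hpw := it p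
  rw [hu, one_mul, one_mul, mul_one, add_eq_left] at hpw
  have hww : w * w = 0 := by
    have : f ((p : F)⁻¹ * p) = 1 := by rw [inv_mul_cancel₀ hp, map_one]
    rw [map_mul, map_natCast] at this
    rw [← one_mul (w * w), ← this, mul_assoc, hpw, mul_zero]
  have hw0 : w = 0 := by
    have : w * w = w := by
      have : w * (1 - q) = w := by rw [mul_sub, mul_one, wq, sub_zero]
      rwa [← hw] at this
    rw [← this, hww]
  rw [← hq]
  rw [hw] at hw0
  exact (sub_eq_zero.1 hw0).symm

end mu

end SLP


set_option linter.unusedSectionVars false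
set_option linter.unusedSimpArgs false
set_option linter.unusedVariables false

namespace SLP
open scoped commutatorElement
open Matrix

/-- The names. -/
inductive Nm : Type
  | o | th | thi | ta | tai | P | zb | c | ze | zei | ep | u | ui | h | hi | ka | e | d | uk | uki | y | yi
  deriving DecidableEq

open Nm in
instance : Fintype Nm :=
  Fintype.ofList [o, th, thi, ta, tai, P, zb, c, ze, zei, ep, u, ui, h, hi, ka, e, d, uk, uki, y, yi]
    (by intro x; cases x <;> decide)

/-- Ring expressions in the names. -/
inductive RE : Type
  | nm (s : Nm)
  | zero
  | add (a b : RE)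
  | mul (a b : RE)

namespace RE

instance : Zero RE := ⟨RE.zero⟩
instance : Add RE := ⟨RE.add⟩
instance : Mul RE := ⟨RE.mul⟩

def ev {R : Type} [Ring R] (v : Nm → R) : RE → R
  | nm s => v s
  | zero => 0
  | add a b => ev v a + ev v b
  | mul a b => ev v a * ev v b

def size : RE → ℕ
  | nm _ => 1
  | zero => 1
  | add a b => size a + size b
  | mul a b => size a + size b + size a + size b

theorem ev_nm {R : Type} [Ring R] (v : Nm → R) (s) : ev v (nm s) = v s := rfl
theorem ev_zero {R : Type} [Ring R] (v : Nm → R) : ev v 0 = 0 := rfl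
theorem ev_add {R : Type} [Ring R] (v : Nm → R) (a b) : ev v (a + b) = ev v a + ev v b := rfl
theorem ev_mul {R : Type} [Ring R] (v : Nm → R) (a b) : ev v (a * b) = ev v a * ev v b := rfl

end RE

/-- Parameters. -/
structure Par (F : Type) where
  p : ℕ
  k : ℕ
  g0 : ℕ
  m : ℕ
  tn : ℕ
  g : F
  z : F

structure Par.OK {F : Type} [Field F] (P : Par F) : Prop where
  hp : (P.p : F) ≠ 0
  p2 : P.p ≠ 2
  hk : P.k < P.p
  hg0 : ∀ t : ZMod P.p, t ≠ 0 → ∃ j : ℕ, t = (P.g0 : ZMod P.p) ^ j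
  hg00 : (P.g0 : ZMod P.p) ≠ 0
  tn : P.tn = 1 ∨ P.tn = 4
  tn0 : (P.tn : F) ≠ 0
  hg : ∀ t : F, t ≠ 0 → ∃ j : ℕ, t = P.g ^ j
  g00 : P.g ≠ 0
  z0 : P.z ≠ 0
  hz : P.z ^ (P.m * P.p + P.k) = 1

section val
variable {F : Type} [Field F] (P : Par F)

def Par.W (j : ℕ) : F := P.z ^ P.m + (P.z ^ (P.m + 1) - P.z ^ P.m) * (if j < P.k then 1 else 0)

def Par.Yn : ℕ → F
  | 0 => 1
  | j + 1 => P.W (j + 1) * Par.Yn j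

open Nm in
def Par.mp [Fact P.p.Prime] : Nm → (ZMod P.p → ZMod P.p) × (ZMod P.p → F)
  | o => (fun t => t, fun _ => 1)
  | th => (fun t => t, fun _ => P.g)
  | thi => (fun t => t, fun _ => P.g⁻¹)
  | ta => (fun t => t, fun _ => P.tn)
  | tai => (fun t => t, fun _ => (P.tn : F)⁻¹)
  | Nm.P => (fun t => t, fun _ => P.p)
  | zb => (fun t => t, fun _ => P.z ^ P.m)
  | c => (fun t => t, fun _ => P.z ^ (P.m + 1) - P.z ^ P.m)
  | ze => (fun t => t, fun _ => P.z)
  | zei => (fun t => t, fun _ => P.z⁻¹)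
  | ep => (fun t => t, fun t => if t.val < P.k then 1 else 0)
  | u => (fun t => t + 1, fun _ => 1)
  | ui => (fun t => t - 1, fun _ => 1)
  | h => (fun t => 2 * t, fun _ => 1)
  | hi => (fun t => 2⁻¹ * t, fun _ => 1)
  | ka => (fun t => P.g0 * t, fun _ => 1)
  | e => (fun t => t, fun t => if t = 0 then 1 else 0)
  | d => (fun t => t, fun t => (t.val : F))
  | uk => (fun t => t + P.k, fun _ => 1)
  | uki => (fun t => t - P.k, fun _ => 1)
  | y => (fun t => t, fun t => P.Yn t.val)
  | yi => (fun t => t, fun t => (P.Yn t.val)⁻¹)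

def Par.val [Fact P.p.Prime] (s : Nm) : Matrix (ZMod P.p) (ZMod P.p) F := mono (P.mp s).1 (P.mp s).2

open Nm RE in
def Par.rels : List (RE × RE) :=
  [(nm u * nm ui, nm o), (nm ui * nm u, nm o), (nm h * nm hi, nm o), (nm hi * nm h, nm o),
   (nm uk * nm uki, nm o), (nm uki * nm uk, nm o), (nm y * nm yi, nm o), (nm yi * nm y, nm o),
   (nm th * nm thi, nm o), (nm thi * nm th, nm o), (nm ta * nm tai, nm o), (nm tai * nm ta, nm o),
   (nm ze * nm zei, nm o), (nm zei * nm ze, nm o),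
   (nm h * nm u, nm u * nm u * nm h), (nm h * nm e, nm e), (nm ka * nm e, nm e), (nm e * nm ka, nm e),
   (nm e * nm u * nm e, 0), (nm e * nm e, nm e), (nm th * nm u, nm u * nm th), (nm th * nm e, nm e * nm th),
   (nm d * nm e, 0), (nm u * nm d + nm u, nm d * nm u + nm Nm.P * nm e * nm u),
   (nm ep * nm e, if 0 < P.k then nm e else 0),
   (nm u * nm ep + nm e * nm u, nm ep * nm u + nm uk * nm e * nm uki * nm u),
   (nm y * nm e, nm e), (nm y * nm u, (nm zb + nm c * nm ep) * nm u * nm y),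
   (nm ta, if P.tn = 1 then nm o else nm o + nm o + nm o + nm o)]

theorem Par.rels_size : ∀ r ∈ P.rels, r.1.size ≤ 100 ∧ r.2.size ≤ 100 := by
  intro r hr
  simp only [Par.rels] at hr
  by_cases h1 : 0 < P.k <;> by_cases h2 : P.tn = 1 <;>
  · simp only [h1, h2, if_true, if_false] at hr
    fin_cases hr <;> decide

theorem Par.W_eq (j : ℕ) : P.W j = P.z ^ (P.m + if j < P.k then 1 else 0) := by
  rw [Par.W]; split_ifs <;> simp

theorem Par.Yn_eq (j : ℕ) : P.Yn j = ∏ i ∈ Finset.range j, P.W (i + 1) := by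
  induction j with
  | zero => rfl
  | succ j ih => rw [Finset.prod_range_succ, ← ih, Par.Yn, mul_comm]

theorem Par.Yn_ne (hP : P.OK) (j : ℕ) : P.Yn j ≠ 0 := by
  rw [Par.Yn_eq, Finset.prod_ne_zero_iff]
  intro i _
  rw [Par.W_eq]
  exact pow_ne_zero _ hP.z0

theorem Par.prodW (hP : P.OK) : ∏ i ∈ Finset.range P.p, P.W i = 1 := by
  simp only [Par.W_eq]
  rw [Finset.prod_pow_eq_pow_sum, Finset.sum_add_distrib, Finset.sum_const, Finset.card_range,
    ← Finset.card_filter]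
  have : (Finset.filter (fun i => i < P.k) (Finset.range P.p)) = Finset.range P.k := by
    ext i; simp; have := hP.hk; omega
  rw [this, Finset.card_range, smul_eq_mul, mul_comm, hP.hz]

end val

end SLP


set_option linter.unusedSectionVars false
set_option linter.unusedSimpArgs false
set_option linter.unusedVariables false

namespace SLP
open scoped commutatorElement
open Matrix

section val
variable {F : Type} [Field F] (P : Par F) [Fact P.p.Prime]

theorem mono_congr {T : Type} [DecidableEq T] {σ σ' : T → T} {c c' : T → F}
    (h1 : ∀ t, σ t = σ' t) (h2 : ∀ t, c t = c' t) : mono σ c = mono σ' c' := by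
  rw [funext h1, funext h2]

theorem mono_congr' {T : Type} [DecidableEq T] {σ σ' : T → T} {c c' : T → F}
    (h2 : ∀ t, c t = c' t) (h1 : ∀ t, c t ≠ 0 → σ t = σ' t) : mono σ c = mono σ' c' := by
  ext s t
  rw [mono_apply, mono_apply, ← h2]
  by_cases h : c t = 0
  · simp [h]
  · rw [h1 t h]

theorem mono_zero {T : Type} [DecidableEq T] {σ : T → T} {c : T → F} (h : ∀ t, c t = 0) : mono σ c = 0 := by
  ext s t
  simp [mono_apply, h]

theorem mono_add {T : Type} [DecidableEq T] (σ : T → T) (c c' : T → F) :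
    mono σ c + mono σ c' = mono σ (fun t => c t + c' t) := by
  ext s t
  simp only [Matrix.add_apply, mono_apply]
  split_ifs <;> simp

theorem val_succ {p : ℕ} [Fact p.Prime] (t : ZMod p) :
    (t.val + 1 < p ∧ (t + 1).val = t.val + 1 ∧ t + 1 ≠ 0) ∨ (t.val + 1 = p ∧ t + 1 = 0) := by
  have h1 := ZMod.val_lt t
  have hp : 1 < p := (Fact.out : p.Prime).one_lt
  have : Fact (1 < p) := ⟨hp⟩
  have e : ((t.val + 1 : ℕ) : ZMod p) = t + 1 := by push_cast; rw [ZMod.natCast_zmod_val]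
  by_cases h : t.val + 1 < p
  · left
    have : (t + 1).val = t.val + 1 := by rw [← e, ZMod.val_natCast, Nat.mod_eq_of_lt h]
    refine ⟨h, this, fun h0 => ?_⟩
    rw [h0, ZMod.val_zero] at this
    omega
  · right
    have : t.val + 1 = p := by omega
    refine ⟨this, ?_⟩
    rw [← e, this, ZMod.natCast_self]

theorem Par.val_rels (hP : P.OK) : ∀ r ∈ P.rels, r.1.ev P.val = r.2.ev P.val := by
  have two : (2 : ZMod P.p) ≠ 0 := by
    have := hP.p2
    intro h
    have h2 : ((2 : ℕ) : ZMod P.p) = 0 := by exact_mod_cast h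
    rw [ZMod.natCast_eq_zero_iff] at h2
    exact this ((Nat.prime_dvd_prime_iff_eq Fact.out Nat.prime_two).1 h2)
  have hk := hP.hk
  have kv : ((P.k : ℕ) : ZMod P.p).val = P.k := by rw [ZMod.val_natCast, Nat.mod_eq_of_lt hk]
  simp only [Par.rels, List.forall_mem_cons, RE.ev_add, RE.ev_mul, RE.ev_nm, RE.ev_zero, apply_ite (RE.ev P.val)]
  simp only [Par.val, Par.mp, mono_mul]
  have pl : 1 < P.p := (Fact.out : P.p.Prime).one_lt
  have : Fact (1 < P.p) := ⟨pl⟩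
  refine ⟨?_, ?_, ?_, ?_, ?_, ?_, ?_, ?_, ?_, ?_, ?_, ?_, ?_, ?_, ?_, ?_, ?_, ?_, ?_, ?_, ?_, ?_, ?_, ?_, ?_, ?_,
    ?_, ?_, ?_, by simp⟩
  · exact mono_congr (fun t => by ring) (fun t => by ring)
  · exact mono_congr (fun t => by ring) (fun t => by ring)
  · exact mono_congr (fun t => by rw [← mul_assoc, mul_inv_cancel₀ two, one_mul]) (fun t => by ring)
  · exact mono_congr (fun t => by rw [← mul_assoc, inv_mul_cancel₀ two, one_mul]) (fun t => by ring)
  · exact mono_congr (fun t => by ring) (fun t => by ring)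
  · exact mono_congr (fun t => by ring) (fun t => by ring)
  · exact mono_congr (fun t => rfl) (fun t => mul_inv_cancel₀ (P.Yn_ne hP _))
  · exact mono_congr (fun t => rfl) (fun t => inv_mul_cancel₀ (P.Yn_ne hP _))
  · exact mono_congr (fun t => rfl) (fun t => mul_inv_cancel₀ hP.g00)
  · exact mono_congr (fun t => rfl) (fun t => inv_mul_cancel₀ hP.g00)
  · exact mono_congr (fun t => rfl) (fun t => mul_inv_cancel₀ hP.tn0)
  · exact mono_congr (fun t => rfl) (fun t => inv_mul_cancel₀ hP.tn0)
  · exact mono_congr (fun t => rfl) (fun t => mul_inv_cancel₀ hP.z0)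
  · exact mono_congr (fun t => rfl) (fun t => inv_mul_cancel₀ hP.z0)
  · exact mono_congr (fun t => by ring) (fun t => by ring)
  · refine mono_congr' (fun t => by ring) (fun t ht => ?_)
    have : t = 0 := by by_contra h; simp [h] at ht
    rw [this, mul_zero]
  · refine mono_congr' (fun t => by ring) (fun t ht => ?_)
    have : t = 0 := by by_contra h; simp [h] at ht
    rw [this, mul_zero]
  · refine mono_congr' (fun t => by simp [hP.hg00]) (fun t ht => ?_)
    have : t = 0 := by by_contra h; simp [h, hP.hg00] at ht
    rw [this, mul_zero]
  · refine mono_zero fun t => ?_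
    by_cases h : t = 0
    · simp [h]
    · simp [h]
  · refine mono_congr (fun t => rfl) (fun t => by simp)
  · refine mono_congr (fun t => rfl) (fun t => by simp)
  · refine mono_congr (fun t => rfl) (fun t => by simp)
  · refine mono_zero fun t => ?_
    by_cases h : t = 0
    · simp [h, ZMod.val_zero]
    · simp [h]
  · rw [mono_add, mono_add]
    refine mono_congr (fun t => rfl) (fun t => ?_)
    rcases val_succ t with ⟨h1, h2, h3⟩ | ⟨h1, h2⟩
    · rw [h2, if_neg h3]; push_cast; ring
    · rw [h2, if_pos rfl, ZMod.val_zero]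
      have : ((t.val : F) + 1) = P.p := by exact_mod_cast congrArg (Nat.cast (R := F)) h1
      simp only [one_mul, mul_one, Nat.cast_zero, zero_mul, zero_add]
      exact this
  · by_cases h : 0 < P.k
    · rw [if_pos h]
      refine mono_congr (fun t => rfl) (fun t => ?_)
      by_cases h' : t = 0
      · simp [h', ZMod.val_zero, h]
      · simp [h']
    · rw [if_neg h]
      refine mono_zero fun t => ?_
      simp [show ¬ t.val < P.k by omega]
  · have e : mono (fun t : ZMod P.p => t + 1 - (P.k : ZMod P.p) + (P.k : ZMod P.p)) (fun t => (1 : F) *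
        (if t + 1 - (P.k : ZMod P.p) = 0 then 1 else 0) * 1 * 1) = mono (fun t => t + 1)
        (fun t => if t + 1 - (P.k : ZMod P.p) = 0 then 1 else 0) :=
      mono_congr (fun t => by ring) (fun t => by ring)
    rw [e, mono_add, mono_add]
    refine mono_congr (fun t => rfl) (fun t => ?_)
    rcases val_succ t with ⟨h1, h2, h3⟩ | ⟨h1, h2⟩
    · have hi : (t + 1 - (P.k : ZMod P.p) = 0) ↔ t.val + 1 = P.k := by
        rw [sub_eq_zero]
        constructor
        · intro h; rw [← h2, h, kv]
        · intro h; rw [← h]; push_cast; rw [ZMod.natCast_zmod_val]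
      simp only [hi, h2, h3, if_false]
      by_cases a : t.val + 1 < P.k
      · simp [a, show t.val < P.k by omega, show ¬ t.val + 1 = P.k by omega]
      · by_cases b : t.val + 1 = P.k
        · simp [b, show t.val < P.k by omega]
        · simp [a, b, show ¬ t.val < P.k by omega]
    · have hi : (0 - (P.k : ZMod P.p) = 0) ↔ P.k = 0 := by
        rw [zero_sub, neg_eq_zero]
        constructor
        · intro h; rw [← kv, h, ZMod.val_zero]
        · intro h; rw [h, Nat.cast_zero]
      rw [h2, if_pos rfl, ZMod.val_zero]
      simp only [hi]
      by_cases b : P.k = 0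
      · simp [b]
      · simp [b, show ¬ t.val < P.k by omega, show 0 < P.k by omega]
  · refine mono_congr (fun t => rfl) (fun t => ?_)
    by_cases h : t = 0
    · simp [h, ZMod.val_zero, Par.Yn]
    · simp [h]
  · rw [mono_add, mono_mul, mono_mul]
    refine mono_congr (fun t => rfl) (fun t => ?_)
    have : P.z ^ P.m + (P.z ^ (P.m + 1) - P.z ^ P.m) * (if (t + 1).val < P.k then 1 else 0) = P.W (t + 1).val := rfl
    simp only [this]
    rcases val_succ t with ⟨h1, h2, h3⟩ | ⟨h1, h2⟩
    · rw [h2, Par.Yn]; ring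
    · rw [h2, ZMod.val_zero]
      have hp := P.prodW hP
      rw [← h1, Finset.prod_range_succ', ← Par.Yn_eq] at hp
      rw [Par.Yn]
      linear_combination -hp
  · rcases hP.tn with h | h
    · rw [if_pos h]
      exact mono_congr (fun t => rfl) (fun t => by rw [h, Nat.cast_one])
    · rw [if_neg (by omega), mono_add, mono_add, mono_add]
      exact mono_congr (fun t => rfl) (fun t => by rw [h]; push_cast; norm_num)

end val

end SLP


set_option linter.unusedSectionVars false
set_option linter.unusedSimpArgs false
set_option linter.unusedVariables false

namespace SLP
open scoped commutatorElement
open Matrix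

section val
variable {F : Type} [Field F] (P : Par F) [Fact P.p.Prime]

theorem Par.val_o : P.val .o = 1 := mono_one

theorem inv_pin {A R : Type} [Ring A] [Ring R] (φ : A →+* R) {M M' : A} {a a' : R} (h : φ M = a)
    (hM : M' * M = 1) (ha : a * a' = 1) : φ M' = a' := by
  calc φ M' = φ M' * (a * a') := by rw [ha, mul_one]
    _ = φ (M' * M) * a' := by rw [map_mul, h, mul_assoc]
    _ = a' := by rw [hM, map_one, one_mul]

theorem Par.names_phi (hP : P.OK) {R : Type} [Ring R] (f : F →+* R) (n : Nm → R) (ho : n .o = 1)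
    (hr : ∀ r ∈ P.rels, r.1.ev n = r.2.ev n) (hup : n .u ^ P.p = 1)
    (hka : n .ka * n .u = n .u ^ P.g0 * n .ka) (huk : n .uk = n .u ^ P.k)
    (hth : n .th = f P.g) (hPp : n .P = f P.p) (hzb : n .zb = f (P.z ^ P.m))
    (hc : n .c = f (P.z ^ (P.m + 1) - P.z ^ P.m)) (hze : n .ze = f P.z) :
    ∃ φ : Matrix (ZMod P.p) (ZMod P.p) F →+* R, ∀ s, φ (P.val s) = n s := by
  have hv := P.val_rels hP
  simp only [Par.rels, List.forall_mem_cons, RE.ev_add, RE.ev_mul, RE.ev_nm, RE.ev_zero,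
    apply_ite (RE.ev P.val), P.val_o] at hv
  obtain ⟨v1, v2, v3, v4, v5, v6, v7, v8, v9, v10, v11, v12, v13, v14, -⟩ := hv
  simp only [Par.rels, List.forall_mem_cons, RE.ev_add, RE.ev_mul, RE.ev_nm, RE.ev_zero,
    apply_ite (RE.ev n), ho] at hr
  obtain ⟨r1, r2, r3, r4, r5, r6, r7, r8, r9, r10, r11, r12, r13, r14, rhu, rhe, rke, rek, reue, ree, rtu, rte,
    rde, rd, repe, rep, rye, ryu, rta, -⟩ := hr
  have pl : 1 < P.p := (Fact.out : P.p.Prime).one_lt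
  have hk := hP.hk
  have fth : ∀ a : F, a ≠ 0 → ∃ j : ℕ, f a = n .th ^ j := by
    intro a ha
    obtain ⟨j, hj⟩ := hP.hg a ha
    exact ⟨j, by rw [hj, map_pow, hth]⟩
  have cfu : ∀ a, Commute (f a) (n .u) := by
    intro a
    by_cases ha : a = 0
    · rw [ha, map_zero]; exact Commute.zero_left _
    · obtain ⟨j, hj⟩ := fth a ha
      rw [hj]; exact (show Commute _ _ from rtu).pow_left j
  have cfe : ∀ a, Commute (f a) (n .e) := by
    intro a
    by_cases ha : a = 0
    · rw [ha, map_zero]; exact Commute.zero_left _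
    · obtain ⟨j, hj⟩ := fth a ha
      rw [hj]; exact (show Commute _ _ from rte).pow_left j
  have kapow : ∀ j : ℕ, n .ka * n .u ^ j = n .u ^ (P.g0 * j) * n .ka := by
    intro j
    induction j with
    | zero => simp
    | succ j ih => rw [pow_succ, ← mul_assoc, ih, mul_assoc, hka, ← mul_assoc, ← pow_add, mul_add, mul_one]
  have hpow : ∀ j : ℕ, n .h * n .u ^ j = n .u ^ (2 * j) * n .h := by
    intro j
    induction j with
    | zero => simp
    | succ j ih =>
      rw [pow_succ, ← mul_assoc, ih, mul_assoc, rhu, ← mul_assoc, ← pow_two, ← pow_add, mul_add, mul_one]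
  have eus : ∀ j : ℕ, n .e * n .u ^ (P.g0 ^ j) * n .e = 0 := by
    intro j
    induction j with
    | zero => rw [pow_zero, pow_one]; exact reue
    | succ j ih =>
      calc n .e * n .u ^ (P.g0 ^ (j + 1)) * n .e = n .e * (n .u ^ (P.g0 * P.g0 ^ j) * n .ka) * n .e := by
            rw [pow_succ', mul_assoc, mul_assoc, mul_assoc, rke]
        _ = (n .e * n .ka) * n .u ^ (P.g0 ^ j) * n .e := by rw [← kapow]; noncomm_ring
        _ = 0 := by rw [rek, ih]
  have he : ∀ t : ZMod P.p, n .e * us (n .u) t * n .e = if t = 0 then n .e else 0 := by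
    intro t
    by_cases h : t = 0
    · rw [if_pos h, h, us_zero, mul_one, ree]
    · rw [if_neg h]
      obtain ⟨j, hj⟩ := hP.hg0 t h
      rw [hj, ← Nat.cast_pow, us_nat hup, eus]
  have hs := units_complete hP.hp hup he (n .d) (by rw [rd, hPp]) cfe
  obtain ⟨φ, pin⟩ := exists_phi hup he cfu cfe hs
  have cfs : ∀ a (t : ZMod P.p), Commute (f a) (us (n .u) t) := fun a t => (cfu a).pow_right _
  have usv : ∀ t : ZMod P.p, us (n .u) t = n .u ^ t.val := fun t => rfl
  have scal : ∀ a : F, φ (mono (fun t => t) fun _ => a) = f a := fun a => pin _ _ _ fun t => rfl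
  have tv' : ∀ t : ZMod P.p, ((t.val : ℕ) : ZMod P.p) = t := fun t => ZMod.natCast_zmod_val t
  have small : ∀ j : ℕ, 0 < j → j < P.p → n .e * n .u ^ j * n .e = 0 := by
    intro j h0 hj
    have := he (j : ZMod P.p)
    rw [us_nat hup, if_neg] at this
    · exact this
    · intro h
      rw [ZMod.natCast_eq_zero_iff] at h
      exact absurd (Nat.le_of_dvd h0 h) (by omega)
  have Pu : φ (P.val .u) = n .u := pin _ _ _ fun t => by
    show _ = f 1 * (us _ (t + 1) * _)
    have u1 : us (n .u) (1 : ZMod P.p) = n .u := by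
      have := us_nat hup 1
      simpa using this
    rw [map_one, one_mul, add_comm, us_add hup, u1, mul_assoc]
  have Ph : φ (P.val .h) = n .h := pin _ _ _ fun t => by
    show _ = f 1 * (us _ (2 * t) * _)
    have : us (n .u) (2 * t) = n .u ^ (2 * t.val) := by
      rw [← us_nat hup]; push_cast; rw [tv']
    rw [map_one, one_mul, this, usv, ← mul_assoc, hpow, mul_assoc, rhe]
  have Pka : φ (P.val .ka) = n .ka := pin _ _ _ fun t => by
    show _ = f 1 * (us _ ((P.g0 : ZMod P.p) * t) * _)
    have : us (n .u) ((P.g0 : ZMod P.p) * t) = n .u ^ (P.g0 * t.val) := by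
      rw [← us_nat hup]; push_cast; rw [tv']
    rw [map_one, one_mul, this, usv, ← mul_assoc, kapow, mul_assoc, rke]
  have Puk : φ (P.val .uk) = n .uk := pin _ _ _ fun t => by
    show _ = f 1 * (us _ (t + (P.k : ZMod P.p)) * _)
    rw [map_one, one_mul, huk, ← us_nat hup, add_comm, us_add hup, mul_assoc]
  have Pe : φ (P.val .e) = n .e := pin _ _ _ fun t => by
    show _ = f (if t = 0 then 1 else 0) * (us _ t * _)
    rw [← mul_assoc, he]
    by_cases h : t = 0
    · rw [if_pos h, if_pos h, h, us_zero, map_one, one_mul, one_mul]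
    · rw [if_neg h, if_neg h, map_zero, zero_mul]
  have Pd : φ (P.val .d) = n .d := pin _ _ _ fun t => by
    show _ = f (t.val : F) * (us _ t * _)
    have : ∀ j : ℕ, j < P.p → n .d * (n .u ^ j * n .e) = f (j : F) * (n .u ^ j * n .e) := by
      intro j
      induction j with
      | zero => intro _; simp [rde]
      | succ j ih =>
        intro hj
        have e1 : n .d * n .u = n .u * n .d + n .u - n .P * n .e * n .u := by rw [rd]; noncomm_ring
        have cj : n .u * f (j : F) = f (j : F) * n .u := (cfu _).eq.symm
        calc n .d * (n .u ^ (j + 1) * n .e) = (n .d * n .u) * n .u ^ j * n .e := by rw [pow_succ']; noncomm_ring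
          _ = n .u * (n .d * (n .u ^ j * n .e)) + n .u ^ (j + 1) * n .e - n .P * (n .e * n .u ^ (j + 1) * n .e) := by
            rw [e1, pow_succ']; noncomm_ring
          _ = _ := by
            rw [small (j + 1) (by omega) hj, ih (by omega), ← mul_assoc (n .u), cj, pow_succ', mul_zero, sub_zero,
              Nat.cast_add, map_add, Nat.cast_one, map_one]
            noncomm_ring
    exact this t.val (ZMod.val_lt t)
  have Pep : φ (P.val .ep) = n .ep := pin _ _ _ fun t => by
    show _ = f (if t.val < P.k then 1 else 0) * (us _ t * _)
    have uki : n .uki = us (n .u) (-(P.k : ZMod P.p)) := by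
      have h1 : n .uk * us (n .u) (-(P.k : ZMod P.p)) = 1 := by
        rw [huk, ← us_nat hup, us_neg' hup]
      calc n .uki = n .uki * (n .uk * us (n .u) (-(P.k : ZMod P.p))) := by rw [h1, mul_one]
        _ = _ := by rw [← mul_assoc, r6, one_mul]
    have : ∀ j : ℕ, j < P.p → n .ep * (n .u ^ j * n .e) = f (if j < P.k then 1 else 0) * (n .u ^ j * n .e) := by
      intro j
      induction j with
      | zero =>
        intro _
        rw [pow_zero, one_mul, repe]
        split_ifs <;> simp
      | succ j ih =>
        intro hj
        have e1 : n .ep * n .u = n .u * n .ep + n .e * n .u - n .uk * n .e * n .uki * n .u := by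
          rw [rep]; noncomm_ring
        have cj : n .u * f (if j < P.k then 1 else 0) = f (if j < P.k then 1 else 0) * n .u := (cfu _).eq.symm
        have e2 : n .e * n .uki * n .u ^ (j + 1) * n .e = if j + 1 = P.k then n .e else 0 := by
          rw [uki, mul_assoc (n .e), ← us_nat hup, ← us_add hup, he]
          have : (-(P.k : ZMod P.p) + ((j + 1 : ℕ) : ZMod P.p) = 0) ↔ j + 1 = P.k := by
            rw [neg_add_eq_zero, eq_comm, ZMod.natCast_eq_natCast_iff', Nat.mod_eq_of_lt hj, Nat.mod_eq_of_lt hk]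
          simp only [this]
        calc n .ep * (n .u ^ (j + 1) * n .e) = (n .ep * n .u) * n .u ^ j * n .e := by rw [pow_succ']; noncomm_ring
          _ = n .u * (n .ep * (n .u ^ j * n .e)) + (n .e * n .u ^ (j + 1) * n .e) -
              n .uk * (n .e * n .uki * n .u ^ (j + 1) * n .e) := by
            rw [e1, pow_succ']; noncomm_ring
          _ = _ := by
            rw [small (j + 1) (by omega) hj, ih (by omega), ← mul_assoc (n .u), cj, e2, add_zero, mul_assoc,
              ← mul_assoc (n .u), ← pow_succ', huk]
            by_cases a : j + 1 = P.k
            · rw [if_pos a, if_pos (show j < P.k by omega), if_neg (show ¬ j + 1 < P.k by omega), ← a]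
              simp
            · rw [if_neg a]
              by_cases b : j + 1 < P.k
              · rw [if_pos b, if_pos (show j < P.k by omega)]; simp
              · rw [if_neg b, if_neg (show ¬ j < P.k by omega)]; simp
    exact this t.val (ZMod.val_lt t)
  have epj : ∀ j : ℕ, j < P.p → n .ep * (n .u ^ j * n .e) = f (if j < P.k then 1 else 0) * (n .u ^ j * n .e) := by
    intro j hj
    have h1 : mono (fun t : ZMod P.p => t) (fun t => if t.val < P.k then (1 : F) else 0) *
        mono (fun t => t + (j : ZMod P.p)) (fun t => if t = 0 then 1 else 0) =
        mono (fun t => t) (fun _ => if j < P.k then (1 : F) else 0) *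
        mono (fun t => t + (j : ZMod P.p)) (fun t => if t = 0 then 1 else 0) := by
      rw [mono_mul, mono_mul]
      refine mono_congr (fun t => rfl) fun t => ?_
      by_cases h : t = 0
      · rw [h, zero_add, ZMod.val_natCast, Nat.mod_eq_of_lt hj]
      · rw [if_neg h, mul_zero, mul_zero]
    have h2 : φ (mono (fun t => t + (j : ZMod P.p)) (fun t => if t = 0 then 1 else 0)) = n .u ^ j * n .e := by
      refine pin _ _ _ fun t => ?_
      have := he t
      rw [mul_assoc, ← mul_assoc (n .e), he]
      by_cases h : t = 0
      · rw [if_pos h, if_pos h, h, zero_add, us_nat hup, map_one, one_mul]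
      · rw [if_neg h, if_neg h, map_zero, zero_mul, mul_zero]
    have h3 := congrArg φ h1
    rw [map_mul, map_mul, h2, scal] at h3
    rw [← h3]
    congr 1
    exact Pep.symm
  have Py : φ (P.val .y) = n .y := pin _ _ _ fun t => by
    show _ = f (P.Yn t.val) * (us _ t * _)
    have : ∀ j : ℕ, j < P.p → n .y * (n .u ^ j * n .e) = f (P.Yn j) * (n .u ^ j * n .e) := by
      intro j
      induction j with
      | zero => intro _; simp [rye, Par.Yn]
      | succ j ih =>
        intro hj
        have cj : n .u * f (P.Yn j) = f (P.Yn j) * n .u := (cfu _).eq.symm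
        have e3 : ∀ r : R, f (P.Yn j) * (n .u * r) = n .u * (f (P.Yn j) * r) := fun r => by
          rw [← mul_assoc, ← mul_assoc, cj]
        have fc : ∀ a b : F, f a * f b = f b * f a := fun a b => by rw [← map_mul, mul_comm, map_mul]
        calc n .y * (n .u ^ (j + 1) * n .e) = (n .y * n .u) * (n .u ^ j * n .e) := by rw [pow_succ']; noncomm_ring
          _ = (n .zb + n .c * n .ep) * (n .u * (n .y * (n .u ^ j * n .e))) := by rw [ryu]; noncomm_ring
          _ = (n .zb + n .c * n .ep) * (n .u ^ (j + 1) * n .e * f (P.Yn j)) := by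
            rw [ih (by omega), ← e3, ← mul_assoc (n .u), ← pow_succ',
              (((cfu (P.Yn j)).pow_right (j + 1)).mul_right (cfe (P.Yn j))).eq]
          _ = (f (P.W (j + 1)) * (n .u ^ (j + 1) * n .e)) * f (P.Yn j) := by
            rw [← mul_assoc]
            congr 1
            rw [add_mul, mul_assoc (n .c), epj (j + 1) hj, hzb, hc, Par.W, map_add, map_mul]
            noncomm_ring
          _ = _ := by
            rw [mul_assoc, ← (((cfu (P.Yn j)).pow_right (j + 1)).mul_right (cfe (P.Yn j))).eq, ← mul_assoc,
              ← map_mul]; rfl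
    exact this t.val (ZMod.val_lt t)
  have tn : φ (P.val .ta) = n .ta := by
    have hh : φ (P.val .ta) = f (P.tn : F) := scal _
    rw [rta, hh]
    rcases hP.tn with h | h
    · rw [if_pos h, h, Nat.cast_one, map_one]
    · rw [if_neg (by omega), h, map_natCast]; norm_num
  refine ⟨φ, fun s => ?_⟩
  have Pth : φ (P.val .th) = n .th := (scal _).trans hth.symm
  have Pze : φ (P.val .ze) = n .ze := (scal _).trans hze.symm
  cases s with
  | o => rw [P.val_o, map_one, ho]
  | th => exact Pth
  | thi => exact inv_pin φ Pth v10 r9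
  | ta => exact tn
  | tai => exact inv_pin φ tn v12 r11
  | P => exact (scal _).trans hPp.symm
  | zb => exact (scal _).trans hzb.symm
  | c => exact (scal _).trans hc.symm
  | ze => exact Pze
  | zei => exact inv_pin φ Pze v14 r13
  | ep => exact Pep
  | u => exact Pu
  | ui => exact inv_pin φ Pu v2 r1
  | h => exact Ph
  | hi => exact inv_pin φ Ph v4 r3
  | ka => exact Pka
  | e => exact Pe
  | d => exact Pd
  | uk => exact Puk
  | uki => exact inv_pin φ Puk v6 r5
  | y => exact Py
  | yi => exact inv_pin φ Py v8 r7

end val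

end SLP


set_option linter.unusedSectionVars false
set_option linter.unusedSimpArgs false
set_option linter.unusedVariables false

namespace SLP
open scoped commutatorElement
open Matrix

section gsnear
variable {Q R S G Γ : Type} [Ring R] [Ring S] [Group G] [Group Γ] {reg : Q → Prop}
  {ε : Q → R} {X : Q → Q → R → G} {ε' : Q → S} {X' : Q → Q → S → Γ}

theorem GS.mulr (h : GS ε X) {i j k} (hj : ε j = 1) (h1 : i ≠ j) (h2 : j ≠ k) (h3 : i ≠ k) (r s) :
    ⁅X i j r, X j k s⁆ = X i k (r * s) := by
  rw [h.mul h1 h2 h3, hj, mul_one]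

theorem GS.near {ι : Type} {γ : ι → G} {γ' : ι → Γ} (hf : Fresh reg) (h : GS ε X) (h' : GS ε' X')
    (he : ∀ j, reg j → ε j = 1) (he' : ∀ j, reg j → ε' j = 1) {v : Nm → R} {v' : Nm → S}
    (hn : ∀ i j, i ≠ j → ∀ s, Near γ γ' 1 (X i j (v s)) (X' i j (v' s))) (e : RE) :
    ∀ i j, i ≠ j → Near γ γ' e.size (X i j (e.ev v)) (X' i j (e.ev v')) := by
  induction e with
  | nm s => intro i j hij; exact hn i j hij s
  | zero => intro i j hij; rw [RE.ev, RE.ev, h.zero hij, h'.zero hij]; exact Near.one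
  | add a b iha ihb =>
    intro i j hij
    rw [RE.ev, RE.ev, h.add hij, h'.add hij]; exact (iha i j hij).mul (ihb i j hij)
  | mul a b iha ihb =>
    intro i j hij
    obtain ⟨k, hk, hki, hkj, -⟩ := hf i j i i i
    have := (iha i k hki.symm).comm (ihb k j hkj)
    rw [← commutatorElement_def, ← commutatorElement_def, h.mulr (he k hk) hki.symm hkj hij,
      h'.mulr (he' k hk) hki.symm hkj hij] at this
    exact this

theorem GS.spread (hf : Fresh reg) (h : GS ε X) (he : ∀ j, reg j → ε j = 1) {a b : Q} (hab : a ≠ b)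
    (ha : reg a) (hb : reg b) {r s : R} (hrs : X a b r = X a b s) : ∀ i j, i ≠ j → X i j r = X i j s := by
  have h1 : ∀ j, a ≠ j → X a j r = X a j s := by
    intro j haj
    by_cases hj : j = b
    · rw [hj]; exact hrs
    · have e1 := h.mulr (he b hb) hab (Ne.symm hj) haj r 1
      have e2 := h.mulr (he b hb) hab (Ne.symm hj) haj s 1
      rw [mul_one] at e1 e2
      rw [← e1, ← e2, hrs]
  have h2 : ∀ i j, i ≠ a → j ≠ a → i ≠ j → X i j r = X i j s := by
    intro i j hi hj hij
    have e1 := h.mulr (he a ha) hi (Ne.symm hj) hij 1 r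
    have e2 := h.mulr (he a ha) hi (Ne.symm hj) hij 1 s
    rw [one_mul] at e1 e2
    rw [← e1, ← e2, h1 j (Ne.symm hj)]
  intro i j hij
  by_cases hi : i = a
  · subst hi; exact h1 j hij
  by_cases hj : j = a
  · obtain ⟨k, hk, hki, hkj, -⟩ := hf i j i i i
    have e1 := h.mulr (he k hk) hki.symm hkj hij r 1
    have e2 := h.mulr (he k hk) hki.symm hkj hij s 1
    rw [mul_one] at e1 e2
    rw [← e1, ← e2, h2 i k hi (hj ▸ hkj) hki.symm]
  · exact h2 i j hi hj hij

/-- Weyl-type element. -/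
def ww {Γ : Type} [Group Γ] (x : Q → Q → Nm → Γ) (i k : Q) (s s' : Nm) : Γ :=
  x i k s * (x k i s')⁻¹ * x i k s

def dl {Γ : Type} [Group Γ] (x : Q → Q → Nm → Γ) (i k : Q) (s s' : Nm) : Γ :=
  ww x i k s s' * (ww x i k .o .o)⁻¹

theorem dl_map (f : G →* Γ) (x : Q → Q → Nm → G) (i k s s') :
    f (dl x i k s s') = dl (fun i j s => f (x i j s)) i k s s' := by
  simp [dl, ww]

theorem Near.dl {ι : Type} {γ : ι → G} {γ' : ι → Γ} {x : Q → Q → Nm → G} {x' : Q → Q → Nm → Γ} {i k : Q}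
    (hik : i ≠ k) (hn : ∀ i j, i ≠ j → ∀ s, Near γ γ' 1 (x i j s) (x' i j s)) (s s') :
    Near γ γ' 6 (dl x i k s s') (dl x' i k s s') := by
  have h : ∀ s s', Near γ γ' 3 (ww x i k s s') (ww x' i k s s') := fun s s' =>
    ((hn i k hik s).mul (hn k i hik.symm s').inv).mul (hn i k hik s)
  exact (h s s').mul (h .o .o).inv

theorem conj_ww (h : GS ε X) {v : Nm → R} {i j k : Q} (hik : i ≠ k) (hij : i ≠ j) (hkj : k ≠ j)
    (hi : ε i = 1) (hk : ε k = 1) {s s' : Nm} (hv : v s' * v s = 1) (r : R) :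
    ww (fun i j s => X i j (v s)) i k s s' * X k j r * (ww (fun i j s => X i j (v s)) i k s s')⁻¹ =
      X i j (v s * r) := by
  have e1 : X i k (v s) * X k j r * (X i k (v s))⁻¹ = X i j (v s * r) * X k j r := by
    have := h.mulr hk hik hkj hij (v s) r
    rw [commutatorElement_def] at this
    rw [← this]; group
  have e2 : (X k i (v s'))⁻¹ * X i j (v s * r) * X k i (v s') = X k j (- r) * X i j (v s * r) := by
    have := h.mulr hi hik.symm hij hkj (-(v s')) (v s * r)
    rw [commutatorElement_def, h.neg hik.symm, ← mul_assoc, neg_mul, hv, neg_one_mul] at this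
    rw [← this]; group
  have c1 := (h.comm hik.symm hkj hik hkj (v s') r).eq
  have c2 := (h.comm hkj hij hij.symm hkj r (v s * r)).eq
  have c3 := (h.comm hik hij hik.symm hij (v s) (v s * r)).eq
  have c1' : (X k i (v s'))⁻¹ * X k j r * X k i (v s') = X k j r := by
    rw [mul_assoc, ← c1, inv_mul_cancel_left]
  calc _ = X i k (v s) * ((X k i (v s'))⁻¹ * (X i k (v s) * X k j r * (X i k (v s))⁻¹) * X k i (v s')) *
        (X i k (v s))⁻¹ := by simp only [ww]; group
    _ = X i k (v s) * (((X k i (v s'))⁻¹ * X i j (v s * r) * X k i (v s')) *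
        ((X k i (v s'))⁻¹ * X k j r * X k i (v s'))) * (X i k (v s))⁻¹ := by rw [e1]; group
    _ = X i k (v s) * (X k j (-r) * (X i j (v s * r) * X k j r)) * (X i k (v s))⁻¹ := by
      rw [e2, c1', mul_assoc (X k j (-r))]
    _ = X i k (v s) * X i j (v s * r) * (X i k (v s))⁻¹ := by
      rw [← c2, ← mul_assoc (X k j (-r)), ← h.add hkj, neg_add_cancel, h.zero hkj, one_mul]
    _ = _ := by rw [c3, mul_inv_cancel_right]

theorem conj_dl (h : GS ε X) {v : Nm → R} (ho : v .o = 1) {i j k : Q} (hik : i ≠ k) (hij : i ≠ j) (hkj : k ≠ j)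
    (hi : ε i = 1) (hk : ε k = 1) {s s' : Nm} (hv : v s' * v s = 1) (r : R) :
    dl (fun i j s => X i j (v s)) i k s s' * X i j r * (dl (fun i j s => X i j (v s)) i k s s')⁻¹ =
      X i j (v s * r) := by
  have e1 := conj_ww h (v := v) hik hij hkj hi hk (s := .o) (s' := .o) (by rw [ho, one_mul]) r
  rw [ho, one_mul] at e1
  rw [← conj_ww h hik hij hkj hi hk hv r]
  nth_rewrite 1 [← e1]
  rw [dl]; group

/-- Horner words. -/
def hw {Γ : Type} [Group Γ] (H U : Γ) : ℕ → ℕ → Γ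
  | 0, _ => 1
  | f + 1, N => H * hw H U f (N / 2) * H⁻¹ * (if N % 2 = 1 then U else 1)

theorem hw_map (f : G →* Γ) (H U : G) (l N : ℕ) : f (hw H U l N) = hw (f H) (f U) l N := by
  induction l generalizing N with
  | zero => simp [hw]
  | succ l ih => simp only [hw, map_mul, map_inv, ih]; split_ifs <;> simp

theorem hw_len {ι : Type} {H U : FreeGroup ι} {k : ℕ} (hH : Len H k) (hU : Len U k) (l N : ℕ) :
    Len (hw H U l N) (l * (3 * k)) := by
  induction l generalizing N with
  | zero => exact Len.one
  | succ l ih =>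
    have : Len (if N % 2 = 1 then U else 1) k := by split_ifs; exacts [hU, Len.one]
    exact (((hH.mul (ih (N / 2))).mul hH.inv).mul this).mono (by ring_nf; omega)

theorem hw_conj {X : R → G} {H U : G} {a a' u : R} (ha : a * a' = 1) (ha' : a' * a = 1)
    (hu : a * u = u * u * a)
    (hH : ∀ r, H * X r * H⁻¹ = X (a * r)) (hU : ∀ r, U * X r * U⁻¹ = X (u * r)) (l : ℕ) :
    ∀ N, N < 2 ^ l → ∀ r, hw H U l N * X r * (hw H U l N)⁻¹ = X (u ^ N * r) := by
  have hH' : ∀ r, H⁻¹ * X r * H = X (a' * r) := by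
    intro r
    have := hH (a' * r)
    rw [← mul_assoc a, ha, one_mul] at this
    rw [← this]; group
  have hp : ∀ k, a * u ^ k = u ^ (2 * k) * a := by
    intro k
    induction k with
    | zero => simp
    | succ k ih =>
      rw [pow_succ, ← mul_assoc, ih, mul_assoc, hu, show 2 * (k + 1) = 2 * k + 2 by ring, pow_add, pow_two]
      noncomm_ring
  induction l with
  | zero =>
    intro N hN r
    have : N = 0 := by simpa using hN
    subst this; simp [hw]
  | succ l ih =>
    intro N hN r
    have h2 := ih (N / 2) (by rw [pow_succ] at hN; omega)
    have h1 : (if N % 2 = 1 then U else 1) * X r * (if N % 2 = 1 then U else 1)⁻¹ = X (u ^ (N % 2) * r) := by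
      rcases Nat.mod_two_eq_zero_or_one N with h | h
      · simp [h]
      · simp [h, hU]
    calc _ = H * (hw H U l (N / 2) * (H⁻¹ * ((if N % 2 = 1 then U else 1) * X r * (if N % 2 = 1 then U else 1)⁻¹) * H)
          * (hw H U l (N / 2))⁻¹) * H⁻¹ := by simp only [hw]; group
      _ = X (a * (u ^ (N / 2) * (a' * (u ^ (N % 2) * r)))) := by rw [h1, hH', h2, hH]
      _ = _ := by
        congr 1
        rw [← mul_assoc, hp, mul_assoc, ← mul_assoc a, ha, one_mul, ← mul_assoc, ← pow_add, Nat.div_add_mod]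

end gsnear

/-- Agreement of two one-parameter families. -/
theorem fam_agree {F Γ : Type} [Field F] [Group Γ] {g : F} (hg : ∀ t : F, t ≠ 0 → ∃ j : ℕ, t = g ^ j)
    {a b : F → Γ} (a0 : a 0 = 1) (b0 : b 0 = 1) {h d : Γ} (ha : ∀ r, h * a r * h⁻¹ = a (g * g * r))
    (hb : ∀ r, d * b r * d⁻¹ = b (g * r)) (h1 : a 1 = b 1) (hg1 : a g = b g)
    (hh : h * b 1 * h⁻¹ = d * d * b 1 * (d * d)⁻¹) (hd : h * d = d * h) (r : F) : a r = b r := by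
  have hbn : ∀ n : ℕ, d ^ n * b 1 * (d ^ n)⁻¹ = b (g ^ n) := by
    intro n
    induction n with
    | zero => simp
    | succ n ih => rw [pow_succ', pow_succ', ← hb, ← ih]; group
  have hbh : ∀ n : ℕ, h * b (g ^ n) * h⁻¹ = b (g ^ (n + 2)) := by
    intro n
    have hc : h * d ^ n = d ^ n * h := (show Commute h d from hd).pow_right n
    rw [← hbn, ← hbn (n + 2)]
    calc _ = (h * d ^ n) * b 1 * (h * d ^ n)⁻¹ := by group
      _ = d ^ n * (h * b 1 * h⁻¹) * (d ^ n)⁻¹ := by rw [hc]; group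
      _ = _ := by rw [hh, pow_add, pow_two]; group
  have key : ∀ n : ℕ, a (g ^ n) = b (g ^ n) ∧ a (g ^ (n + 1)) = b (g ^ (n + 1)) := by
    intro n
    induction n with
    | zero => simpa using ⟨h1, hg1⟩
    | succ n ih =>
      refine ⟨ih.2, ?_⟩
      rw [← hbh, ← ih.1, ha, ← pow_two, ← pow_add, add_comm 2 n]
  by_cases hr : r = 0
  · rw [hr, a0, b0]
  · obtain ⟨j, rfl⟩ := hg r hr
    exact (key j).1

end SLP


set_option linter.unusedSectionVars false
set_option linter.unusedSimpArgs false
set_option linter.unusedVariables false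

namespace SLP
open scoped commutatorElement
open Matrix

theorem ww_ring {R : Type} [Ring R] {a b : R} (ha : a * a = 0) (h : a * b * a = a) :
    (1 + a) * (1 - b) * (1 + a) = 1 - a * b - b * a + a - b := by
  have : (1 + a) * (1 - b) * (1 + a) = 1 + a + a - b - a * b - b * a - a * b * a + a * a := by noncomm_ring
  rw [this, ha, h]; abel

theorem dl_ring {R : Type} [Ring R] {q a b c d : R} (h1 : q * q = q) (h2 : q * c = 0) (h3 : q * d = 0)
    (h4 : a * q = 0) (h5 : b * q = 0) (h6 : a * c = 0) (h7 : b * d = 0) :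
    (q + a - b) * (q - c + d) = q + a * d + b * c := by
  have : (q + a - b) * (q - c + d) = q * q - q * c + q * d + a * q - a * c + a * d - b * q + b * c - b * d := by
    noncomm_ring
  rw [this, h1, h2, h3, h4, h5, h6, h7]; abel

section blk
variable {Q T F : Type} [Fintype Q] [DecidableEq Q] [Fintype T] [DecidableEq T] [CommRing F]
  {supp : Q → T → Bool}

theorem BM_left (I J : Q) (A : Matrix T T F) : BM supp I J (epsM F supp I * A) = BM supp I J A := by
  ext a b
  rw [BM_apply, BM_apply, epsM, Matrix.diagonal_mul]
  split_ifs with h1 h2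
  · rw [one_mul]
  · exact absurd (h1.1 ▸ a.2) h2
  · rfl

theorem BM_right (I J : Q) (A : Matrix T T F) : BM supp I J (A * epsM F supp J) = BM supp I J A := by
  ext a b
  rw [BM_apply, BM_apply, epsM, Matrix.mul_diagonal]
  split_ifs with h1 h2
  · rw [mul_one]
  · exact absurd (h1.2 ▸ b.2) h2
  · rfl

theorem eps_idem (I : Q) : epsM F supp I * epsM F supp I = epsM F supp I := by
  rw [epsM, Matrix.diagonal_mul_diagonal]; congr 1; ext t; split_ifs <;> simp

theorem BX_neg {I J : Q} (h : I ≠ J) (A : Matrix T T F) : ((BX supp I J A)⁻¹).1 = 1 - BM supp I J A := by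
  rw [← BX_gs.neg h, BX_coe h, sub_eq_add_neg]
  congr 1
  simp [BM]

theorem ww_coe {i k : Q} (hik : i ≠ k) (hk : epsM F supp k = 1) {v : Nm → Matrix T T F} {s s' : Nm}
    (h1 : v s * v s' = 1) (h2 : v s' * v s = 1) (hc : v s * epsM F supp i = epsM F supp i * v s) :
    (ww (fun i j s => BX supp i j (v s)) i k s s').1 = 1 - BM supp i i 1 - BM supp k k (epsM F supp i) +
      BM supp i k (v s) - BM supp k i (v s') ∧
    ((ww (fun i j s => BX supp i j (v s)) i k s s')⁻¹).1 = 1 - BM supp i i 1 - BM supp k k (epsM F supp i) -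
      BM supp i k (v s) + BM supp k i (v s') := by
  have ab : BM supp i k (v s) * BM supp k i (v s') = BM supp i i 1 := by
    rw [BM_eq, hk, mul_one, h1]
  have ba : BM supp k i (v s') * BM supp i k (v s) = BM supp k k (epsM F supp i) := by
    rw [BM_eq, mul_assoc, ← hc, ← mul_assoc, h2, one_mul]
  have aa : BM supp i k (v s) * BM supp i k (v s) = 0 := BM_ne hik.symm _ _ _ _
  have ea : BM supp i i 1 * BM supp i k (v s) = BM supp i k (v s) := by
    rw [BM_eq, one_mul, BM_left]
  constructor
  · simp only [ww, Matrix.SpecialLinearGroup.coe_mul]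
    rw [BX_neg hik.symm, BX_coe hik, ww_ring aa (by rw [ab, ea]), ab, ba]
  · have := ww_ring (a := - BM supp i k (v s)) (b := - BM supp k i (v s')) (by simp [aa])
      (by rw [neg_mul_neg, ab, mul_neg, ea])
    simp only [ww, _root_.mul_inv_rev, inv_inv, Matrix.SpecialLinearGroup.coe_mul]
    rw [BX_neg hik, BX_coe hik.symm, ← mul_assoc]
    rw [neg_mul_neg, neg_mul_neg, ab, ba] at this
    simp only [sub_neg_eq_add, ← sub_eq_add_neg] at this
    exact this

theorem dl_coe {i k : Q} (hik : i ≠ k) (hk : epsM F supp k = 1) {v : Nm → Matrix T T F} (ho : v .o = 1) {s s' : Nm}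
    (h1 : v s * v s' = 1) (h2 : v s' * v s = 1) (hc : v s * epsM F supp i = epsM F supp i * v s) :
    (dl (fun i j s => BX supp i j (v s)) i k s s').1 = 1 - BM supp i i 1 - BM supp k k (epsM F supp i) +
      BM supp i i (v s) + BM supp k k (v s' * epsM F supp i) := by
  have hc' : v s' * epsM F supp i = epsM F supp i * v s' := by
    calc v s' * epsM F supp i = v s' * (epsM F supp i * v s) * v s' := by rw [mul_assoc, mul_assoc, h1, mul_one]
      _ = _ := by rw [← hc, ← mul_assoc, h2, one_mul]
  have e1 := (ww_coe hik hk h1 h2 hc).1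
  have e2 := (ww_coe hik hk (v := v) (s := .o) (s' := .o) (by simp [ho]) (by simp [ho]) (by simp [ho])).2
  rw [dl, Matrix.SpecialLinearGroup.coe_mul, e1, e2, ho]
  rw [dl_ring, BM_eq, BM_eq, hk, mul_one, mul_one, mul_one]
  · have a1 : BM supp i i 1 * BM supp i i (1 : Matrix T T F) = BM supp i i 1 := by
      rw [BM_eq, one_mul, BM_left]
    have a2 : BM supp k k (epsM F supp i) * BM supp k k (epsM F supp i) = BM supp k k (epsM F supp i) := by
      rw [BM_eq, hk, mul_one, eps_idem]
    have a3 := BM_ne (supp := supp) hik i k 1 (epsM F supp i)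
    have a4 := BM_ne (supp := supp) hik.symm k i (epsM F supp i) 1
    simp only [mul_sub, sub_mul, mul_one, one_mul, a1, a2, a3, a4]; abel
  · rw [sub_mul, sub_mul, BM_eq, BM_ne hik.symm, one_mul, one_mul, BM_left]; abel
  · rw [sub_mul, sub_mul, BM_ne hik, BM_eq, one_mul, hk, mul_one, mul_one, ← mul_one (epsM F supp i)]
    have := BM_right (supp := supp) k i (1 : Matrix T T F)
    rw [one_mul] at this
    rw [mul_one, this]; abel
  · rw [mul_sub, mul_sub, BM_ne hik.symm, BM_eq, mul_one, hk, mul_one, hc, BM_left]; abel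
  · rw [mul_sub, mul_sub, BM_eq, BM_ne hik, mul_one, mul_one, BM_right]; abel
  · exact BM_ne hik.symm _ _ _ _
  · exact BM_ne hik _ _ _ _

/-- Block diagonal matrices. -/
def DG (supp : Q → T → Bool) (A : Q → Matrix T T F) : Matrix (Ind supp) (Ind supp) F :=
  ∑ I, BM supp I I (A I)

theorem DG_apply (A : Q → Matrix T T F) (a b : Ind supp) :
    DG supp A a b = if a.1.1 = b.1.1 then A a.1.1 a.1.2 b.1.2 else 0 := by
  rw [DG, Matrix.sum_apply]
  simp only [BM_apply]
  by_cases h : a.1.1 = b.1.1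
  · rw [if_pos h, Finset.sum_eq_single a.1.1]
    · simp [h]
    · intro I _ hI; rw [if_neg]; exact fun hh => hI hh.1.symm
    · simp
  · rw [if_neg h]
    apply Finset.sum_eq_zero
    intro I _; rw [if_neg]; exact fun hh => h (hh.1.trans hh.2.symm)

theorem DG_mul (A B : Q → Matrix T T F) : DG supp A * DG supp B = DG supp fun I => A I * epsM F supp I * B I := by
  simp only [DG, Finset.sum_mul, Finset.mul_sum, BM_mul]
  simp

theorem DG_one : DG supp (fun _ => (1 : Matrix T T F)) = 1 := by
  ext a b
  rw [DG_apply, Matrix.one_apply, Matrix.one_apply]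
  by_cases h : a = b
  · subst h; simp
  · rw [if_neg h]
    by_cases h1 : a.1.1 = b.1.1
    · rw [if_pos h1, if_neg]; intro h2; exact h (Subtype.ext (Prod.ext h1 h2))
    · rw [if_neg h1]

theorem dl_DG {i k : Q} (hik : i ≠ k) (hk : epsM F supp k = 1) {v : Nm → Matrix T T F} (ho : v .o = 1) {s s' : Nm}
    (h1 : v s * v s' = 1) (h2 : v s' * v s = 1) (hc : v s * epsM F supp i = epsM F supp i * v s) :
    (dl (fun i j s => BX supp i j (v s)) i k s s').1 =
      DG supp fun I => if I = i then v s else if I = k then 1 - epsM F supp i + v s' * epsM F supp i else 1 := by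
  rw [dl_coe hik hk ho h1 h2 hc, ← DG_one]
  ext a b
  simp only [Matrix.add_apply, Matrix.sub_apply, BM_apply, DG_apply]
  by_cases hab : a.1.1 = b.1.1
  · rw [if_pos hab, if_pos hab, ← hab]
    by_cases hi : a.1.1 = i
    · have hk' : ¬ a.1.1 = k := fun h => hik (hi.symm.trans h)
      simp [hi, hik]
    · by_cases hk' : a.1.1 = k
      · simp [hk', hik.symm]
      · simp [hi, hk']
  · rw [if_neg hab, if_neg hab, if_neg, if_neg, if_neg, if_neg]
    · simp
    all_goals exact fun hh => hab (hh.1.trans hh.2.symm)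

end blk

end SLP


set_option linter.unusedSectionVars false
set_option linter.unusedSimpArgs false
set_option linter.unusedVariables false

namespace SLP
open scoped commutatorElement
open Matrix

/-- Programs for the long relations. -/
structure Prog where
  e1 : Ex
  e2 : Ex
  eP : Ex
  eb : Ex
  ec : Ex
  ez : Ex
  l : ℕ

structure Prog.OK {F : Type} [Field F] (E : Prog) (P : Par F) : Prop where
  h1 : E.e1.eval P.tn P.g = 0
  h2 : E.e2.eval P.tn P.g = 0
  hom : ∀ (R : Type) [Ring R] (θ' : R), E.e1.eval P.tn θ' = 0 → E.e2.eval P.tn θ' = 0 →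
        ∃ f : F →+* R, f P.g = θ'
  hP : E.eP.eval P.tn P.g = P.p
  hb : E.eb.eval P.tn P.g = P.z ^ P.m
  hc : E.ec.eval P.tn P.g = P.z ^ (P.m + 1) - P.z ^ P.m
  hz : E.ez.eval P.tn P.g = P.z
  lp : P.p < 2 ^ E.l
  lg : P.g0 < 2 ^ E.l
  lk : P.k < 2 ^ E.l

section long
variable {F : Type} [Field F] (P : Par F) (E : Prog) {Q : Type} (q0 q1 q2 : Q)

/-- The long relations. -/
def LW {Γ : Type} [Group Γ] (x : Q → Q → Nm → Γ) : List (Γ × Γ) :=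
  [(E.e1.val (x q0 q1 .o) (dl x q0 q2 .th .thi) (dl x q0 q2 .ta .tai), 1),
   (E.e2.val (x q0 q1 .o) (dl x q0 q2 .th .thi) (dl x q0 q2 .ta .tai), 1),
   (E.eP.val (x q0 q1 .o) (dl x q0 q2 .th .thi) (dl x q0 q2 .ta .tai), x q0 q1 .P),
   (E.eb.val (x q0 q1 .o) (dl x q0 q2 .th .thi) (dl x q0 q2 .ta .tai), x q0 q1 .zb),
   (E.ec.val (x q0 q1 .o) (dl x q0 q2 .th .thi) (dl x q0 q2 .ta .tai), x q0 q1 .c),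
   (E.ez.val (x q0 q1 .o) (dl x q0 q2 .th .thi) (dl x q0 q2 .ta .tai), x q0 q1 .ze),
   (hw (dl x q0 q2 .h .hi) (dl x q0 q2 .u .ui) E.l P.p * x q0 q1 .o *
      (hw (dl x q0 q2 .h .hi) (dl x q0 q2 .u .ui) E.l P.p)⁻¹, x q0 q1 .o),
   (hw (dl x q0 q2 .h .hi) (dl x q0 q2 .u .ui) E.l P.g0 * x q0 q1 .ka *
      (hw (dl x q0 q2 .h .hi) (dl x q0 q2 .u .ui) E.l P.g0)⁻¹, ⁅x q0 q2 .ka, x q2 q1 .u⁆),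
   (hw (dl x q0 q2 .h .hi) (dl x q0 q2 .u .ui) E.l P.k * x q0 q1 .o *
      (hw (dl x q0 q2 .h .hi) (dl x q0 q2 .u .ui) E.l P.k)⁻¹, x q0 q1 .uk)]

def LR {R : Type} [Ring R] (v : Nm → R) : List (R × R) :=
  [(E.e1.eval P.tn (v .th), 0), (E.e2.eval P.tn (v .th), 0), (E.eP.eval P.tn (v .th), v .P),
   (E.eb.eval P.tn (v .th), v .zb), (E.ec.eval P.tn (v .th), v .c), (E.ez.eval P.tn (v .th), v .ze),
   (v .u ^ P.p, 1), (v .u ^ P.g0 * v .ka, v .ka * v .u), (v .u ^ P.k, v .uk)]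

theorem LW_map {G Γ : Type} [Group G] [Group Γ] (f : G →* Γ) (x : Q → Q → Nm → G) :
    LW P E q0 q1 q2 (fun i j s => f (x i j s)) = (LW P E q0 q1 q2 x).map (Prod.map f f) := by
  simp only [LW, List.map_cons, List.map_nil, Prod.map, Ex.val_map, dl_map, hw_map, map_mul, map_inv, map_one,
    map_commutatorElement]

theorem LW_length {Γ : Type} [Group Γ] (x : Q → Q → Nm → Γ) : (LW P E q0 q1 q2 x).length = 9 := rfl

theorem LW_len {ι : Type} (x : Q → Q → Nm → FreeGroup ι) (hx : ∀ i j s, Len (x i j s) 1) {S : ℕ}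
    (h1 : E.e1.size ≤ S) (h2 : E.e2.size ≤ S) (h3 : E.eP.size ≤ S) (h4 : E.eb.size ≤ S) (h5 : E.ec.size ≤ S)
    (h6 : E.ez.size ≤ S) : ∀ r ∈ LW P E q0 q1 q2 x, Len r.1 (12 * S + 36 * E.l + 1) ∧ Len r.2 4 := by
  have hd : ∀ i k s s', Len (dl x i k s s') 6 := by
    intro i k s s'
    have h : ∀ s s', Len (ww x i k s s') 3 := fun s s' =>
      ((hx i k s).mul (hx k i s').inv).mul (hx i k s)
    exact (h s s').mul (h .o .o).inv
  have hv : ∀ e : Ex, e.size ≤ S → Len (e.val (x q0 q1 .o) (dl x q0 q2 .th .thi) (dl x q0 q2 .ta .tai))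
      (12 * S + 36 * E.l + 1) := by
    intro e he
    exact (e.val_len ((hx _ _ _).mono (by norm_num)) (hd _ _ _ _) (hd _ _ _ _)).mono (by nlinarith)
  have hh : ∀ N s, Len (hw (dl x q0 q2 .h .hi) (dl x q0 q2 .u .ui) E.l N * x q0 q1 s *
      (hw (dl x q0 q2 .h .hi) (dl x q0 q2 .u .ui) E.l N)⁻¹) (12 * S + 36 * E.l + 1) := by
    intro N s
    have := hw_len (hd q0 q2 .h .hi) (hd q0 q2 .u .ui) E.l N
    exact ((this.mul (hx _ _ _)).mul this.inv).mono (by omega)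
  have h4' : ∀ i j s, Len (x i j s) 4 := fun i j s => (hx i j s).mono (by norm_num)
  simp only [LW, List.forall_mem_cons]
  refine ⟨⟨hv _ h1, Len.one⟩, ⟨hv _ h2, Len.one⟩, ⟨hv _ h3, h4' _ _ _⟩, ⟨hv _ h4, h4' _ _ _⟩, ⟨hv _ h5, h4' _ _ _⟩,
    ⟨hv _ h6, h4' _ _ _⟩, ⟨hh _ _, h4' _ _ _⟩, ⟨hh _ _, ?_⟩, ⟨hh _ _, h4' _ _ _⟩, by simp⟩
  rw [commutatorElement_def]
  exact (((hx _ _ _).mul (hx _ _ _)).mul (hx _ _ _).inv).mul (hx _ _ _).inv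

variable {q0 q1 q2} {P} {E}

theorem LW_eval (hE : E.OK P) (hP : P.OK) {R Γ : Type} [Ring R] [Group Γ] {ε : Q → R} {X : Q → Q → R → Γ} (h : GS ε X)
    (h01 : q0 ≠ q1) (h02 : q0 ≠ q2) (h12 : q1 ≠ q2) (h0 : ε q0 = 1) (h2 : ε q2 = 1) {v : Nm → R} (ho : v .o = 1)
    (hr : ∀ r ∈ P.rels, r.1.ev v = r.2.ev v) :
    LW P E q0 q1 q2 (fun i j s => X i j (v s)) = (LR P E v).map (Prod.map (X q0 q1) (X q0 q1)) := by
  simp only [Par.rels, List.forall_mem_cons, RE.ev_add, RE.ev_mul, RE.ev_nm, RE.ev_zero,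
    apply_ite (RE.ev v), ho] at hr
  obtain ⟨r1, r2, r3, r4, r5, r6, r7, r8, r9, r10, r11, r12, r13, r14, rhu, rhe, rke, rek, reue, ree, rtu, rte,
    rde, rd, repe, rep, rye, ryu, rta, -⟩ := hr
  have tn : v .ta = (P.tn : R) := by
    rw [rta]
    rcases hP.tn with h | h
    · rw [if_pos h, h, Nat.cast_one]
    · rw [if_neg (by omega), h]; norm_num
  have hA := fun r => conj_dl h ho h02 h01 h12.symm h0 h2 r10 r
  have hH := fun r => conj_dl h ho h02 h01 h12.symm h0 h2 r12 r
  have hh := fun r => conj_dl h ho h02 h01 h12.symm h0 h2 r4 r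
  have hU := fun r => conj_dl h ho h02 h01 h12.symm h0 h2 r2 r
  rw [tn] at hH
  have hv := fun e : Ex => Ex.val_eq (u := X q0 q1 (v .o)) (h.add h01) (by rw [ho]) hA hH e
  have hw' := hw_conj r3 r4 rhu hh hU E.l
  simp only [LW, LR, List.map_cons, List.map_nil, Prod.map, hv]
  rw [hw' _ hE.lp, hw' _ hE.lg, hw' _ hE.lk, ho, mul_one, mul_one, h.zero h01, h.mulr h2 h02 h12.symm h01]

/-- The long relations hold on the matrix side. -/
theorem LR_val [Fact P.p.Prime] (hE : E.OK P) : ∀ r ∈ LR P E P.val, r.1 = r.2 := by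
  have sc : ∀ c : F, mono (fun t : ZMod P.p => t) (fun _ => c) = Matrix.scalar (ZMod P.p) c := by
    intro c
    ext s t
    rw [mono_apply, Matrix.scalar_apply, Matrix.diagonal_apply]
  have hth : P.val .th = Matrix.scalar (ZMod P.p) P.g := sc _
  have he : ∀ e : Ex, e.eval P.tn (P.val .th) = Matrix.scalar (ZMod P.p) (e.eval P.tn P.g) := by
    intro e; rw [hth, Ex.eval_map]
  have hu : ∀ N : ℕ, P.val .u ^ N = mono (fun t => t + (N : ZMod P.p)) (fun _ => 1) := by
    intro N
    induction N with
    | zero => simp [mono_one]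
    | succ N ih =>
      rw [pow_succ, ih, Par.val, mono_mul]
      apply mono_congr
      · intro t; simp only [Par.mp]; push_cast; ring
      · intro t; simp [Par.mp]
  simp only [LR, List.forall_mem_cons, he, hE.h1, hE.h2, hE.hP, hE.hb, hE.hc, hE.hz, map_zero, hu]
  refine ⟨trivial, trivial, (sc _).symm, (sc _).symm, (sc _).symm, (sc _).symm, ?_, ?_, ?_, by simp⟩
  · simp [mono_one]
  · rw [Par.val, Par.val, mono_mul, mono_mul]
    apply mono_congr
    · intro t; simp only [Par.mp]; ring
    · intro t; simp [Par.mp]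
  · rfl

theorem LR_phi [Fact P.p.Prime] (hE : E.OK P) (hP : P.OK) {R : Type} [Ring R] {v : Nm → R} (ho : v .o = 1)
    (hr : ∀ r ∈ P.rels, r.1.ev v = r.2.ev v) (hl : ∀ r ∈ LR P E v, r.1 = r.2) :
    ∃ φ : Matrix (ZMod P.p) (ZMod P.p) F →+* R, ∀ s, φ (P.val s) = v s := by
  simp only [LR, List.forall_mem_cons] at hl
  obtain ⟨l1, l2, l3, l4, l5, l6, l7, l8, l9, -⟩ := hl
  obtain ⟨f, hf⟩ := hE.hom R _ l1 l2
  have he : ∀ e : Ex, e.eval P.tn (v .th) = f (e.eval P.tn P.g) := by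
    intro e; rw [← hf, Ex.eval_map]
  rw [he] at l3 l4 l5 l6
  refine P.names_phi hP f v ho hr l7 l8.symm l9.symm hf.symm ?_ ?_ ?_ ?_
  · rw [← l3, hE.hP]
  · rw [← l4, hE.hb]
  · rw [← l5, hE.hc]
  · rw [← l6, hE.hz]

end long

theorem Enf.list {G : Type} [Group G] {ι : Type} {γ : ι → G} {L : ℕ} (rs : List (FreeGroup ι × FreeGroup ι)) {l : ℕ}
    (h : ∀ r ∈ rs, Len r.1 L ∧ Len r.2 l) (h' : ∀ r ∈ rs, FreeGroup.lift γ r.1 = FreeGroup.lift γ r.2) :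
    Enf γ rs.length (L + l) fun _ _ γ' => ∀ r ∈ rs, FreeGroup.lift γ' r.1 = FreeGroup.lift γ' r.2 := by
  refine ⟨rs.map fun r => r.1 * r.2⁻¹, by simp, ?_, ?_⟩
  · intro w hw
    obtain ⟨r, hr, rfl⟩ := List.mem_map.1 hw
    exact ⟨(h r hr).1.mul (h r hr).2.inv, by simp [h' r hr]⟩
  · intro Γ _ γ' hw r hr
    have := hw _ (List.mem_map_of_mem hr)
    simpa [mul_inv_eq_one] using this

end SLP


set_option linter.unusedSectionVars false
set_option linter.unusedSimpArgs false
set_option linter.unusedVariables false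

namespace SLP
open scoped commutatorElement
open Matrix

theorem mono_diag {T F : Type} [DecidableEq T] [Field F] (c : T → F) : mono (fun t : T => t) c = diagonal c := by
  ext s t
  rw [mono_apply, Matrix.diagonal_apply]
  split_ifs with h
  · rw [h]
  · rfl

/-- Diagonal case of `dl`. -/
theorem dl_diag {Q T F : Type} [Fintype Q] [DecidableEq Q] [Fintype T] [DecidableEq T] [Field F]
    {supp : Q → T → Bool} {i k : Q} (hik : i ≠ k) (hk : epsM F supp k = 1) {v : Nm → Matrix T T F} (ho : v .o = 1)
    {s s' : Nm} (h1 : v s * v s' = 1) (h2 : v s' * v s = 1) {c c' : T → F} (hs : v s = diagonal c)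
    (hs' : v s' = diagonal c') :
    (dl (fun i j s => BX supp i j (v s)) i k s s').1 = diagonal fun a : Ind supp =>
      if a.1.1 = i then c a.1.2 else if a.1.1 = k then (if supp i a.1.2 = true then c' a.1.2 else 1) else 1 := by
  rw [dl_DG hik hk ho h1 h2 (by rw [hs, epsM, diagonal_mul_diagonal, diagonal_mul_diagonal]; congr 1; ext; ring)]
  have hd : ∀ I, (if I = i then v s else if I = k then 1 - epsM F supp i + v s' * epsM F supp i else 1) =
      diagonal fun t => if I = i then c t else if I = k then (if supp i t = true then c' t else 1) else 1 := by
    intro I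
    split_ifs with h3 h4
    · exact hs
    · rw [hs', epsM, diagonal_mul_diagonal, ← diagonal_one, diagonal_sub, diagonal_add]
      congr 1; ext t; split_ifs <;> simp
    · rw [diagonal_one]
  ext a b
  rw [DG_apply, hd, diagonal_apply, diagonal_apply]
  by_cases h : a = b
  · subst h; simp
  · rw [if_neg h]
    by_cases h3 : a.1.1 = b.1.1
    · rw [if_pos h3, if_neg]; intro h4; exact h (Subtype.ext (Prod.ext h3 h4))
    · rw [if_neg h3]

theorem em_self {F : Type} [Field F] (g : Fˣ) : (em (show (0 : Fin 2) ≠ 1 by simp) (hM g) : SL (Fin 2) F) = hM g := by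
  apply Subtype.ext
  rw [em_hM, hM_coe]
  ext a b; fin_cases a <;> fin_cases b <;> simp

theorem hM_conj01 {F : Type} [Field F] (g : Fˣ) (r : F) :
    hM g * tv 0 1 r * (hM g)⁻¹ = tv 0 1 ((g : F) * g * r) := by
  have := em_hM_conj (I := Fin 2) (k := 0) (l := 1) (i := 0) (j := 1) (by simp) (by simp) g r
  rw [em_self] at this
  rw [this]
  simp [wt, pow_two, zpow_two]

theorem hM_conj10 {F : Type} [Field F] (g : Fˣ) (r : F) :
    (hM g)⁻¹ * tv 1 0 r * (hM g)⁻¹⁻¹ = tv 1 0 ((g : F) * g * r) := by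
  have := em_hM_conj (I := Fin 2) (k := 0) (l := 1) (i := 1) (j := 0) (by simp) (by simp) g ((g : F) * g * r)
  rw [em_self] at this
  have h2 : (((g ^ wt (0 : Fin 2) 1 1 0 : Fˣ) : F)) * ((g : F) * g * r) = r := by
    simp [wt]; field_simp
  rw [h2] at this
  rw [← this]; group

section cfg
variable {F : Type} [Field F] {P : Par F} [Fact P.p.Prime] {Q : Type} [Fintype Q] [DecidableEq Q]

/-- A block configuration. -/
structure Cfg (P : Par F) [Fact P.p.Prime] (supp : Q → ZMod P.p → Bool) (reg : Q → Prop) (epN : Q → Nm)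
    (q0 q1 q2 : Q) : Prop where
  ok : P.OK
  fresh : Fresh reg
  ep : ∀ j, epsM F supp j = P.val (epN j)
  reg1 : ∀ j, reg j → epN j = .o
  rs : ∀ j, reg j → ∀ t, supp j t = true
  r0 : reg q0
  r1 : reg q1
  r2 : reg q2
  h01 : q0 ≠ q1
  h02 : q0 ≠ q2
  h12 : q1 ≠ q2

variable {supp : Q → ZMod P.p → Bool} {reg : Q → Prop} {epN : Q → Nm} {q0 q1 q2 : Q}

theorem Cfg.e1 (c : Cfg P supp reg epN q0 q1 q2) (j) (hj : reg j) : epsM F supp j = 1 := by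
  rw [c.ep, c.reg1 j hj, P.val_o]

def Cfg.a0 (c : Cfg P supp reg epN q0 q1 q2) : Ind supp := ⟨(q0, 0), c.rs _ c.r0 0⟩
def Cfg.b0 (c : Cfg P supp reg epN q0 q1 q2) : Ind supp := ⟨(q1, 0), c.rs _ c.r1 0⟩

theorem Cfg.hab (c : Cfg P supp reg epN q0 q1 q2) : c.a0 ≠ c.b0 := fun h => c.h01 (congrArg (fun a => a.1.1) h)

/-- The generators. -/
def Cfg.gam (c : Cfg P supp reg epN q0 q1 q2) {ι2 : Type} (γ2 : ι2 → SL (Fin 2) F) :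
    (Q × Q × Nm) ⊕ ι2 → SL (Ind supp) F :=
  Sum.elim (fun t => BX supp t.1 t.2.1 (P.val t.2.2)) (fun i => em c.hab (γ2 i))

theorem Par.val_e : P.val .e = Matrix.single 0 0 1 := by
  ext s t
  show (if s = t then (if t = 0 then (1 : F) else 0) else 0) = _
  rw [Matrix.single_apply, ← ite_and]
  congr 1
  exact propext ⟨fun ⟨h1, h2⟩ => ⟨(h1.trans h2).symm, h2.symm⟩, fun ⟨h1, h2⟩ => ⟨h1.symm.trans h2, h2.symm⟩⟩

theorem Par.th_single (r : F) : P.val .th * Matrix.single 0 0 r = Matrix.single 0 0 (P.g * r) := by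
  have : P.val .th = diagonal fun _ => P.g := mono_diag _
  rw [this]
  ext s t
  rw [Matrix.diagonal_mul, Matrix.single_apply, Matrix.single_apply]
  split_ifs <;> simp

theorem Cfg.dl_comm (c : Cfg P supp reg epN q0 q1 q2) {i k : Q} (hik : i ≠ k) (hk : reg k) (g : Fˣ) :
    em c.hab (hM g) * dl (fun i j s => BX supp i j (P.val s)) i k .th .thi =
      dl (fun i j s => BX supp i j (P.val s)) i k .th .thi * em c.hab (hM g) := by
  have hv := P.val_rels c.ok
  simp only [Par.rels, List.forall_mem_cons, RE.ev_mul, RE.ev_nm, P.val_o] at hv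
  obtain ⟨v1, v2, v3, v4, v5, v6, v7, v8, v9, v10, -⟩ := hv
  apply Subtype.ext
  rw [Matrix.SpecialLinearGroup.coe_mul, Matrix.SpecialLinearGroup.coe_mul, em_hM,
    dl_diag hik (c.e1 k hk) P.val_o v9 v10 (mono_diag _) (mono_diag _), diagonal_mul_diagonal, diagonal_mul_diagonal]
  congr 1; ext a; ring

theorem Cfg.gamma (c : Cfg P supp reg epN q0 q1 q2) {E : Prog} (hE : E.OK P) {ι2 : Type} (γ2 : ι2 → SL (Fin 2) F)
    (g : Fˣ) (hg : (g : F) = P.g) (i1 i2 i3 i4 i5 : ι2) (hi1 : γ2 i1 = tv 0 1 1) (hi2 : γ2 i2 = tv 0 1 (g : F))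
    (hi3 : γ2 i3 = tv 1 0 1) (hi4 : γ2 i4 = tv 1 0 (g : F)) (hi5 : γ2 i5 = hM g)
    {Γ : Type} [Group Γ] (γ' : (Q × Q × Nm) ⊕ ι2 → Γ) (hs : Short (c.gam γ2) 1000 γ')
    (ψ2 : SL (Fin 2) F →* Γ) (hψ2 : ∀ i, ψ2 (γ2 i) = γ' (Sum.inr i))
    (hl : ∀ r ∈ LW P E q0 q1 q2 (fun i j s => γ' (Sum.inl (i, j, s))), r.1 = r.2) :
    ∃ ψ : SL (Ind supp) F →* Γ, ∀ i, ψ (c.gam γ2 i) = γ' i := by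
  have N0 : ∀ i j s, Near (c.gam γ2) γ' 1 (BX supp i j (P.val s)) (γ' (Sum.inl (i, j, s))) := fun i j s =>
    Near.of (Sum.inl (i, j, s))
  have N2 : ∀ i, Near (c.gam γ2) γ' 1 (em c.hab (γ2 i)) (ψ2 (γ2 i)) := fun i => by
    rw [hψ2]; exact Near.of (Sum.inr i)
  have gs := BX_gs (F := F) (supp := supp)
  have hv := P.val_rels c.ok
  have km : KM reg Nm.o (fun i j s => γ' (Sum.inl (i, j, s))) := by
    refine ⟨?_, ?_, ?_⟩
    · intro i j k l h1 h2 h3 h4 r s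
      exact ((N0 i j r).mul (N0 k l s)).unique hs ((N0 k l s).mul (N0 i j r)) (gs.comm h1 h2 h3 h4 _ _) (by norm_num)
    · intro i j k hj h1 h2 h3 r
      refine ((N0 i j r).comm (N0 j k .o)).unique hs (N0 i k r) ?_ (by norm_num)
      rw [← commutatorElement_def, gs.mulr (c.e1 j hj) h1 h2 h3, P.val_o, mul_one]
    · intro i j k hj h1 h2 h3 r
      refine ((N0 i j .o).comm (N0 j k r)).unique hs (N0 i k r) ?_ (by norm_num)
      rw [← commutatorElement_def, gs.mulr (c.e1 j hj) h1 h2 h3, P.val_o, one_mul]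
  obtain ⟨R, _, nm, X, no, hX, hXn, hfa⟩ := km.ring c.fresh epN c.reg1 (by
    intro i j k h1 h2 h3
    refine ((N0 i j .o).comm (N0 j k .o)).unique hs (N0 i k (epN j)) ?_ (by norm_num)
    rw [← commutatorElement_def, gs.mul h1 h2 h3, P.val_o, mul_one, one_mul, c.ep])
  have er : ∀ j, reg j → nm (epN j) = 1 := fun j hj => by rw [c.reg1 j hj, no]
  have N1 : ∀ i j, i ≠ j → ∀ s, Near (c.gam γ2) γ' 1 (BX supp i j (P.val s)) (X i j (nm s)) := by
    intro i j hij s; rw [hXn i j hij]; exact N0 i j s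
  have rels : ∀ r ∈ P.rels, r.1.ev nm = r.2.ev nm := by
    intro r hr
    apply hfa
    intro i j hij
    have n1 := GS.near c.fresh gs hX c.e1 er N1 r.1 i j hij
    have n2 := GS.near c.fresh gs hX c.e1 er N1 r.2 i j hij
    have := P.rels_size r hr
    exact n1.unique hs n2 (by rw [hv r hr]) (by omega)
  have faith : ∀ r s, X q0 q1 r = X q0 q1 s → r = s := fun r s h =>
    hfa r s (GS.spread c.fresh hX er c.h01 c.r0 c.r1 h)
  have LWe := LW_eval hE c.ok hX c.h01 c.h02 c.h12 (er _ c.r0) (er _ c.r2) no rels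
  have LWx : LW P E q0 q1 q2 (fun i j s => X i j (nm s)) = LW P E q0 q1 q2 (fun i j s => γ' (Sum.inl (i, j, s))) := by
    have e02 := hXn _ _ c.h02
    have e20 := hXn _ _ c.h02.symm
    have e01 := hXn _ _ c.h01
    have e21 := hXn _ _ c.h12.symm
    simp only [LW, dl, ww, e02, e20, e01, e21]
  obtain ⟨φ, hφ⟩ := LR_phi hE c.ok no rels (by
    intro r hr
    apply faith
    have : Prod.map (X q0 q1) (X q0 q1) r ∈ LW P E q0 q1 q2 (fun i j s => γ' (Sum.inl (i, j, s))) := by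
      rw [← LWx, LWe]; exact List.mem_map_of_mem hr
    exact hl _ this)
  have hY : GS (epsM F supp) (fun i j A => X i j (φ A)) := hX.comap φ fun j => by rw [c.ep, hφ]
  have Ndl : ∀ {i k}, i ≠ k → ∀ s s', Near (c.gam γ2) γ' 6 (dl (fun i j s => BX supp i j (P.val s)) i k s s')
      (dl (fun i j s => X i j (nm s)) i k s s') := fun hik s s' => Near.dl hik N1 s s'
  have th10 : nm .thi * nm .th = 1 := by
    have := rels (RE.nm .thi * RE.nm .th, RE.nm .o) (by simp [Par.rels])
    rw [← no]; exact this
  have th10' : P.val .thi * P.val .th = 1 := by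
    have := hv (RE.nm .thi * RE.nm .th, RE.nm .o) (by simp [Par.rels])
    rw [← P.val_o]; exact this
  -- agreement with the small group
  have hgg : ∀ t : F, t ≠ 0 → ∃ j : ℕ, t = (g : F) ^ j := by rw [hg]; exact c.ok.hg
  have s1 : ∀ r : F, BX supp q0 q1 (single 0 0 r) = em c.hab (tv 0 1 r) := fun r => by
    rw [em_tv01]; exact BX_single c.a0 c.b0 c.h01 r
  have s2 : ∀ r : F, BX supp q1 q0 (single 0 0 r) = em c.hab (tv 1 0 r) := fun r => by
    rw [em_tv10]; exact BX_single c.b0 c.a0 c.h01.symm r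
  have dY : ∀ {i k j}, i ≠ k → i ≠ j → k ≠ j → reg i → reg k → ∀ r : F,
      dl (fun i j s => X i j (nm s)) i k .th .thi * X i j (φ (single 0 0 r)) *
        (dl (fun i j s => X i j (nm s)) i k .th .thi)⁻¹ = X i j (φ (single 0 0 (P.g * r))) := by
    intro i k j h1 h2 h3 hi hk r
    rw [conj_dl hX no h1 h2 h3 (er i hi) (er k hk) th10, ← hφ, ← map_mul, Par.th_single]
  have dG : ∀ {i k j}, i ≠ k → i ≠ j → k ≠ j → reg i → reg k → ∀ r : F,
      dl (fun i j s => BX supp i j (P.val s)) i k .th .thi * BX supp i j (single 0 0 r) *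
        (dl (fun i j s => BX supp i j (P.val s)) i k .th .thi)⁻¹ = BX supp i j (single 0 0 (P.g * r)) := by
    intro i k j h1 h2 h3 hi hk r
    rw [conj_dl gs P.val_o h1 h2 h3 (c.e1 i hi) (c.e1 k hk) th10', Par.th_single]
  have Ne : ∀ i j, i ≠ j → Near (c.gam γ2) γ' 1 (BX supp i j (single 0 0 1)) (X i j (φ (single 0 0 1))) := by
    intro i j hij
    rw [← Par.val_e, hφ]; exact N1 i j hij .e
  have Nh : Near (c.gam γ2) γ' 1 (em c.hab (hM g)) (ψ2 (hM g)) := by rw [← hi5]; exact N2 i5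
  have hM01 : ∀ r : F, hM g * tv 0 1 r * (hM g)⁻¹ = tv 0 1 ((g : F) * g * r) := hM_conj01 g
  have hM10 : ∀ r : F, (hM g)⁻¹ * tv 1 0 r * (hM g)⁻¹⁻¹ = tv 1 0 ((g : F) * g * r) := hM_conj10 g
  have A1 : ∀ r : F, ψ2 (tv 0 1 r) = X q0 q1 (φ (single 0 0 r)) := by
    refine fam_agree hgg (a := fun r => ψ2 (tv 0 1 r)) (b := fun r => X q0 q1 (φ (single 0 0 r)))
      (h := ψ2 (hM g)) (d := dl (fun i j s => X i j (nm s)) q0 q2 .th .thi) ?_ ?_ ?_ ?_ ?_ ?_ ?_ ?_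
    · simp [tv_stein.zero]
    · simp [hX.zero c.h01]
    · intro r; rw [← hM01, map_mul, map_mul, map_inv]
    · intro r; rw [hg]; exact dY c.h02 c.h01 c.h12.symm c.r0 c.r2 r
    · rw [← hi1]
      exact (N2 i1).unique hs (Ne _ _ c.h01) (by rw [hi1, s1]) (by norm_num)
    · rw [← hi2]
      refine (N2 i2).unique hs (y' := X q0 q1 (φ (single 0 0 (g : F)))) ?_ (x' := BX supp q0 q1 (single 0 0 (g : F))) 
        (by rw [hi2, s1]) (l := 13) (by norm_num)
      have := (Ndl c.h02 .th .thi).conj (Ne _ _ c.h01)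
      rw [dY c.h02 c.h01 c.h12.symm c.r0 c.r2, dG c.h02 c.h01 c.h12.symm c.r0 c.r2, mul_one, ← hg] at this
      exact this
    · refine (Nh.conj (Ne _ _ c.h01)).unique hs
        (((Ndl c.h02 .th .thi).mul (Ndl c.h02 .th .thi)).conj (Ne _ _ c.h01)) ?_ (by norm_num)
      have e1 : ∀ d b : SL (Ind supp) F, d * d * b * (d * d)⁻¹ = d * (d * b * d⁻¹) * d⁻¹ := by intro d b; group
      rw [e1, dG c.h02 c.h01 c.h12.symm c.r0 c.r2, dG c.h02 c.h01 c.h12.symm c.r0 c.r2, s1, s1, ← map_inv, ← map_mul,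
        ← map_mul, hM01, ← hg, mul_assoc]
    · exact (Nh.mul (Ndl c.h02 .th .thi)).unique hs ((Ndl c.h02 .th .thi).mul Nh) (c.dl_comm c.h02 c.r2 g) (by norm_num)
  have A2 : ∀ r : F, ψ2 (tv 1 0 r) = X q1 q0 (φ (single 0 0 r)) := by
    have h10 := c.h01.symm
    refine fam_agree hgg (a := fun r => ψ2 (tv 1 0 r)) (b := fun r => X q1 q0 (φ (single 0 0 r)))
      (h := (ψ2 (hM g))⁻¹) (d := dl (fun i j s => X i j (nm s)) q1 q2 .th .thi) ?_ ?_ ?_ ?_ ?_ ?_ ?_ ?_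
    · simp [tv_stein.zero]
    · simp [hX.zero h10]
    · intro r; rw [← hM10, map_mul, map_mul, map_inv ψ2 (hM g)⁻¹, map_inv ψ2 (hM g)]
    · intro r; rw [hg]; exact dY c.h12 h10 c.h02.symm c.r1 c.r2 r
    · rw [← hi3]
      exact (N2 i3).unique hs (Ne _ _ h10) (by rw [hi3, s2]) (by norm_num)
    · rw [← hi4]
      refine (N2 i4).unique hs (y' := X q1 q0 (φ (single 0 0 (g : F)))) ?_ (x' := BX supp q1 q0 (single 0 0 (g : F))) 
        (by rw [hi4, s2]) (l := 13) (by norm_num)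
      have := (Ndl c.h12 .th .thi).conj (Ne _ _ h10)
      rw [dY c.h12 h10 c.h02.symm c.r1 c.r2, dG c.h12 h10 c.h02.symm c.r1 c.r2, mul_one, ← hg] at this
      exact this
    · refine (Nh.inv.conj (Ne _ _ h10)).unique hs
        (((Ndl c.h12 .th .thi).mul (Ndl c.h12 .th .thi)).conj (Ne _ _ h10)) ?_ (by norm_num)
      have e1 : ∀ d b : SL (Ind supp) F, d * d * b * (d * d)⁻¹ = d * (d * b * d⁻¹) * d⁻¹ := by intro d b; group
      rw [e1, dG c.h12 h10 c.h02.symm c.r1 c.r2, dG c.h12 h10 c.h02.symm c.r1 c.r2, s2, s2, ← map_inv (em c.hab) (hM g), ← map_inv (em c.hab) (hM g)⁻¹,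
        ← map_mul, ← map_mul, hM10, ← hg, mul_assoc]
    · refine (Nh.inv.mul (Ndl c.h12 .th .thi)).unique hs ((Ndl c.h12 .th .thi).mul Nh.inv) ?_ (by norm_num)
      exact (show Commute _ _ from c.dl_comm c.h12 c.r2 g).inv_left
  -- normalisation
  have nl : ∀ I J, I ≠ J → X I J (φ (epsM F supp I)) = X I J 1 := by
    intro I J hIJ
    rw [c.ep, hφ, ← no]
    refine (N1 I J hIJ _).unique hs (N1 I J hIJ _) ?_ (by norm_num)
    rw [← c.ep, P.val_o, ← BX_left hIJ 1, mul_one]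
  have nr : ∀ I J, I ≠ J → X I J (φ (epsM F supp J)) = X I J 1 := by
    intro I J hIJ
    rw [c.ep, hφ, ← no]
    refine (N1 I J hIJ _).unique hs (N1 I J hIJ _) ?_ (by norm_num)
    rw [← c.ep, P.val_o, ← BX_right hIJ 1, one_mul]
  obtain ⟨ψ, hψ⟩ := block_hom hY (fun a b d e f => by
      obtain ⟨k, hk, hh⟩ := c.fresh a b d e f
      exact ⟨k, c.rs k hk, hh⟩)
    (by
      intro I J hIJ A
      obtain ⟨k, hk, k1, k2, -⟩ := c.fresh I J I I I
      rw [map_mul, ← hX.mulr (er k hk) k1.symm k2 hIJ, nl _ _ k1.symm, hX.mulr (er k hk) k1.symm k2 hIJ, one_mul])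
    (by
      intro I J hIJ A
      obtain ⟨k, hk, k1, k2, -⟩ := c.fresh I J I I I
      rw [map_mul, ← hX.mulr (er k hk) k1.symm k2 hIJ, nr _ _ k2, hX.mulr (er k hk) k1.symm k2 hIJ, mul_one])
    c.a0 c.b0 c.h01 ψ2 A1 A2
  have hem : ψ.comp (em c.hab) = ψ2 := by
    have : (ψ.comp (em c.hab)).eqLocus ψ2 = ⊤ := by
      refine tv_gen2 _ (fun r => ?_) fun r => ?_
      · change ψ (em _ _) = _
        rw [← s1, hψ _ _ c.h01, A1]
      · change ψ (em _ _) = _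
        rw [← s2, hψ _ _ c.h01.symm, A2]
    ext1 x
    have h2 : x ∈ (ψ.comp (em c.hab)).eqLocus ψ2 := by rw [this]; trivial
    exact h2
  refine ⟨ψ, fun i => ?_⟩
  rcases i with ⟨i, j, s⟩ | i
  · by_cases hij : i = j
    · subst hij
      have h1 : c.gam γ2 (Sum.inl (i, i, s)) = 1 := by simp [Cfg.gam, BX]
      rw [h1, map_one]
      exact (Near.one (k := 1)).unique hs (Near.of (Sum.inl (i, i, s))) h1.symm (by norm_num)
    · have := hψ i j hij (P.val s)
      simp only [hφ, hXn i j hij] at this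
      exact this
  · rw [← hψ2, ← hem]; rfl

end cfg

end SLP


set_option linter.unusedSectionVars false
set_option linter.unusedSimpArgs false
set_option linter.unusedVariables false

namespace SLP
open scoped commutatorElement
open Matrix

section cfg
variable {F : Type} [Field F] {P : Par F} [Fact P.p.Prime] {Q : Type} [Fintype Q] [DecidableEq Q]
variable {supp : Q → ZMod P.p → Bool} {reg : Q → Prop} {epN : Q → Nm} {q0 q1 q2 : Q}

theorem Cfg.pres (c : Cfg P supp reg epN q0 q1 q2) {E : Prog} (hE : E.OK P) {ι2 : Type} [Fintype ι2]
    (γ2 : ι2 → SL (Fin 2) F)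
    (g : Fˣ) (hg : (g : F) = P.g) (i1 i2 i3 i4 i5 : ι2) (hi1 : γ2 i1 = tv 0 1 1) (hi2 : γ2 i2 = tv 0 1 (g : F))
    (hi3 : γ2 i3 = tv 1 0 1) (hi4 : γ2 i4 = tv 1 0 (g : F)) (hi5 : γ2 i5 = hM g)
    {C L S N : ℕ} (h2 : Pres γ2 C L) (hN : Fintype.card ((Q × Q × Nm) ⊕ ι2) ≤ N)
    (h1 : E.e1.size ≤ S) (h2' : E.e2.size ≤ S) (h3 : E.eP.size ≤ S) (h4 : E.eb.size ≤ S) (h5 : E.ec.size ≤ S)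
    (h6 : E.ez.size ≤ S) :
    Pres (c.gam γ2) (C + (2 * N + 1) ^ 1000 + 9) (L + 1000 + (12 * S + 36 * E.l + 1 + 4)) := by
  have k1 := Enf.map (γ2 := c.gam γ2) Sum.inr (em c.hab) (fun _ => rfl) h2
  have k2 := Enf.short (γ := c.gam γ2) 1000
  let x : Q → Q → Nm → FreeGroup ((Q × Q × Nm) ⊕ ι2) := fun i j s => FreeGroup.of (Sum.inl (i, j, s))
  have lm : ∀ {Γ : Type} [Group Γ] (γ' : (Q × Q × Nm) ⊕ ι2 → Γ),
      LW P E q0 q1 q2 (fun i j s => γ' (Sum.inl (i, j, s))) =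
        (LW P E q0 q1 q2 x).map (Prod.map (FreeGroup.lift γ') (FreeGroup.lift γ')) := by
    intro Γ _ γ'
    rw [← LW_map]
    simp [x]
  have k3 := Enf.list (γ := c.gam γ2) (LW P E q0 q1 q2 x)
    (LW_len P E q0 q1 q2 x (fun i j s => Len.of _) h1 h2' h3 h4 h5 h6) (by
      intro r hr
      have hm : Prod.map (FreeGroup.lift (c.gam γ2)) (FreeGroup.lift (c.gam γ2)) r ∈
          LW P E q0 q1 q2 (fun i j s => c.gam γ2 (Sum.inl (i, j, s))) := by
        rw [lm]; exact List.mem_map_of_mem hr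
      have e := LW_eval (q0 := q0) (q1 := q1) (q2 := q2) hE c.ok (BX_gs (F := F) (supp := supp)) c.h01 c.h02 c.h12 (c.e1 _ c.r0) (c.e1 _ c.r2)
        P.val_o (P.val_rels c.ok)
      have hm' : Prod.map (FreeGroup.lift (c.gam γ2)) (FreeGroup.lift (c.gam γ2)) r ∈
          LW P E q0 q1 q2 (fun i j s => BX supp i j (P.val s)) := hm
      rw [e] at hm'
      obtain ⟨r', hr', he⟩ := List.mem_map.1 hm'
      have := LR_val hE r' hr'
      have e1 := congrArg Prod.fst he
      have e2 := congrArg Prod.snd he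
      simp only [Prod.map] at e1 e2
      rw [← e1, ← e2, this])
  rw [LW_length] at k3
  refine (((k1.mono le_rfl (show _ ≤ L + 1000 + (12 * S + 36 * E.l + 1 + 4) by omega) fun _ _ _ h => h).and
      (k2.mono le_rfl (show 1000 ≤ L + 1000 + (12 * S + 36 * E.l + 1 + 4) by omega) fun _ _ _ h => h)).and
      (k3.mono le_rfl (show _ ≤ L + 1000 + (12 * S + 36 * E.l + 1 + 4) by omega) fun _ _ _ h => h)).mono
      (by gcongr) le_rfl ?_
  rintro Γ _ γ' ⟨⟨⟨ψ2, hψ2⟩, hs⟩, hl⟩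
  refine c.gamma hE γ2 g hg i1 i2 i3 i4 i5 hi1 hi2 hi3 hi4 hi5 γ' hs ψ2 hψ2 ?_
  rw [lm]
  intro r hr
  obtain ⟨r', hr', rfl⟩ := List.mem_map.1 hr
  exact hl r' hr'

theorem Par.u_single (a b : ZMod P.p) (r : F) : P.val .u * Matrix.single a b r = Matrix.single (a + 1) b r := by
  ext s t
  rw [Matrix.mul_apply, Finset.sum_eq_single a]
  · simp only [Matrix.single_apply, Par.val, mono_apply, Par.mp, eq_comm (a := a + 1)]
    by_cases h1 : s = a + 1 <;> by_cases h2 : b = t <;> simp [h1, h2]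
  · intro x _ hx; rw [Matrix.single_apply, if_neg, mul_zero]; exact fun h => hx h.1.symm
  · simp

theorem Par.single_u (a b : ZMod P.p) (r : F) : Matrix.single a b r * P.val .u = Matrix.single a (b - 1) r := by
  ext s t
  rw [Matrix.mul_apply, Finset.sum_eq_single b]
  · have : b = t + 1 ↔ b - 1 = t := by constructor <;> intro h <;> linear_combination h
    simp only [Matrix.single_apply, Par.val, mono_apply, Par.mp, this]
    by_cases h1 : a = s <;> by_cases h2 : b - 1 = t <;> simp [h1, h2]
  · intro x _ hx; rw [Matrix.single_apply, if_neg, zero_mul]; exact fun h => hx h.2.symm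
  · simp

theorem Cfg.gen (c : Cfg P supp reg epN q0 q1 q2) {ι2 : Type} (γ2 : ι2 → SL (Fin 2) F) :
    Subgroup.closure (Set.range (c.gam γ2)) = ⊤ := by
  obtain ⟨H, hH⟩ : ∃ H, H = Subgroup.closure (Set.range (c.gam γ2)) := ⟨_, rfl⟩
  rw [← hH]
  have cm : ∀ a b : SL (Ind supp) F, a ∈ H → b ∈ H → ⁅a, b⁆ ∈ H := fun a b ha hb =>
    H.mul_mem (H.mul_mem (H.mul_mem ha hb) (H.inv_mem ha)) (H.inv_mem hb)
  have gs := BX_gs (F := F) (supp := supp)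
  have nm : ∀ s I J, I ≠ J → BX supp I J (P.val s) ∈ H := by
    intro s I J _
    rw [hH]; exact Subgroup.subset_closure ⟨Sum.inl (I, J, s), rfl⟩
  have mul : ∀ A B, (∀ I J, I ≠ J → BX supp I J A ∈ H) → (∀ I J, I ≠ J → BX supp I J B ∈ H) →
      ∀ I J, I ≠ J → BX supp I J (A * B) ∈ H := by
    intro A B hA hB I J hIJ
    obtain ⟨k, hk, k1, k2, -⟩ := c.fresh I J I I I
    rw [← gs.mulr (c.e1 k hk) k1.symm k2 hIJ]
    exact cm _ _ (hA _ _ k1.symm) (hB _ _ k2)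
  have s0 : ∀ r : F, ∀ I J, I ≠ J → BX supp I J (Matrix.single 0 0 r) ∈ H := by
    intro r
    by_cases hr : r = 0
    · intro I J hIJ
      rw [hr, Matrix.single_zero, gs.zero hIJ]; exact H.one_mem
    · obtain ⟨j, rfl⟩ := c.ok.hg r hr
      clear hr
      induction j with
      | zero => rw [pow_zero, ← Par.val_e]; exact nm .e
      | succ j ih => rw [pow_succ', ← Par.th_single]; exact mul _ _ (nm _) ih
  have sa : ∀ (r : F) (a : ℕ), ∀ I J, I ≠ J → BX supp I J (Matrix.single (a : ZMod P.p) 0 r) ∈ H := by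
    intro r a
    induction a with
    | zero => rw [Nat.cast_zero]; exact s0 r
    | succ a ih => rw [Nat.cast_succ, ← Par.u_single]; exact mul _ _ (nm _) ih
  have sb : ∀ (r : F) (a : ZMod P.p) (b : ℕ), ∀ I J, I ≠ J → BX supp I J (Matrix.single a (-(b : ZMod P.p)) r) ∈ H := by
    intro r a b
    induction b with
    | zero =>
      have := sa r a.val
      rw [ZMod.natCast_zmod_val] at this
      rw [Nat.cast_zero, neg_zero]; exact this
    | succ b ih =>
      have e : -((b + 1 : ℕ) : ZMod P.p) = -(b : ZMod P.p) - 1 := by push_cast; ring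
      rw [e, ← Par.single_u]; exact mul _ _ ih (nm _)
  have sab : ∀ (r : F) (a b : ZMod P.p), ∀ I J, I ≠ J → BX supp I J (Matrix.single a b r) ∈ H := by
    intro r a b
    have := sb r a (-b).val
    rw [ZMod.natCast_zmod_val, neg_neg] at this
    exact this
  have t1 : ∀ a b : Ind supp, a.1.1 ≠ b.1.1 → ∀ r : F, tv a b r ∈ H := by
    intro a b h r
    rw [← BX_single a b h]; exact sab _ _ _ _ _ h
  have : Nontrivial (Ind supp) := ⟨⟨_, _, c.hab⟩⟩
  refine tv_gen _ fun a b hab r => ?_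
  by_cases h : a.1.1 = b.1.1
  · obtain ⟨k, hk, k1, k2, -⟩ := c.fresh a.1.1 b.1.1 a.1.1 a.1.1 a.1.1
    let d : Ind supp := ⟨(k, 0), c.rs k hk 0⟩
    have d1 : a.1.1 ≠ d.1.1 := k1.symm
    have d2 : d.1.1 ≠ b.1.1 := k2
    have := (tv_stein (F := F)).mul (i := a) (j := d) (k := b) (fun h => d1 (by rw [h])) (fun h => d2 (by rw [h])) hab r 1
    rw [mul_one] at this
    rw [← this]
    exact cm _ _ (t1 _ _ d1 _) (t1 _ _ d2 _)
  · exact t1 a b h r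

theorem Cfg.dgW (c : Cfg P supp reg epN q0 q1 q2) :
    (⁅dl (fun i j s => BX supp i j (P.val s)) q1 q2 .y .yi, dl (fun i j s => BX supp i j (P.val s)) q1 q0 .u .ui⁆ :
      SL (Ind supp) F).1 = diagonal fun a => if a.1.1 = q1 then P.W a.1.2.val else 1 := by
  have hv := P.val_rels c.ok
  simp only [Par.rels, List.forall_mem_cons, RE.ev_add, RE.ev_mul, RE.ev_nm, P.val_o] at hv
  obtain ⟨r1, r2, r3, r4, r5, r6, r7, r8, r9, r10, r11, r12, r13, r14, rhu, rhe, rke, rek, reue, ree, rtu, rte,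
    rde, rd, repe, rep, rye, ryu, rta, -⟩ := hv
  have hW : P.val .zb + P.val .c * P.val .ep = diagonal fun t => P.W t.val := by
    have a1 : P.val .zb = diagonal fun _ => P.z ^ P.m := mono_diag _
    have a2 : P.val .c = diagonal fun _ => P.z ^ (P.m + 1) - P.z ^ P.m := mono_diag _
    have a3 : P.val .ep = diagonal fun t => if t.val < P.k then 1 else 0 := mono_diag _
    rw [a1, a2, a3, diagonal_mul_diagonal, diagonal_add]
    rfl
  rw [hW] at ryu
  have e1 : epsM F supp q1 = 1 := c.e1 _ c.r1
  have hM := dl_DG (supp := supp) c.h12 (c.e1 _ c.r2) P.val_o r7 r8 (by rw [e1, mul_one, one_mul])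
  have hN := dl_DG (supp := supp) c.h01.symm (c.e1 _ c.r0) P.val_o r1 r2 (by rw [e1, mul_one, one_mul])
  obtain ⟨M, hMd⟩ : ∃ M, M = dl (fun i j s => BX supp i j (P.val s)) q1 q2 .y .yi := ⟨_, rfl⟩
  obtain ⟨N, hNd⟩ : ∃ N, N = dl (fun i j s => BX supp i j (P.val s)) q1 q0 .u .ui := ⟨_, rfl⟩
  rw [← hMd] at hM ⊢
  rw [← hNd] at hN ⊢
  have hX : (diagonal fun a : Ind supp => if a.1.1 = q1 then P.W a.1.2.val else 1) =
      DG supp fun I => if I = q1 then diagonal fun t => P.W t.val else 1 := by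
    ext a b
    rw [DG_apply, diagonal_apply]
    by_cases h : a = b
    · subst h; by_cases h2 : a.1.1 = q1 <;> simp [h2]
    · rw [if_neg h]
      by_cases h3 : a.1.1 = b.1.1
      · have h4 : a.1.2 ≠ b.1.2 := fun h4 => h (Subtype.ext (Prod.ext h3 h4))
        rw [if_pos h3]
        split_ifs <;> simp [h4]
      · rw [if_neg h3]
  have key : (diagonal fun a : Ind supp => if a.1.1 = q1 then P.W a.1.2.val else 1) * (N * M).1 = (M * N).1 := by
    rw [hX, Matrix.SpecialLinearGroup.coe_mul, Matrix.SpecialLinearGroup.coe_mul, hM, hN, DG_mul, DG_mul, DG_mul]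
    congr 1
    ext1 I
    by_cases h1 : I = q1
    · simp only [h1, if_true, e1, mul_one]
      rw [ryu, Matrix.mul_assoc]
    · by_cases h2 : I = q2
      · simp [h2, c.h12.symm, c.h02.symm, c.e1 _ c.r2, e1]
      · by_cases h0 : I = q0
        · simp [h0, c.h01, c.h02, c.e1 _ c.r0, e1]
        · simp [h1, h2, h0, eps_idem]
  have : ⁅M, N⁆ = M * N * (N * M)⁻¹ := by rw [commutatorElement_def]; group
  rw [this, Matrix.SpecialLinearGroup.coe_mul, ← key, Matrix.mul_assoc, ← Matrix.SpecialLinearGroup.coe_mul,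
    mul_inv_cancel, Matrix.SpecialLinearGroup.coe_one, mul_one]

theorem Cfg.zreach (c : Cfg P supp reg epN q0 q1 q2) {ι2 : Type} (γ2 : ι2 → SL (Fin 2) F)
    (hm : ∀ t, (Finset.univ.filter fun i => supp i t = true).card = P.m + if t.val < P.k then 1 else 0)
    (z : SL (Ind supp) F) (hz : z.1 = scalar (Ind supp) P.z) : Reach (c.gam γ2) (Fintype.card Q * 6 + 24) z := by
  have hx : ∀ i j s, Reach (c.gam γ2) 1 (BX supp i j (P.val s)) := fun i j s => Reach.of (Sum.inl (i, j, s))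
  have hd : ∀ i k s s', Reach (c.gam γ2) 6 (dl (fun i j s => BX supp i j (P.val s)) i k s s') := by
    intro i k s s'
    have h : ∀ s s', Reach (c.gam γ2) 3 (ww (fun i j s => BX supp i j (P.val s)) i k s s') := fun s s' =>
      ((hx i k s).mul (hx k i s').inv).mul (hx i k s)
    exact (h s s').mul (h .o .o).inv
  have hv := P.val_rels c.ok
  simp only [Par.rels, List.forall_mem_cons, RE.ev_mul, RE.ev_nm, P.val_o] at hv
  obtain ⟨v1, v2, v3, v4, v5, v6, v7, v8, v9, v10, v11, v12, v13, v14, -⟩ := hv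
  have z0 := c.ok.z0
  have key : ∀ S : Finset Q, q1 ∉ S → ∃ M : SL (Ind supp) F, Reach (c.gam γ2) (S.card * 6) M ∧ M.1 =
      diagonal fun a => if a.1.1 ∈ S then P.z else if a.1.1 = q1 then
        (P.z ^ (S.filter fun i => supp i a.1.2 = true).card)⁻¹ else 1 := by
    intro S
    induction S using Finset.induction_on with
    | empty => intro _; exact ⟨1, Reach.one, by ext a b; simp [diagonal_apply, Matrix.one_apply]⟩
    | insert a S ha ih =>
      intro h0
      rw [Finset.mem_insert, not_or] at h0
      obtain ⟨M, h1, h2⟩ := ih h0.2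
      refine ⟨M * dl (fun i j s => BX supp i j (P.val s)) a q1 .ze .zei, ?_, ?_⟩
      · rw [Finset.card_insert_of_notMem ha]
        exact (h1.mul (hd _ _ _ _)).mono (by rw [add_mul, one_mul])
      · rw [val_mul, h2, dl_diag (Ne.symm h0.1) (c.e1 _ c.r1) P.val_o v13 v14 (mono_diag _) (mono_diag _),
          diagonal_mul_diagonal]
        congr 1; ext i
        by_cases hi : i.1.1 = a
        · simp [hi, ha, h0.1, Ne.symm h0.1, Par.mp]
        · by_cases hi0 : i.1.1 = q1
          · by_cases hs : supp a i.1.2 = true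
            · have e : ((insert a S).filter fun i' => supp i' i.1.2 = true).card =
                  (S.filter fun i' => supp i' i.1.2 = true).card + 1 := by
                rw [Finset.filter_insert, if_pos hs, Finset.card_insert_of_notMem (by simp [ha])]
              rw [e]
              simp [h0.2, hi, Ne.symm hi, hi0, h0.1, hs, pow_succ, mul_comm, Par.mp]
            · rw [Finset.filter_insert, if_neg hs]
              simp [h0.2, hi, Ne.symm hi, hi0, h0.1, hs, Par.mp]
          · simp [hi, hi0, Ne.symm hi, Ne.symm hi0]
  obtain ⟨M, h1, h2⟩ := key (Finset.univ.erase q1) (by simp)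
  have : z = M * ⁅dl (fun i j s => BX supp i j (P.val s)) q1 q2 .y .yi, dl (fun i j s => BX supp i j (P.val s)) q1 q0 .u .ui⁆ := by
    apply Subtype.ext
    rw [val_mul, c.dgW, h2, hz, scalar_apply, diagonal_mul_diagonal]
    congr 1; ext a
    by_cases ha : a.1.1 = q1
    · simp only [ha, Finset.mem_erase, ne_eq, not_true_eq_false, false_and, if_false, if_true]
      have : ((Finset.univ.erase q1).filter fun i => supp i a.1.2 = true).card + 1 =
          P.m + if a.1.2.val < P.k then 1 else 0 := by
        rw [← hm, Finset.filter_erase, Finset.card_erase_add_one]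
        simp [c.rs _ c.r1]
      rw [P.W_eq, ← this, pow_succ, ← mul_assoc, inv_mul_cancel₀ (pow_ne_zero _ z0), one_mul]
    · simp [ha]
  rw [this]
  refine (h1.mul ((((hd q1 q2 .y .yi).mul (hd q1 q0 .u .ui)).mul (hd q1 q2 .y .yi).inv).mul (hd q1 q0 .u .ui).inv)).mono ?_
  have : (Finset.univ.erase q1).card ≤ Fintype.card Q := Finset.card_le_univ _
  omega

end cfg

end SLP


set_option linter.unusedSectionVars false
set_option linter.unusedSimpArgs false
set_option linter.unusedVariables false

namespace SLP
open scoped commutatorElement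
open Matrix

/-- Reindexing. -/
def reix {I J F : Type} [Fintype I] [DecidableEq I] [Fintype J] [DecidableEq J] [Field F] (e : I ≃ J) :
    SL I F ≃* SL J F where
  toFun A := ⟨A.1.submatrix e.symm e.symm, by rw [Matrix.det_submatrix_equiv_self, A.2]⟩
  invFun A := ⟨A.1.submatrix e e, by rw [Matrix.det_submatrix_equiv_self, A.2]⟩
  left_inv A := by apply Subtype.ext; simp [Matrix.submatrix_submatrix]
  right_inv A := by apply Subtype.ext; simp [Matrix.submatrix_submatrix]
  map_mul' A B := by
    apply Subtype.ext
    show (A.1 * B.1).submatrix e.symm e.symm = A.1.submatrix e.symm e.symm * B.1.submatrix e.symm e.symm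
    rw [Matrix.submatrix_mul_equiv]

theorem Pres.equiv {G G' ι : Type} [Group G] [Group G'] {γ : ι → G} {C L : ℕ} (h : Pres γ C L) (Φ : G ≃* G') :
    Pres (fun i => Φ (γ i)) C L := by
  refine (Enf.map (γ2 := fun i => Φ (γ i)) id Φ.toMonoidHom (fun _ => rfl) h).mono le_rfl le_rfl ?_
  rintro Γ _ γ' ⟨ψ, hψ⟩
  refine ⟨ψ.comp Φ.symm.toMonoidHom, fun i => ?_⟩
  simpa using hψ i

theorem exists_p (n : ℕ) (hn : 1000 ≤ n) (c : ℕ) : ∃ p, p.Prime ∧ p ≠ c ∧ p ≠ 2 ∧ 25 ≤ n / p ∧ n / p < 100 := by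
  obtain ⟨p1, h1, h2, h3⟩ := Nat.exists_prime_lt_and_le_two_mul (n / 100) (by omega)
  obtain ⟨p2, h4, h5, h6⟩ := Nat.exists_prime_lt_and_le_two_mul (2 * (n / 100)) (by omega)
  have key : ∀ p : ℕ, n / 100 < p → p ≤ 4 * (n / 100) → p ≠ 2 ∧ 25 ≤ n / p ∧ n / p < 100 := by
    intro p a b
    refine ⟨by omega, ?_, ?_⟩
    · rw [Nat.le_div_iff_mul_le (by omega)]; omega
    · rw [Nat.div_lt_iff_lt_mul (by omega)]; omega
  by_cases h : p1 = c
  · exact ⟨p2, h4, by omega, key p2 (by omega) (by omega)⟩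
  · exact ⟨p1, h1, h, key p1 (by omega) (by omega)⟩

theorem arith28 (C0 a b : ℕ) : C0 * (1 + b) + 1000 + (12 * (200 * b) + 36 * (a + 1) + 1 + 4) + 624 + 1 ≤
    (C0 + 10000) * (1 + a + b) := by
  nlinarith [Nat.zero_le (C0 * a)]

theorem good_large : ∃ C, ∀ n, 1000 ≤ n → Good C n := by
  obtain ⟨C0, hC0⟩ := sl2_named 5
  obtain ⟨N, hN⟩ : ∃ N, N = 220000 + (C0 + 5) := ⟨_, rfl⟩
  refine ⟨C0 + (2 * N + 1) ^ 1000 + 9 + N + 1 + 10000, ?_⟩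
  intro n hn F _ _ z hz
  classical
  obtain ⟨c, hc⟩ := CharP.exists F
  have hcp : c.Prime := (CharP.char_is_prime_or_zero F c).resolve_right (fun h0 => by
    subst h0
    have := CharP.charP_to_charZero F
    exact not_finite F)
  have : Fact c.Prime := ⟨hcp⟩
  obtain ⟨p, hp, hpc, hp2, hm25, hm100⟩ := exists_p n hn c
  obtain ⟨ζ, hζ, hs⟩ := Matrix.SpecialLinearGroup.mem_center_iff.1 hz
  rw [Fintype.card_fin] at hζ
  have ζ0 : ζ ≠ 0 := by
    rintro rfl
    rw [zero_pow (by omega)] at hζ; exact zero_ne_one hζ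
  obtain ⟨g, hg, -⟩ := exists_gen (F := F)
  have : Fact p.Prime := ⟨hp⟩
  obtain ⟨w, hw, -⟩ := exists_gen (F := ZMod p)
  let P : Par F := ⟨p, n % p, (w : ZMod p).val, n / p, tau c, g, ζ⟩
  have : Fact P.p.Prime := ⟨hp⟩
  have hgF : ∀ {K : Type} [Field K] (u : Kˣ), (∀ t : Kˣ, ∃ k : ℕ, t = u ^ k) → ∀ t : K, t ≠ 0 → ∃ j : ℕ, t = (u : K) ^ j := by
    intro K _ u hu t ht
    obtain ⟨k, hk⟩ := hu (Units.mk0 t ht)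
    exact ⟨k, by simpa using congrArg Units.val hk⟩
  have hmk : P.m * P.p + P.k = n := by
    show n / p * p + n % p = n
    rw [mul_comm]; exact Nat.div_add_mod n p
  have ok : P.OK := by
    refine ⟨?_, hp2, Nat.mod_lt _ hp.pos, ?_, ?_, ?_, ?_, hgF g hg, g.ne_zero, ζ0, ?_⟩
    · show ((p : ℕ) : F) ≠ 0
      rw [Ne, CharP.cast_eq_zero_iff F c, Nat.prime_dvd_prime_iff_eq hcp hp]
      exact fun h => hpc h.symm
    · intro t ht
      show ∃ j : ℕ, t = (((w : ZMod p).val : ℕ) : ZMod p) ^ j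
      rw [ZMod.natCast_zmod_val]
      exact hgF w hw t ht
    · show (((w : ZMod p).val : ℕ) : ZMod p) ≠ 0
      rw [ZMod.natCast_zmod_val]; exact w.ne_zero
    · show tau c = 1 ∨ tau c = 4
      unfold tau; split_ifs <;> simp
    · show ((tau c : ℕ) : F) ≠ 0
      unfold tau
      split_ifs with h
      · simp
      · rw [Ne, CharP.cast_eq_zero_iff F c]
        intro h4
        have : c ∣ 2 ^ 2 := h4
        exact h ((Nat.prime_dvd_prime_iff_eq hcp Nat.prime_two).1 (hcp.dvd_of_dvd_pow this))
    · rw [hmk]; exact hζ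
  obtain ⟨fp1, e1, e2, se1, se2, ev1, ev2, ehom⟩ := field_prog (F := F) (g : F)
    (closure_top_of_gen hg _ (Subring.subset_closure rfl)) c
  obtain ⟨eP, sP, hP⟩ := fp1 (P.p : F)
  obtain ⟨eb, sb, hb⟩ := fp1 (P.z ^ P.m)
  obtain ⟨ec, sc, hec⟩ := fp1 (P.z ^ (P.m + 1) - P.z ^ P.m)
  obtain ⟨ez, sz, hez⟩ := fp1 P.z
  let E : Prog := ⟨e1, e2, eP, eb, ec, ez, Nat.log 2 p + 1⟩
  have pl : p < 2 ^ (Nat.log 2 p + 1) := Nat.lt_pow_succ_log_self (by norm_num) p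
  have hE : E.OK P := ⟨ev1, ev2, ehom, hP, hb, hec, hez, pl, (ZMod.val_lt _).trans pl, (Nat.mod_lt _ hp.pos).trans pl⟩
  -- the configuration
  obtain ⟨m, hm⟩ : ∃ m, m = n / p := ⟨_, rfl⟩
  let Q := Option (Fin m)
  let supp : Q → ZMod P.p → Bool := fun q t => q.isSome || decide (t.val < P.k)
  let q0 : Q := some ⟨0, by omega⟩
  let q1 : Q := some ⟨1, by omega⟩
  let q2 : Q := some ⟨2, by omega⟩
  have cfg : Cfg P supp (fun q => q.isSome = true) (fun q => if q.isSome = true then .o else .ep) q0 q1 q2 := by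
    refine ⟨ok, ?_, ?_, ?_, ?_, rfl, rfl, rfl, ?_, ?_, ?_⟩
    · intro a b c d e
      have : ({a, b, c, d, e} : Finset Q).card < (Finset.univ.image (some : Fin m → Q)).card := by
        rw [Finset.card_image_of_injective _ (Option.some_injective _), Finset.card_univ, Fintype.card_fin]
        have := Finset.card_le_five (a := a) (b := b) (c := c) (d := d) (e := e)
        omega
      obtain ⟨k, hk, hk'⟩ := Finset.exists_mem_notMem_of_card_lt_card this
      obtain ⟨x, -, rfl⟩ := Finset.mem_image.1 hk
      simp only [Finset.mem_insert, Finset.mem_singleton, not_or] at hk'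
      exact ⟨some x, rfl, hk'⟩
    · intro j
      rcases j with _ | j
      · have a3 : P.val .ep = diagonal fun t => if t.val < P.k then 1 else 0 := mono_diag _
        simp [a3, epsM, supp]
      · simp [epsM, supp, P.val_o]
    · intro j hj; simp [hj]
    · intro j hj t; simp [supp, hj]
    all_goals exact fun h => absurd (congrArg Fin.val (Option.some.inj h)) (by norm_num)
  have cnt : ∀ t, (Finset.univ.filter fun i => supp i t = true).card = P.m + if t.val < P.k then 1 else 0 := by
    intro t
    rw [Finset.card_filter, Fintype.sum_option]
    simp [supp]
    rw [add_comm, hm]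
  have crd : Fintype.card (Ind supp) = n := by
    rw [Fintype.card_subtype, Finset.card_filter, Fintype.sum_prod_type_right]
    have : ∀ t, (∑ q : Q, if supp q t = true then 1 else 0) = P.m + if t.val < P.k then 1 else 0 := fun t => by
      rw [← cnt, Finset.card_filter]
    simp only [this]
    rw [Finset.sum_add_distrib, Finset.sum_const, Finset.card_univ, ZMod.card, ← Finset.card_filter, smul_eq_mul,
      mul_comm]
    have h2 : (Finset.univ.filter fun t : ZMod P.p => t.val < P.k).card = P.k := by
      conv_rhs => rw [← Finset.card_range P.k]
      have hkp := ok.hk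
      refine Finset.card_nbij' (fun t => t.val) (fun j => (j : ZMod P.p)) ?_ ?_ ?_ ?_
      · intro t ht; simpa using ht
      · intro j hj
        have hj' : j < P.k := by simpa using hj
        simp [ZMod.val_natCast_of_lt (hj'.trans hkp), hj']
      · intro t ht; simp
      · intro j hj
        have hj' : j < P.k := by simpa using hj
        simp [ZMod.val_natCast_of_lt (hj'.trans hkp)]
    rw [h2, hmk]
  let Φ : SL (Ind supp) F ≃* SL (Fin n) F := reix (Fintype.equivFinOfCardEq crd)
  let δ : Fin 5 → SL (Fin 2) F := ![tv 0 1 1, tv 0 1 (g : F), tv 1 0 1, tv 1 0 (g : F), hM g]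
  obtain ⟨ι, _, γ0, b1, b2, b3⟩ := hC0 F (Fin 5) δ (by simp)
  have cQ : Fintype.card Q ≤ 100 := by simp [Q]; omega
  have cNm : Fintype.card Nm = 22 := rfl
  have cN : Fintype.card ((Q × Q × Nm) ⊕ (ι ⊕ Fin 5)) ≤ N := by
    rw [Fintype.card_sum, Fintype.card_prod, Fintype.card_prod, Fintype.card_sum, Fintype.card_fin, cNm, hN]
    have : Fintype.card Q * (Fintype.card Q * 22) ≤ 100 * (100 * 22) :=
      Nat.mul_le_mul cQ (Nat.mul_le_mul_right _ cQ)
    omega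
  have pr := cfg.pres hE (Sum.elim γ0 δ) g rfl (Sum.inr 0) (Sum.inr 1) (Sum.inr 2) (Sum.inr 3) (Sum.inr 4)
    rfl rfl rfl rfl rfl b2 cN (S := 200 * Nat.log 2 (Fintype.card F)) se1 se2 (sP.trans (by omega)) (sb.trans (by omega))
    (sc.trans (by omega)) (sz.trans (by omega))
  obtain ⟨z', hz'⟩ : ∃ z', z = Φ z' := ⟨Φ.symm z, by simp⟩
  have zr := cfg.zreach (Sum.elim γ0 δ) cnt z' (by
    have e1 : z' = Φ.symm z := by rw [hz']; simp
    have e2 : z'.1 = z.1.submatrix (Fintype.equivFinOfCardEq crd) (Fintype.equivFinOfCardEq crd) := by rw [e1]; rfl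
    have e3 : z.1 = scalar (Fin n) ζ := hs.symm
    rw [e2, e3, scalar_apply, scalar_apply, Matrix.submatrix_diagonal_equiv]
    rfl)
  have ex := (pr.mono le_rfl (Nat.le_add_right _ 624)).extend (fun _ : Unit => z') fun _ => zr.mono (by omega)
  refine ⟨_ ⊕ Unit, inferInstance, _, Sum.inr (), ?_, (ex.equiv Φ).mono ?_ ?_, hz'.symm, ?_⟩
  · rw [Fintype.card_sum, Fintype.card_unit]; omega
  · simp only [Fintype.card_unit]; omega
  · have hlp : E.l ≤ Nat.log 2 n + 1 := by
      show Nat.log 2 p + 1 ≤ _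
      have : p ≤ n := by
        by_contra h
        rw [Nat.div_eq_of_lt (by omega)] at hm25
        omega
      exact Nat.add_le_add_right (Nat.log_mono_right this) 1
    obtain ⟨M, hM⟩ : ∃ M, M = (2 * N + 1) ^ 1000 := ⟨_, rfl⟩
    rw [← hM]
    obtain ⟨a, ha⟩ : ∃ a, a = Nat.log 2 n := ⟨_, rfl⟩
    obtain ⟨b, hb⟩ : ∃ b, b = Nat.log 2 (Fintype.card F) := ⟨_, rfl⟩
    rw [← ha] at hlp
    rw [← ha, ← hb]
    calc _ ≤ C0 * (1 + b) + 1000 + (12 * (200 * b) + 36 * (a + 1) + 1 + 4) + 624 + 1 := by omega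
      _ ≤ (C0 + 10000) * (1 + a + b) := arith28 C0 a b
      _ ≤ _ := Nat.mul_le_mul_right _ (by omega)
  · have : Set.range (fun i => Φ (Sum.elim (cfg.gam (Sum.elim γ0 δ)) (fun _ : Unit => z') i)) =
      Φ.toMonoidHom '' Set.range (Sum.elim (cfg.gam (Sum.elim γ0 δ)) (fun _ : Unit => z')) := by
      rw [← Set.range_comp]; rfl
    rw [this, ← MonoidHom.map_closure]
    have top : Subgroup.closure (Set.range (Sum.elim (cfg.gam (Sum.elim γ0 δ)) (fun _ : Unit => z'))) = ⊤ := by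
      rw [eq_top_iff, ← cfg.gen (Sum.elim γ0 δ)]
      apply Subgroup.closure_mono
      rintro _ ⟨i, rfl⟩
      exact ⟨Sum.inl i, rfl⟩
    rw [top, Subgroup.map_top_of_surjective _ Φ.surjective]

theorem good_all : ∃ C, ∀ n, 2 ≤ n → Good C n := by
  obtain ⟨C1, h1⟩ := good_two
  obtain ⟨C2, h2⟩ := good_large
  have h3 : ∀ n, ∃ C, 3 ≤ n → Good C n := fun n => by
    by_cases h : 3 ≤ n
    · obtain ⟨C, hC⟩ := good_small n h; exact ⟨C, fun _ => hC⟩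
    · exact ⟨0, fun h' => absurd h' h⟩
  choose f hf using h3
  refine ⟨C1 + C2 + ∑ n ∈ Finset.range 1000, f n, fun n hn => ?_⟩
  by_cases a : n = 2
  · subst a; exact h1.mono (by omega)
  by_cases b : 1000 ≤ n
  · exact (h2 n b).mono (by omega)
  · refine (hf n (by omega)).mono ?_
    have := Finset.single_le_sum (f := f) (fun i _ => Nat.zero_le _) (Finset.mem_range.2 (show n < 1000 by omega))
    omega

end SLP

theorem SL_mod_center_subgroup_short_bounded_presentation :
    ∃ C : ℕ, ∀ (n : ℕ), 2 ≤ n → ∀ (F : Type) [Field F] [Fintype F],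
      ∀ (Z : Subgroup (Matrix.SpecialLinearGroup (Fin n) F))
        (hZ : Z ≤ Subgroup.center (Matrix.SpecialLinearGroup (Fin n) F)),
        @HasBoundedPresentation (Matrix.SpecialLinearGroup (Fin n) F ⧸ Z)
          (@QuotientGroup.Quotient.group _ _ Z (normal_of_le_center hZ)) C C
          (C * (1 + Real.logb 2 n + Real.logb 2 (Fintype.card F))) := by
  obtain ⟨C, hC⟩ := SLP.good_all
  exact ⟨_, fun n hn F _ _ Z hZ => (hC n hn).final hn F Z hZ⟩
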